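/- Let t ≥ 3 be an odd integer that is neither a Gold number 2^k + 1 nor a Kasami–Welch number 2^{2k} − 2^k + 1 for any k ≥ 1. Then the monomial function f(x) = x^t is not exceptional APN: there are only finitely many m ≥ 1 such that x ↦ x^t is APN on F_{2^m}. -/

import Mathlib

/-- `g` is almost perfect nonlinear (APN) on the field `K`: for all `a ≠ 0` and all `b`,
the equation `g(x+a) + g(x) = b` has at most two solutions. -/
def IsAPN {K : Type} [Field K] (g : K → K) : Prop :=
  ∀ a b : K, a ≠ 0 → {x : K | g (x + a) + g x = b}.ncard ≤ 2


section
open Polynomial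

namespace HM

section Val
variable {k Ω : Type} [Field k] [Field Ω]

lemma exists_val (ι : k →+* Ω) (T : Ω) (hT : ∀ p : k[X], p.eval₂ ι T = 0 → p = 0) :
    ∃ B : ValuationSubring Ω, (∀ c : k, c ≠ 0 → B.valuation (ι c) = 1) ∧ B.valuation T < 1 := by
  let A : Subring Ω := (eval₂RingHom ι T).range
  have hTA : T ∈ A := ⟨X, by simp⟩
  let T' : A := ⟨T, hTA⟩
  have hI : Ideal.span {T'} ≠ ⊤ := by
    intro h
    rw [Ideal.eq_top_iff_one, Ideal.mem_span_singleton'] at h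
    obtain ⟨⟨a, p, hp⟩, h⟩ := h
    have h1 : a * T = 1 := congrArg Subtype.val h
    have h2 : (p * X - 1 : k[X]) = 0 := by
      apply hT
      simp only [coe_eval₂RingHom] at hp
      simp [eval₂_mul, eval₂_sub, hp, h1]
    have h3 := congrArg (eval 0) h2
    simp at h3
  obtain ⟨B, hAB, hB⟩ := Ideal.image_subset_nonunits_valuationSubring (Ideal.span {T'}) hI
  have hle : ∀ c : k, B.valuation (ι c) ≤ 1 := by
    intro c
    rw [ValuationSubring.valuation_le_one_iff]
    exact hAB ⟨C c, by simp⟩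
  refine ⟨B, ?_, ?_⟩
  · intro c hc
    apply le_antisymm (hle c)
    have h1 := hle c⁻¹
    rw [map_inv₀, map_inv₀] at h1
    have hne : B.valuation (ι c) ≠ 0 := by simp [hc]
    exact (inv_le_one₀ (zero_lt_iff.mpr hne)).mp h1
  · have : T ∈ B.nonunits := hB ⟨T', Ideal.mem_span_singleton_self _, rfl⟩
    exact B.mem_nonunits_iff.mp this

variable {Γ : Type} [LinearOrderedCommGroupWithZero Γ] (v : Valuation Ω Γ) (ι : k →+* Ω)

lemma val_poly_le (hv : ∀ c : k, c ≠ 0 → v (ι c) = 1) (p : k[X]) {z : Ω} (hz : v z ≤ 1) :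
    v (p.eval₂ ι z) ≤ 1 := by
  rw [eval₂_eq_sum_range]
  apply v.map_sum_le
  intro i _
  rw [map_mul, map_pow]
  have h1 : v (ι (p.coeff i)) ≤ 1 := by
    by_cases h : p.coeff i = 0
    · simp [h]
    · exact (hv _ h).le
  exact mul_le_one' h1 (pow_le_one' hz i)

/-- values of polynomials near a point -/
lemma val_poly_near (hv : ∀ c : k, c ≠ 0 → v (ι c) = 1) (p : k[X]) (hp : p ≠ 0) {z : Ω} {c : k}
    (hz : v (z - ι c) < 1) :
    v (p.eval₂ ι z) = v (z - ι c) ^ (p.rootMultiplicity c) := by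
  obtain ⟨r, hr, hr2⟩ := exists_eq_pow_rootMultiplicity_mul_and_not_dvd p hp c
  have hz1 : v z ≤ 1 := by
    have : z = (z - ι c) + ι c := by ring
    rw [this]
    refine v.map_add_le hz.le ?_
    by_cases h : c = 0
    · simp [h]
    · exact (hv _ h).le
  conv_lhs => rw [hr]
  rw [eval₂_mul, eval₂_pow, map_mul, map_pow]
  have h1 : v (r.eval₂ ι z) = 1 := by
    have h2 : r.eval c ≠ 0 := fun h => hr2 (dvd_iff_isRoot.mpr h)
    have h3 : r = (X - C c) * (r /ₘ (X - C c)) + C (r.eval c) := by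
      rw [← modByMonic_X_sub_C_eq_C_eval, add_comm, modByMonic_add_div]
    have h4 : r.eval₂ ι z = ι (r.eval c) + (z - ι c) * (r /ₘ (X - C c)).eval₂ ι z := by
      conv_lhs => rw [h3]
      simp [eval₂_add, eval₂_mul, add_comm]
    rw [h4, v.map_add_eq_of_lt_left]
    · exact hv _ h2
    · rw [hv _ h2, map_mul]
      exact mul_lt_one_of_lt_of_le hz (val_poly_le v ι hv _ hz1)
  simp [h1]

lemma val_poly_far (hv : ∀ c : k, c ≠ 0 → v (ι c) = 1) (p : k[X]) (hp : p ≠ 0) {z : Ω}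
    (hz : 1 < v z) : v (p.eval₂ ι z) = v z ^ p.natDegree := by
  have h0 : v (ι p.leadingCoeff * z ^ p.natDegree) = v z ^ p.natDegree := by
    rw [map_mul, hv _ (leadingCoeff_ne_zero.mpr hp), one_mul, map_pow]
  have h1 : v (p.eraseLead.eval₂ ι z) < v z ^ p.natDegree := by
    rw [eval₂_eq_sum_range]
    apply v.map_sum_lt
    · exact pow_ne_zero _ (zero_lt_one.trans hz).ne'
    intro i _
    by_cases h : p.eraseLead.coeff i = 0
    · simp only [h, map_zero, zero_mul]
      exact zero_lt_iff.mpr (pow_ne_zero _ (zero_lt_one.trans hz).ne')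
    · rw [map_mul, hv _ h, one_mul, map_pow]
      apply pow_lt_pow_right₀ hz
      exact eraseLead_natDegree_lt_or_eraseLead_eq_zero p |>.elim
        (fun h' => (le_natDegree_of_ne_zero h).trans_lt h') (fun h' => by simp [h'] at h)
  have h2 : p.eval₂ ι z = ι p.leadingCoeff * z ^ p.natDegree + p.eraseLead.eval₂ ι z := by
    have h3 := congrArg (eval₂ ι z) p.eraseLead_add_C_mul_X_pow
    rw [eval₂_add] at h3
    rw [← h3, add_comm]
    simp
  rw [h2, v.map_add_eq_of_lt_left, h0]
  rw [h0]; exact h1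

end Val
end HM

end

section
open Polynomial

namespace HM

section Poly
variable {k : Type} [Field k] [CharP k 2]

noncomputable def gp (k : Type) [Field k] (Q l : ℕ) : k[X] := (X + 1) ^ (Q * l + 1) + X ^ (Q * l + 1)
noncomputable def hc (k : Type) [Field k] (l : ℕ) : k[X] := (X + 1) ^ l + X ^ l
def al {k : Type} [Field k] (Q l : ℕ) (z : k) : k := (z + 1) ^ (Q * (l - 1) + 1) + z ^ (Q * (l - 1) + 1)
def be {k : Type} [Field k] (Q l : ℕ) (z : k) : k := (z + 1) ^ (Q * (l - 1)) + z ^ (Q * (l - 1))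

lemma add_pow_Q {R : Type} [CommRing R] [CharP R 2] (i : ℕ) (a b : R) :
    (a + b) ^ (2 ^ i) = a ^ (2 ^ i) + b ^ (2 ^ i) := by
  haveI : Fact (Nat.Prime 2) := ⟨Nat.prime_two⟩
  exact add_pow_char_pow a b 2 i

lemma cast_odd {R : Type} [CommRing R] [CharP R 2] {l : ℕ} (hl : Odd l) : (l : R) = 1 := by
  obtain ⟨m, rfl⟩ := hl
  have : (2 : R) = 0 := CharTwo.two_eq_zero
  push_cast
  rw [this]; ring

lemma pow_expansion {R : Type} [CommRing R] [CharP R 2] (i : ℕ) {l : ℕ} (hl : Odd l) (z : R) :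
    ∃ H : R[X], (X + C z) ^ (2 ^ i * l + 1) = C (z ^ (2 ^ i * l + 1)) + C (z ^ (2 ^ i * l)) * X
      + C (z ^ (2 ^ i * (l - 1) + 1)) * X ^ (2 ^ i) + C (z ^ (2 ^ i * (l - 1))) * X ^ (2 ^ i + 1)
      + X ^ (2 * 2 ^ i) * H := by
  obtain ⟨K, hK⟩ := Polynomial.powAddExpansion (C (z ^ (2 ^ i)) : R[X]) (X ^ (2 ^ i)) l
  refine ⟨K * (X + C z), ?_⟩
  have h1 : (l : R[X]) = 1 := cast_odd hl
  rw [pow_succ, pow_mul, add_pow_Q, add_comm (X ^ 2 ^ i), ← C_pow, hK, h1]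
  simp only [pow_mul, pow_succ, C_mul, C_pow]
  ring

variable {i l : ℕ}

lemma g_expansion (hl : Odd l) (z : k) :
    ∃ H : k[X], (gp k (2 ^ i) l).comp (X + C z) = C ((gp k (2 ^ i) l).eval z)
      + C ((hc k l).eval z ^ (2 ^ i)) * X
      + C (al (2 ^ i) l z) * X ^ (2 ^ i) + C (be (2 ^ i) l z) * X ^ (2 ^ i + 1)
      + X ^ (2 * 2 ^ i) * H := by
  obtain ⟨H1, h1⟩ := pow_expansion i hl z
  obtain ⟨H2, h2⟩ := pow_expansion i hl (z + 1)
  refine ⟨H1 + H2, ?_⟩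
  have h3 : (X + C z + 1 : k[X]) = X + C (z + 1) := by simp [add_assoc]
  have h4 : (gp k (2 ^ i) l).comp (X + C z) = (X + C (z + 1)) ^ (2 ^ i * l + 1) + (X + C z) ^ (2 ^ i * l + 1) := by
    rw [← h3]; simp [gp]
  have h5 : (hc k l).eval z ^ (2 ^ i) = (z + 1) ^ (2 ^ i * l) + z ^ (2 ^ i * l) := by
    simp only [hc, eval_add, eval_pow, eval_X, eval_one]
    rw [add_pow_Q, ← pow_mul, ← pow_mul, mul_comm l]
  have h6 : (gp k (2 ^ i) l).eval z = (z + 1) ^ (2 ^ i * l + 1) + z ^ (2 ^ i * l + 1) := by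
    simp only [gp, eval_add, eval_pow, eval_X, eval_one]
  rw [h4, h1, h2, h5, h6, al, be]
  generalize z + 1 = z'
  simp only [C_add]
  ring

lemma derivative_gp (hl : Odd l) (hi : 1 ≤ i) : derivative (gp k (2 ^ i) l) = hc k l ^ (2 ^ i) := by
  have h : ((2 ^ i * l + 1 : ℕ) : k[X]) = 1 := by
    apply cast_odd
    obtain ⟨j, rfl⟩ : ∃ j, i = j + 1 := ⟨i - 1, by omega⟩
    rw [pow_succ]
    exact ⟨2 ^ j * l, by ring⟩
  have h' : C ((2 ^ i * l + 1 : ℕ) : k) = (1 : k[X]) := by rw [← h]; exact C_eq_natCast _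
  rw [gp, derivative_add, derivative_pow, derivative_pow, h']
  rw [hc, add_pow_Q, ← pow_mul, ← pow_mul, mul_comm l]
  simp

lemma natDegree_sub_aux (hl : Odd l) (hl3 : 3 ≤ l) :
    ((X + 1) ^ l + X ^ l + X ^ (l - 1) : k[X]).natDegree ≤ l - 2 := by
  rw [natDegree_le_iff_coeff_eq_zero]
  intro N hN
  simp only [coeff_add, coeff_X_add_one_pow, coeff_X_pow]
  rcases lt_trichotomy N l with h | h | h
  · have : N = l - 1 := by omega
    subst this
    have h2 : l.choose (l - 1) = l := by
      rw [Nat.choose_symm_of_eq_add (show l = (l - 1) + 1 by omega)]; simp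
    rw [h2, cast_odd hl]
    simp [h.ne, CharTwo.add_self_eq_zero]
  · subst h
    have : N ≠ N - 1 := by omega
    simp [this, CharTwo.add_self_eq_zero]
  · have h1 : N ≠ l - 1 := by omega
    simp [h.ne', h1, Nat.choose_eq_zero_of_lt h]

lemma hc_monic (hl : Odd l) (hl3 : 3 ≤ l) : (hc k l).Monic ∧ (hc k l).natDegree = l - 1 := by
  have h1 := natDegree_sub_aux (k := k) hl hl3
  have h2 : hc k l = X ^ (l - 1) + ((X + 1) ^ l + X ^ l + X ^ (l - 1)) := by
    have : (X ^ (l - 1) + X ^ (l - 1) : k[X]) = 0 := CharTwo.add_self_eq_zero _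
    rw [hc]; linear_combination - this
  have h3 : degree ((X + 1) ^ l + X ^ l + X ^ (l - 1) : k[X]) < degree (X ^ (l - 1) : k[X]) := by
    rw [degree_X_pow]
    refine (degree_le_natDegree).trans_lt ?_
    exact_mod_cast (by omega : _ < l - 1)
  constructor
  · rw [h2]; exact (monic_X_pow _).add_of_left h3
  · rw [h2, natDegree_add_eq_left_of_degree_lt h3, natDegree_X_pow]

lemma gp_infty (hl : Odd l) (hl3 : 3 ≤ l) (hi : 1 ≤ i) :
    ∃ r : k[X], gp k (2 ^ i) l = X ^ (2 ^ i * l) + X ^ (2 ^ i * (l - 1) + 1) + r ∧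
      r.natDegree ≤ 2 ^ i * (l - 1) := by
  set p : k[X] := (X + 1) ^ l + X ^ l + X ^ (l - 1) with hp
  have hpd := natDegree_sub_aux (k := k) hl hl3
  have h1 : (X + 1 : k[X]) ^ (2 ^ i * l) = X ^ (2 ^ i * l) + X ^ (2 ^ i * (l - 1)) + expand k (2 ^ i) p := by
    rw [pow_mul, add_pow_Q, hp]
    simp only [map_add, map_pow, expand_X, map_one, one_pow, ← pow_mul]
    have e1 : (X ^ (2 ^ i * (l - 1)) + X ^ (2 ^ i * (l - 1)) : k[X]) = 0 := CharTwo.add_self_eq_zero _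
    have e2 : (X ^ (2 ^ i * l) + X ^ (2 ^ i * l) : k[X]) = 0 := CharTwo.add_self_eq_zero _
    linear_combination - e1 - e2
  have hQ : 2 ≤ 2 ^ i := by
    calc 2 = 2 ^ 1 := rfl
      _ ≤ 2 ^ i := Nat.pow_le_pow_right (by norm_num) hi
  have hexp : (expand k (2 ^ i) p).natDegree ≤ 2 ^ i * (l - 1) - 2 := by
    rw [natDegree_expand]
    calc p.natDegree * 2 ^ i ≤ (l - 2) * 2 ^ i := Nat.mul_le_mul_right _ hpd
      _ ≤ 2 ^ i * (l - 1) - 2 := by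
        obtain ⟨m, rfl⟩ : ∃ m, l = m + 3 := ⟨l - 3, by omega⟩
        have : 2 ^ i * (m + 3 - 1) = (m + 3 - 2) * 2 ^ i + 2 ^ i := by
          simp only [show m + 3 - 1 = m + 2 by omega, show m + 3 - 2 = m + 1 by omega]; ring
        omega
  refine ⟨X ^ (2 ^ i * (l - 1)) + (X + 1) * expand k (2 ^ i) p, ?_, ?_⟩
  · have e2 : (X ^ (2 ^ i * l + 1) + X ^ (2 ^ i * l + 1) : k[X]) = 0 := CharTwo.add_self_eq_zero _
    rw [gp, pow_succ (X + 1 : k[X]), h1]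
    linear_combination e2
  · refine natDegree_add_le_of_degree_le (natDegree_X_pow_le _) ?_
    refine natDegree_mul_le.trans ?_
    have : (X + 1 : k[X]).natDegree ≤ 1 := natDegree_X_add_C (1 : k) ▸ le_rfl
    have h4 : 2 * 2 ≤ 2 ^ i * (l - 1) := Nat.mul_le_mul hQ (by omega)
    omega

lemma gp_monic (hl : Odd l) (hl3 : 3 ≤ l) (hi : 1 ≤ i) :
    (gp k (2 ^ i) l).Monic ∧ (gp k (2 ^ i) l).natDegree = 2 ^ i * l := by
  obtain ⟨r, hr, hrd⟩ := gp_infty (k := k) hl hl3 hi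
  have hQ : 2 ≤ 2 ^ i := by
    calc 2 = 2 ^ 1 := rfl
      _ ≤ 2 ^ i := Nat.pow_le_pow_right (by norm_num) hi
  have h0 : 2 ^ i * (l - 1) + 1 < 2 ^ i * l := by
    obtain ⟨m, rfl⟩ : ∃ m, l = m + 1 := ⟨l - 1, by omega⟩
    simp only [Nat.add_sub_cancel]
    rw [Nat.mul_succ]; omega
  have h3 : degree (X ^ (2 ^ i * (l - 1) + 1) + r : k[X]) < degree (X ^ (2 ^ i * l) : k[X]) := by
    rw [degree_X_pow]
    refine (degree_le_natDegree).trans_lt ?_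
    have : (X ^ (2 ^ i * (l - 1) + 1) + r : k[X]).natDegree ≤ 2 ^ i * (l - 1) + 1 :=
      natDegree_add_le_of_degree_le (natDegree_X_pow_le _) (by omega)
    exact_mod_cast (by omega : _ < 2 ^ i * l)
  rw [hr, add_assoc]
  constructor
  · exact (monic_X_pow _).add_of_left h3
  · rw [natDegree_add_eq_left_of_degree_lt h3, natDegree_X_pow]

lemma crit_facts (hl : Odd l) {z : k} (hz : (hc k l).eval z = 0) : z ≠ 0 ∧ z + 1 ≠ 0 ∧
    (z + 1) ^ l = z ^ l := by
  have h : (z + 1) ^ l + z ^ l = 0 := by simpa [hc] using hz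
  have hl0 : l ≠ 0 := by rintro rfl; simp at hl
  refine ⟨?_, ?_, CharTwo.add_eq_zero.mp h⟩
  · rintro rfl; simp [hl0] at h
  · intro h1
    have : z = 1 := by rw [CharTwo.add_eq_zero] at h1; exact h1
    rw [h1, this] at h; simp [hl0] at h

lemma be_ne_zero (hl : Odd l) {z : k} (hz : (hc k l).eval z = 0) : be (2 ^ i) l z ≠ 0 := by
  obtain ⟨h0, h1, h2⟩ := crit_facts hl hz
  have hl0 : 1 ≤ l := hl.pos
  intro h
  have h3 : (z + 1) ^ (l - 1) + z ^ (l - 1) = 0 := by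
    have : ((z + 1) ^ (l - 1) + z ^ (l - 1)) ^ (2 ^ i) = 0 := by
      rw [add_pow_Q, ← pow_mul, ← pow_mul, mul_comm (l - 1)]; exact h
    exact pow_eq_zero_iff (by positivity) |>.mp this
  rw [CharTwo.add_eq_zero] at h3
  obtain ⟨m, rfl⟩ : ∃ m, l = m + 1 := ⟨l - 1, by omega⟩
  simp only [Nat.add_sub_cancel] at h3
  rw [pow_succ, pow_succ, h3] at h2
  have := mul_left_cancel₀ (pow_ne_zero _ h0) h2
  simp at this

/-- multiplicity from expansion -/
lemma rootMult_of_comp (p H : k[X]) (z : k) (e : ℕ) (h : p.comp (X + C z) = X ^ e * H) (hH : H.eval 0 ≠ 0) :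
    p ≠ 0 ∧ p.rootMultiplicity z = e := by
  have h1 : p = (X - C z) ^ e * H.comp (X - C z) := by
    have : p = (p.comp (X + C z)).comp (X - C z) := by simp [comp_assoc]
    rw [this, h]; simp
  have h2 : (H.comp (X - C z)).eval z ≠ 0 := by simpa [eval_comp] using hH
  have h3 : H.comp (X - C z) ≠ 0 := by intro h; simp [h] at h2
  have h4 : (X - C z) ^ e * H.comp (X - C z) ≠ 0 := mul_ne_zero (pow_ne_zero _ (X_sub_C_ne_zero z)) h3
  rw [h1]
  refine ⟨h4, ?_⟩
  rw [rootMultiplicity_mul h4, rootMultiplicity_X_sub_C_pow, rootMultiplicity_eq_zero h2, add_zero]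

/-- ramification index -/
noncomputable def ee {k : Type} [Field k] (Q l : ℕ) (z : k) : ℕ :=
  (gp k Q l - C ((gp k Q l).eval z)).rootMultiplicity z

lemma two_le_Q (hi : 1 ≤ i) : 2 ≤ 2 ^ i := by
    calc 2 = 2 ^ 1 := rfl
      _ ≤ 2 ^ i := Nat.pow_le_pow_right (by norm_num) hi

lemma ee_noncrit (hl : Odd l) (hi : 1 ≤ i) {z : k} (hz : (hc k l).eval z ≠ 0) :
    ee (2 ^ i) l z = 1 := by
  obtain ⟨H, hH⟩ := g_expansion (i := i) hl z
  have hQ := two_le_Q hi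
  refine (rootMult_of_comp _ (C ((hc k l).eval z ^ (2 ^ i)) + C (al (2 ^ i) l z) * X ^ (2 ^ i - 1)
    + C (be (2 ^ i) l z) * X ^ (2 ^ i) + X ^ (2 * 2 ^ i - 1) * H) z 1 ?_ ?_).2
  · simp only [sub_comp, C_comp, hH]
    obtain ⟨m, hm⟩ : ∃ m, 2 ^ i = m + 1 := ⟨2 ^ i - 1, by omega⟩
    simp only [hm, show 2 * (m + 1) - 1 = 2 * m + 1 by omega, Nat.add_sub_cancel]
    ring
  · have h1 : 2 ^ i - 1 ≠ 0 := by omega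
    have h2 : 2 * 2 ^ i - 1 ≠ 0 := by omega
    simp [h1, h2, hz]

lemma ee_wild (hl : Odd l) (hi : 1 ≤ i) {z : k} (hz : (hc k l).eval z = 0)
    (ha : al (2 ^ i) l z ≠ 0) : ee (2 ^ i) l z = 2 ^ i := by
  obtain ⟨H, hH⟩ := g_expansion (i := i) hl z
  have hQ := two_le_Q hi
  refine (rootMult_of_comp _ (C (al (2 ^ i) l z)
    + C (be (2 ^ i) l z) * X + X ^ (2 ^ i) * H) z (2 ^ i) ?_ ?_).2
  · simp only [sub_comp, C_comp, hH, hz]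
    simp
    ring
  · simp [ha]

lemma ee_tame (hl : Odd l) (hi : 1 ≤ i) {z : k} (hz : (hc k l).eval z = 0)
    (ha : al (2 ^ i) l z = 0) : ee (2 ^ i) l z = 2 ^ i + 1 := by
  obtain ⟨H, hH⟩ := g_expansion (i := i) hl z
  have hQ := two_le_Q hi
  refine (rootMult_of_comp _ (C (be (2 ^ i) l z) + X ^ (2 ^ i - 1) * H) z (2 ^ i + 1) ?_ ?_).2
  · simp only [sub_comp, C_comp, hH, hz, ha]
    obtain ⟨m, hm⟩ : ∃ m, 2 ^ i = m + 1 := ⟨2 ^ i - 1, by omega⟩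
    simp only [hm, Nat.add_sub_cancel]
    simp
    ring
  · have h1 : 2 ^ i - 1 ≠ 0 := by omega
    simp [h1, be_ne_zero hl hz]

lemma rootMult_der (hl : Odd l) (hl3 : 3 ≤ l) {z : k} (hz : (hc k l).eval z = 0) :
    (hc k l ^ (2 ^ i)).rootMultiplicity z = 2 ^ i := by
  have hne : hc k l ≠ 0 := (hc_monic hl hl3).1.ne_zero
  have h1 : (hc k l).rootMultiplicity z = 1 := by
    have hpos : 0 < (hc k l).rootMultiplicity z := (rootMultiplicity_pos hne).mpr hz
    by_contra hcon
    have h2 : 1 < (hc k l).rootMultiplicity z := by omega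
    rw [one_lt_rootMultiplicity_iff_isRoot hne] at h2
    have h3 := h2.2
    have h4 := be_ne_zero (i := 0) hl hz
    apply h4
    simpa [hc, IsRoot, derivative_pow, cast_odd hl, be] using h3
  classical
  rw [← count_roots, roots_pow, Multiset.count_nsmul, count_roots, h1, mul_one]
end Poly
end HM

end

section
open Polynomial
set_option linter.unusedSectionVars false
set_option linter.style.haveILetI false

namespace HM

structure Setup (k Ω : Type) [Field k] [Field Ω] (i l : ℕ) where
  φ : k[X] →+* Ω
  inj : Function.Injective φ
  hi : 1 ≤ i
  hl : Odd l
  hl3 : 3 ≤ l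
  R : Finset Ω
  card : R.card = 2 ^ i * l
  mem : ∀ y, y ∈ R ↔ (gp k (2 ^ i) l).eval₂ (φ.comp C) y = φ (gp k (2 ^ i) l)
  prod : ∀ z, ∏ y ∈ R, (z - y) = (gp k (2 ^ i) l).eval₂ (φ.comp C) z - φ (gp k (2 ^ i) l)
  der : ∀ y ∈ R, ∀ [DecidableEq Ω], ∏ y' ∈ R.erase y, (y - y') = (hc k l ^ (2 ^ i)).eval₂ (φ.comp C) y

namespace Setup
variable {k Ω : Type} [Field k] [Field Ω] {i l : ℕ} (s : Setup k Ω i l)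

noncomputable def ι : k →+* Ω := s.φ.comp C
noncomputable def x : Ω := s.φ X

lemma φ_eq (p : k[X]) : s.φ p = p.eval₂ s.ι s.x := by
  conv_lhs => rw [← p.sum_C_mul_X_pow_eq]
  rw [eval₂_eq_sum, Polynomial.sum, map_sum]
  simp [Polynomial.sum, ι, x]

/-- a subset of the root set which is defined over `k[X]` -/
def Rat (S : Finset Ω) : Prop := S ⊆ s.R ∧ ∀ p : k[X], ∃ P : k[X], ∏ y ∈ S, (s.φ p - y) = s.φ P

lemma eval₂_φ (p q : k[X]) : q.eval₂ s.ι (s.φ p) = s.φ (q.comp p) := by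
  rw [comp, hom_eval₂]; rfl

lemma rat_R : s.Rat s.R := by
  refine ⟨subset_rfl, fun p => ⟨(gp k (2 ^ i) l).comp p - gp k (2 ^ i) l, ?_⟩⟩
  rw [s.prod, map_sub, ← s.eval₂_φ]; rfl

lemma mem' (y) : y ∈ s.R ↔ (gp k (2 ^ i) l).eval₂ s.ι y = (gp k (2 ^ i) l).eval₂ s.ι s.x := by
  rw [← φ_eq]; exact s.mem y

end Setup

/-- finite place over `x1` -/
structure FPl {k Ω : Type} [Field k] [Field Ω] {i l : ℕ} (s : Setup k Ω i l) (Γ : Type)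
    [LinearOrderedCommGroupWithZero Γ] (x1 : k) where
  v : Valuation Ω Γ
  triv : ∀ c : k, c ≠ 0 → v (s.ι c) = 1
  lt : v (s.x - s.ι x1) < 1

namespace FPl
noncomputable section
open scoped Classical
variable {k Ω : Type} [Field k] [Field Ω] [CharP k 2] [CharP Ω 2] [IsAlgClosed k] {i l : ℕ} {s : Setup k Ω i l}
  {Γ : Type} [LinearOrderedCommGroupWithZero Γ] {x1 : k} (P : FPl s Γ x1)

def pi : Γ := P.v (s.x - s.ι x1)

lemma pi_ne : P.pi ≠ 0 := by
  unfold pi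
  rw [Valuation.ne_zero_iff]
  intro h
  have : s.φ (X - C x1) = s.φ 0 := by rw [map_sub, map_zero]; exact h
  exact X_sub_C_ne_zero x1 (s.inj this)

lemma pi_pos : 0 < P.pi := zero_lt_iff.mpr P.pi_ne
lemma pi_lt : P.pi < 1 := P.lt

lemma pi_pow_inj {a b : ℕ} (h : P.pi ^ a = P.pi ^ b) : a = b :=
  pow_right_injective₀ P.pi_pos P.pi_lt.ne h

lemma vx : P.v s.x ≤ 1 := by
  have : s.x = (s.x - s.ι x1) + s.ι x1 := by ring
  rw [this]
  refine P.v.map_add_le P.lt.le ?_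
  by_cases h : x1 = 0
  · simp [h]
  · exact (P.triv _ h).le

lemma vc (c : k) : P.v (s.ι c) ≤ 1 := by
  by_cases h : c = 0
  · simp [h]
  · exact (P.triv _ h).le

lemma vφ (p : k[X]) (hp : p ≠ 0) : P.v (s.φ p) = P.pi ^ p.rootMultiplicity x1 := by
  rw [s.φ_eq]; exact val_poly_near P.v s.ι P.triv p hp P.lt

lemma vφ_le (p : k[X]) : P.v (s.φ p) ≤ 1 := by
  rw [s.φ_eq]; exact val_poly_le P.v s.ι P.triv p P.vx

lemma exists_near {y : Ω} (hy : y ∈ s.R) : ∃ y1 : k, P.v (y - s.ι y1) < 1 ∧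
    (gp k (2 ^ i) l).eval y1 = (gp k (2 ^ i) l).eval x1 := by
  set p : k[X] := gp k (2 ^ i) l - C ((gp k (2 ^ i) l).eval x1) with hp
  have hm := (gp_monic (k := k) s.hl s.hl3 s.hi)
  have hd : 0 < (gp k (2 ^ i) l).natDegree := by
    rw [hm.2]; have := s.hl3; positivity
  have hpm : p.Monic := hm.1.sub_of_left (by
    apply lt_of_le_of_lt degree_C_le
    exact natDegree_pos_iff_degree_pos.mp hd)
  have hlt : P.v (p.eval₂ s.ι y) < 1 := by
    have h1 : p.eval₂ s.ι y = p.eval₂ s.ι s.x := by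
      simp only [hp, eval₂_sub, eval₂_C, (s.mem' y).mp hy]
    rw [h1, val_poly_near P.v s.ι P.triv p hpm.ne_zero P.lt]
    apply pow_lt_one₀ zero_le P.lt
    have : 0 < p.rootMultiplicity x1 := (rootMultiplicity_pos hpm.ne_zero).mpr (by simp [hp])
    omega
  have hsp := (IsAlgClosed.splits p).eq_prod_roots_of_monic hpm
  rw [hsp, eval₂_multiset_prod, Multiset.map_map] at hlt
  have hex : ∃ c ∈ p.roots, P.v (y - s.ι c) < 1 := by
    by_contra hcon
    push Not at hcon
    refine absurd hlt (not_lt.mpr ?_)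
    rw [map_multiset_prod, Multiset.map_map]
    apply Multiset.one_le_prod
    intro z hz
    rw [Multiset.mem_map] at hz
    obtain ⟨c, hc, rfl⟩ := hz
    simpa using hcon c hc
  obtain ⟨c, hc, hlt⟩ := hex
  refine ⟨c, hlt, ?_⟩
  have := (mem_roots hpm.ne_zero).mp hc
  simpa [hp, sub_eq_zero] using this

lemma vy {y : Ω} (hy : y ∈ s.R) : P.v y ≤ 1 := by
  obtain ⟨y1, h1, _⟩ := P.exists_near hy
  have : y = (y - s.ι y1) + s.ι y1 := by ring
  rw [this]
  exact P.v.map_add_le h1.le (P.vc y1)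

/-- roots near `y1` -/
def near (S : Finset Ω) (y1 : k) : Finset Ω := S.filter (fun y => P.v (y - s.ι y1) < 1)

lemma mem_near {S : Finset Ω} {y1 : k} {y : Ω} : y ∈ P.near S y1 ↔ y ∈ S ∧ P.v (y - s.ι y1) < 1 := by
  simp [near]

lemma not_near {y : Ω} (hy : y ∈ s.R) {y1 : k} (h : ¬ P.v (y - s.ι y1) < 1) : P.v (y - s.ι y1) = 1 :=
  le_antisymm (P.v.map_sub_le (P.vy hy) (P.vc y1)) (not_lt.mp h)

lemma near_unique {y : Ω} {y1 y2 : k} (h1 : P.v (y - s.ι y1) < 1) (h2 : P.v (y - s.ι y2) < 1) : y1 = y2 := by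
  by_contra hne
  have h3 : P.v (s.ι (y2 - y1)) < 1 := by
    have : s.ι (y2 - y1) = (y - s.ι y1) - (y - s.ι y2) := by rw [map_sub]; ring
    rw [this]; exact P.v.map_sub_lt h1 h2
  rw [P.triv _ (sub_ne_zero.mpr (Ne.symm hne))] at h3
  exact lt_irrefl _ h3

/-- value of the product at a point close to y1 -/
lemma val_prod_at {S : Finset Ω} (hS : S ⊆ s.R) {y1 : k} {z : Ω} (hz : P.v (z - s.ι y1) < 1) :
    P.v (∏ y ∈ S, (z - y)) = ∏ y ∈ P.near S y1, P.v (z - y) := by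
  rw [map_prod]
  symm
  apply Finset.prod_subset (Finset.filter_subset _ _)
  intro y hy hny
  have h1 : P.v (y - s.ι y1) = 1 := P.not_near (hS hy) (fun h => hny (P.mem_near.mpr ⟨hy, h⟩))
  have : z - y = (z - s.ι y1) - (y - s.ι y1) := by ring
  rw [this, Valuation.map_sub_eq_of_lt_right]
  · exact h1
  · rw [h1]; exact hz

lemma val_near {y : Ω} (hy : y ∈ s.R) {y1 : k} (h : P.v (y - s.ι y1) < 1)
    (hg : (gp k (2 ^ i) l).eval y1 = (gp k (2 ^ i) l).eval x1) :
    P.v (y - s.ι y1) ^ (ee (2 ^ i) l y1) = P.pi ^ (ee (2 ^ i) l x1) := by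
  have hm := (gp_monic (k := k) s.hl s.hl3 s.hi)
  have hd : 0 < (gp k (2 ^ i) l).natDegree := by
    rw [hm.2]; have := s.hl3; positivity
  have hpm : (gp k (2 ^ i) l - C ((gp k (2 ^ i) l).eval x1)).Monic := hm.1.sub_of_left (by
    apply lt_of_le_of_lt degree_C_le
    exact natDegree_pos_iff_degree_pos.mp hd)
  have h1 := val_poly_near P.v s.ι P.triv _ hpm.ne_zero P.lt
  have h2 := val_poly_near P.v s.ι P.triv _ hpm.ne_zero h
  have h3 : (gp k (2 ^ i) l - C ((gp k (2 ^ i) l).eval x1)).eval₂ s.ι y = (gp k (2 ^ i) l - C ((gp k (2 ^ i) l).eval x1)).eval₂ s.ι s.x := by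
    simp only [eval₂_sub, eval₂_C, (s.mem' y).mp hy]
  rw [ee, ee, hg, pi, ← h1, ← h2, h3]

end
end FPl
end HM

end

section
open Polynomial
set_option linter.unusedSectionVars false

namespace HM
namespace FPl
noncomputable section
open scoped Classical
variable {k Ω : Type} [Field k] [Field Ω] [CharP k 2] [CharP Ω 2] [IsAlgClosed k] {i l : ℕ} {s : Setup k Ω i l}
  {Γ : Type} [LinearOrderedCommGroupWithZero Γ] {x1 : k} (P : FPl s Γ x1)

lemma ee_pos (s : Setup k Ω i l) (z : k) : 0 < ee (2 ^ i) l z := by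
  by_cases h : (hc k l).eval z = 0
  · by_cases h' : al (2 ^ i) l z = 0
    · rw [ee_tame s.hl s.hi h h']; positivity
    · rw [ee_wild s.hl s.hi h h']; positivity
  · rw [ee_noncrit s.hl s.hi h]; norm_num

lemma pow_inj {a b : Γ} {n : ℕ} (hn : 0 < n) (h : a ^ n = b ^ n) : a = b :=
  (pow_left_inj₀ zero_le zero_le hn.ne').mp h

lemma near_sub {A B : Finset Ω} (h : A ⊆ B) (y1 : k) : P.near A y1 ⊆ P.near B y1 :=
  Finset.filter_subset_filter _ h

lemma prod_near_pow {S : Finset Ω} (hS : S ⊆ s.R) {y1 : k} (hg : (gp k (2 ^ i) l).eval y1 = (gp k (2 ^ i) l).eval x1) :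
    P.v (∏ y ∈ S, (s.ι y1 - y)) ^ (ee (2 ^ i) l y1) = P.pi ^ (ee (2 ^ i) l x1 * (P.near S y1).card) := by
  rw [P.val_prod_at hS (y1 := y1) (by simp), ← Finset.prod_pow, pow_mul, ← Finset.prod_const]
  apply Finset.prod_congr rfl
  intro y hy
  rw [mem_near] at hy
  rw [Valuation.map_sub_swap, P.val_near (hS hy.1) hy.2 hg]

lemma card_near_R {y1 : k} (hg : (gp k (2 ^ i) l).eval y1 = (gp k (2 ^ i) l).eval x1) :
    (P.near s.R y1).card = ee (2 ^ i) l y1 := by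
  have h1 := P.prod_near_pow (subset_rfl : s.R ⊆ s.R) hg
  have hm := (gp_monic (k := k) s.hl s.hl3 s.hi)
  have hd : 0 < (gp k (2 ^ i) l).natDegree := by
    rw [hm.2]; have := s.hl3; positivity
  have hpm : (gp k (2 ^ i) l - C ((gp k (2 ^ i) l).eval x1)).Monic := hm.1.sub_of_left (by
    apply lt_of_le_of_lt degree_C_le
    exact natDegree_pos_iff_degree_pos.mp hd)
  have h2 : ∏ y ∈ s.R, (s.ι y1 - y) = - s.φ (gp k (2 ^ i) l - C ((gp k (2 ^ i) l).eval x1)) := by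
    rw [s.prod, map_sub, ← hg]
    change (gp k (2 ^ i) l).eval₂ s.ι (s.ι y1) - _ = - (_ - s.ι _)
    rw [eval₂_at_apply]; ring
  rw [h2, Valuation.map_neg, P.vφ _ hpm.ne_zero, ← pow_mul] at h1
  have h3 := P.pi_pow_inj h1
  change ee (2 ^ i) l x1 * _ = _ at h3
  exact (Nat.eq_of_mul_eq_mul_left (ee_pos s x1) h3).symm

lemma card_near {S : Finset Ω} (hS : S ⊆ s.R) {y1 : k} (hg : (gp k (2 ^ i) l).eval y1 = (gp k (2 ^ i) l).eval x1)
    {D : k[X]} (hD : ∏ y ∈ S, (s.φ (C y1) - y) = s.φ D) :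
    ee (2 ^ i) l y1 * D.rootMultiplicity x1 = ee (2 ^ i) l x1 * (P.near S y1).card := by
  have h1 := P.prod_near_pow hS hg
  change P.v (∏ y ∈ S, (s.φ (C y1) - y)) ^ _ = _ at h1
  rw [hD] at h1
  have hD0 : D ≠ 0 := by
    rintro rfl
    rw [map_zero, map_zero, zero_pow (ee_pos s y1).ne'] at h1
    exact pow_ne_zero _ P.pi_ne h1.symm
  rw [P.vφ _ hD0, ← pow_mul, mul_comm] at h1
  exact P.pi_pow_inj h1

lemma card_add_le {A B : Finset Ω} (hA : A ⊆ s.R) (hB : B ⊆ s.R) (hd : Disjoint A B) {y1 : k}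
    (hg : (gp k (2 ^ i) l).eval y1 = (gp k (2 ^ i) l).eval x1) :
    (P.near A y1).card + (P.near B y1).card ≤ ee (2 ^ i) l y1 := by
  have h1 : Disjoint (P.near A y1) (P.near B y1) :=
    Finset.disjoint_of_subset_left (Finset.filter_subset _ _)
      (Finset.disjoint_of_subset_right (Finset.filter_subset _ _) hd)
  rw [← P.card_near_R hg, ← Finset.card_union_of_disjoint h1]
  exact Finset.card_le_card (Finset.union_subset (P.near_sub hA _) (P.near_sub hB _))

lemma mixed {A B : Finset Ω} (hA : s.Rat A) (hB : s.Rat B) (hd : Disjoint A B) {y1 : k}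
    (hg : (gp k (2 ^ i) l).eval y1 = (gp k (2 ^ i) l).eval x1)
    (hcop : Nat.Coprime (ee (2 ^ i) l x1) (ee (2 ^ i) l y1)) :
    P.near A y1 = ∅ ∨ P.near B y1 = ∅ := by
  have key : ∀ S, s.Rat S → ee (2 ^ i) l y1 ∣ (P.near S y1).card := by
    intro S hS
    obtain ⟨D, hD⟩ := hS.2 (C y1)
    have := P.card_near hS.1 hg hD
    exact hcop.symm.dvd_of_dvd_mul_left (Dvd.intro _ this)
  by_contra hcon
  push Not at hcon
  have hle := P.card_add_le hA.1 hB.1 hd hg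
  have h1 := Nat.le_of_dvd (Finset.card_pos.mpr hcon.1) (key A hA)
  have h2 := Nat.le_of_dvd (Finset.card_pos.mpr hcon.2) (key B hB)
  have := ee_pos s y1
  omega

lemma der_near {y : Ω} {y1 : k} (hy : y ∈ P.near s.R y1) (hcr : (hc k l).eval y1 = 0) :
    ∏ y' ∈ (P.near s.R y1).erase y, P.v (y - y') = P.v (y - s.ι y1) ^ (2 ^ i) := by
  have hy' := P.mem_near.mp hy
  have h1 := P.val_prod_at (S := s.R.erase y) (Finset.erase_subset _ _) hy'.2
  rw [s.der y hy'.1] at h1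
  have h2 : P.near (s.R.erase y) y1 = (P.near s.R y1).erase y := by
    ext z; simp only [mem_near, Finset.mem_erase]; tauto
  rw [h2] at h1
  rw [← h1]
  have hne : (hc k l) ^ 2 ^ i ≠ 0 := pow_ne_zero _ (hc_monic s.hl s.hl3).1.ne_zero
  have h3 := val_poly_near P.v s.ι P.triv _ hne hy'.2
  rw [rootMult_der s.hl s.hl3 hcr] at h3
  exact h3

section eqcase
variable {y1 : k} (hg : (gp k (2 ^ i) l).eval y1 = (gp k (2 ^ i) l).eval x1)
  (he : ee (2 ^ i) l x1 = ee (2 ^ i) l y1)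
include hg he

lemma eq_val {y : Ω} (hy : y ∈ P.near s.R y1) : P.v (y - s.ι y1) = P.pi := by
  have hy := P.mem_near.mp hy
  have := P.val_near hy.1 hy.2 hg
  rw [he] at this
  exact pow_inj (ee_pos s y1) this

lemma eq_card {S : Finset Ω} (hS : S ⊆ s.R) 
    {D : k[X]} (hD : ∏ y ∈ S, (s.φ (C y1) - y) = s.φ D) :
    D.rootMultiplicity x1 = (P.near S y1).card := by
  have h1 := P.card_near hS hg hD
  rw [he] at h1
  exact Nat.eq_of_mul_eq_mul_left (ee_pos s y1) h1

lemma eq_diff_le {y y' : Ω} (hy : y ∈ P.near s.R y1) (hy' : y' ∈ P.near s.R y1) : P.v (y - y') ≤ P.pi := by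
  have : y - y' = (y - s.ι y1) - (y' - s.ι y1) := by ring
  rw [this]
  exact P.v.map_sub_le (P.eq_val hg he hy).le (P.eq_val hg he hy').le

lemma TT (hcr : (hc k l).eval y1 = 0) (ht : ee (2 ^ i) l y1 = 2 ^ i + 1)
    {y y' : Ω} (hy : y ∈ P.near s.R y1) (hy' : y' ∈ P.near s.R y1) (hne : y' ≠ y) :
    P.v (y - y') = P.pi := by
  have h1 := P.der_near hy hcr
  rw [P.eq_val hg he hy] at h1
  have hc : ((P.near s.R y1).erase y).card = 2 ^ i := by
    rw [Finset.card_erase_of_mem hy, P.card_near_R hg, ht]; rfl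
  by_contra hcon
  have h2 : P.v (y - y') < P.pi := lt_of_le_of_ne (P.eq_diff_le hg he hy hy') hcon
  have h3 : ∏ z ∈ (P.near s.R y1).erase y, P.v (y - z) < ∏ z ∈ (P.near s.R y1).erase y, P.pi := by
    have hy'' : y' ∈ (P.near s.R y1).erase y := Finset.mem_erase.mpr ⟨hne, hy'⟩
    rw [← Finset.mul_prod_erase _ _ hy'', ← Finset.mul_prod_erase _ _ hy'']
    have hle : ∏ x ∈ ((P.near s.R y1).erase y).erase y', P.v (y - x) ≤
        ∏ x ∈ ((P.near s.R y1).erase y).erase y', P.pi := by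
      apply Finset.prod_le_prod'
      intro z hz
      exact P.eq_diff_le hg he hy (Finset.mem_of_mem_erase (Finset.mem_of_mem_erase hz))
    calc _ ≤ P.v (y - y') * ∏ x ∈ ((P.near s.R y1).erase y).erase y', P.pi := mul_le_mul_right hle _
      _ < _ := by
        rw [Finset.prod_const]
        exact mul_lt_mul_of_pos_right h2 (pow_pos P.pi_pos _)
  rw [h1, Finset.prod_const, hc] at h3
  exact lt_irrefl _ h3
end eqcase

end
end FPl
end HM

end

section
open Polynomial
set_option linter.unusedSectionVars false

namespace HM

/-- badness of a pair of wild points -/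
def Bad {k : Type} [Field k] (i l : ℕ) (x1 y1 : k) : Prop :=
  ∃ γ : k, γ ^ (2 ^ i) * al (2 ^ i) l y1 = al (2 ^ i) l x1 ∧
    be (2 ^ i) l x1 + be (2 ^ i) l y1 * γ ^ (2 ^ i + 1) = 0

namespace FPl
noncomputable section
open scoped Classical
variable {k Ω : Type} [Field k] [Field Ω] [CharP k 2] [CharP Ω 2] [IsAlgClosed k] {i l : ℕ} {s : Setup k Ω i l}
  {Γ : Type} [LinearOrderedCommGroupWithZero Γ] {x1 : k} (P : FPl s Γ x1)

lemma expand_at (s : Setup k Ω i l) {c : k} (hcr : (hc k l).eval c = 0) : ∃ H : k[X], ∀ z : Ω,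
    (gp k (2 ^ i) l).eval₂ s.ι z = s.ι ((gp k (2 ^ i) l).eval c) + s.ι (al (2 ^ i) l c) * (z - s.ι c) ^ (2 ^ i)
      + s.ι (be (2 ^ i) l c) * (z - s.ι c) ^ (2 ^ i + 1) + (z - s.ι c) ^ (2 * 2 ^ i) * H.eval₂ s.ι (z - s.ι c) := by
  obtain ⟨H, hH⟩ := g_expansion (i := i) s.hl c
  refine ⟨H, fun z => ?_⟩
  have h := congrArg (fun p => p.eval₂ s.ι (z - s.ι c)) hH
  simp only [eval₂_comp, eval₂_add, eval₂_X, eval₂_C, eval₂_mul, eval₂_pow, hcr] at h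
  rw [sub_add_cancel] at h
  rw [h]
  simp

section WWcase
variable {y1 : k} (hg : (gp k (2 ^ i) l).eval y1 = (gp k (2 ^ i) l).eval x1)
  (hx : (hc k l).eval x1 = 0) (hy : (hc k l).eval y1 = 0)
  (hax : al (2 ^ i) l x1 ≠ 0) (hay : al (2 ^ i) l y1 ≠ 0)
  {γ : k} (hγ : γ ^ (2 ^ i) * al (2 ^ i) l y1 = al (2 ^ i) l x1)
include hg hx hy hax hay

lemma ww_ee (s : Setup k Ω i l) : ee (2 ^ i) l x1 = ee (2 ^ i) l y1 := by
  rw [ee_wild s.hl s.hi hx hax, ee_wild s.hl s.hi hy hay]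

include hγ

lemma ww_eq {y : Ω} (hyn : y ∈ P.near s.R y1) :
    ∃ E : Ω, P.v E ≤ P.pi ^ (2 * 2 ^ i) ∧
    (s.ι (al (2 ^ i) l y1) + s.ι (be (2 ^ i) l y1) * (y - s.ι y1)) *
        ((y - s.ι y1) - s.ι γ * (s.x - s.ι x1)) ^ (2 ^ i) =
      s.ι (be (2 ^ i) l x1 + be (2 ^ i) l y1 * γ ^ (2 ^ i + 1)) * (s.x - s.ι x1) ^ (2 ^ i + 1) +
      s.ι (be (2 ^ i) l y1 * γ ^ (2 ^ i)) * (s.x - s.ι x1) ^ (2 ^ i) * ((y - s.ι y1) - s.ι γ * (s.x - s.ι x1)) + E := by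
  obtain ⟨H1, h1⟩ := expand_at s hx
  obtain ⟨H2, h2⟩ := expand_at s hy
  have he := ww_ee hg hx hy hax hay s
  have hv := P.eq_val hg he hyn
  have hmem := (s.mem' y).mp (P.mem_near.mp hyn).1
  rw [h2 y, h1 s.x, hg] at hmem
  refine ⟨(s.x - s.ι x1) ^ (2 * 2 ^ i) * H1.eval₂ s.ι (s.x - s.ι x1) +
      (y - s.ι y1) ^ (2 * 2 ^ i) * H2.eval₂ s.ι (y - s.ι y1), ?_, ?_⟩
  · refine P.v.map_add_le ?_ ?_
    · rw [map_mul, map_pow]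
      exact mul_le_of_le_one_right' (val_poly_le P.v s.ι P.triv _ P.lt.le)
    · rw [map_mul, map_pow, hv]
      exact mul_le_of_le_one_right' (val_poly_le P.v s.ι P.triv _ (hv.le.trans P.pi_lt.le))
  · have e1 : ((y - s.ι y1) - s.ι γ * (s.x - s.ι x1)) ^ (2 ^ i) = (y - s.ι y1) ^ (2 ^ i) + s.ι γ ^ (2 ^ i) * (s.x - s.ι x1) ^ (2 ^ i) := by
      rw [CharTwo.sub_eq_add, add_pow_Q, mul_pow]
    rw [e1]
    have e2 : s.ι γ ^ (2 ^ i) * s.ι (al (2 ^ i) l y1) = s.ι (al (2 ^ i) l x1) := by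
      rw [← hγ]; simp
    have e3 : (2 : Ω) = 0 := CharTwo.two_eq_zero
    simp only [map_add, map_mul, map_pow]
    generalize s.ι (al (2 ^ i) l y1) = a2 at *
    generalize s.ι (be (2 ^ i) l y1) = b2 at *
    generalize s.ι (al (2 ^ i) l x1) = a1 at *
    generalize s.ι (be (2 ^ i) l x1) = b1 at *
    generalize y - s.ι y1 = S at *
    generalize s.x - s.ι x1 = T at *
    generalize eval₂ s.ι S H2 = HS at *
    generalize eval₂ s.ι T H1 = HT at *
    generalize s.ι γ = c at *
    have hp : ∀ z : Ω, z ^ (2 ^ i + 1) = z ^ (2 ^ i) * z := fun z => pow_succ _ _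
    have hp2 : ∀ z : Ω, z ^ (2 * 2 ^ i) = (z ^ (2 ^ i)) ^ 2 := fun z => by rw [← pow_mul, mul_comm]
    simp only [hp, hp2] at hmem ⊢
    generalize S ^ (2 ^ i) = SQ at *
    generalize T ^ (2 ^ i) = TQ at *
    generalize c ^ (2 ^ i) = cQ at *
    linear_combination hmem + TQ * e2 + (a1 * TQ  - SQ ^ 2 * HS) * e3

/-- distance to the tangent point -/
def dist (γ y1 : k) (y : Ω) : Γ := P.v ((y - s.ι y1) - s.ι γ * (s.x - s.ι x1))

omit hg hx hy hax hay hγ in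
lemma vγ (c : k) (z : Ω) : P.v (s.ι c * z) ≤ P.v z := by
  rw [map_mul]; exact mul_le_of_le_one_left' (P.vc c)

lemma ww_lhs {y : Ω} (hyn : y ∈ P.near s.R y1) :
    P.v ((s.ι (al (2 ^ i) l y1) + s.ι (be (2 ^ i) l y1) * (y - s.ι y1)) *
        ((y - s.ι y1) - s.ι γ * (s.x - s.ι x1)) ^ (2 ^ i)) = P.dist γ y1 y ^ (2 ^ i) := by
  have he := ww_ee hg hx hy hax hay s
  have hv := P.eq_val hg he hyn
  rw [map_mul, map_pow, dist, Valuation.map_add_eq_of_lt_left, P.triv _ hay, one_mul]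
  rw [P.triv _ hay]
  refine lt_of_le_of_lt (P.vγ _ _) ?_
  rw [hv]; exact P.pi_lt

lemma ww_dist_lt {y : Ω} (hyn : y ∈ P.near s.R y1) : P.dist γ y1 y < P.pi := by
  obtain ⟨E, hE, h⟩ := P.ww_eq hg hx hy hax hay hγ hyn
  have he := ww_ee hg hx hy hax hay s
  have hv := P.eq_val hg he hyn
  have h1 := P.ww_lhs hg hx hy hax hay hγ hyn
  have hQ := two_le_Q s.hi
  have hpp : P.pi ^ (2 ^ i + 1) < P.pi ^ (2 ^ i) := pow_lt_pow_right_of_lt_one₀ P.pi_pos P.pi_lt (by omega)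
  have hd : P.dist γ y1 y ≤ P.pi := by
    rw [dist]
    refine P.v.map_sub_le hv.le (P.vγ _ _)
  have h2 : P.dist γ y1 y ^ (2 ^ i) ≤ P.pi ^ (2 ^ i + 1) := by
    rw [← h1, h]
    refine P.v.map_add_le (P.v.map_add_le ?_ ?_) ?_
    · refine (P.vγ _ _).trans ?_
      rw [map_pow]; rfl
    · rw [mul_assoc]
      refine (P.vγ _ _).trans ?_
      rw [map_mul, map_pow, pow_succ]
      exact mul_le_mul_right hd _
    · refine hE.trans (pow_le_pow_right_of_le_one' P.pi_lt.le (by omega))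
  exact lt_of_pow_lt_pow_left₀ (2 ^ i) zero_le (h2.trans_lt hpp)

lemma ww_nonbad {y : Ω} (hyn : y ∈ P.near s.R y1)
    (hb : be (2 ^ i) l x1 + be (2 ^ i) l y1 * γ ^ (2 ^ i + 1) ≠ 0) :
    P.dist γ y1 y ^ (2 ^ i) = P.pi ^ (2 ^ i + 1) := by
  obtain ⟨E, hE, h⟩ := P.ww_eq hg hx hy hax hay hγ hyn
  have h1 := P.ww_lhs hg hx hy hax hay hγ hyn
  have hd := P.ww_dist_lt hg hx hy hax hay hγ hyn
  have hQ := two_le_Q s.hi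
  have hv1 : P.v (s.ι (be (2 ^ i) l x1 + be (2 ^ i) l y1 * γ ^ (2 ^ i + 1)) * (s.x - s.ι x1) ^ (2 ^ i + 1))
      = P.pi ^ (2 ^ i + 1) := by
    rw [map_mul, P.triv _ hb, map_pow, one_mul]; rfl
  rw [← h1, h, add_assoc, Valuation.map_add_eq_of_lt_left]
  · exact hv1
  · rw [hv1]
    refine P.v.map_add_lt ?_ ?_
    · rw [mul_assoc]
      refine (P.vγ _ _).trans_lt ?_
      rw [map_mul, map_pow, pow_succ]
      exact mul_lt_mul_of_pos_left hd (pow_pos P.pi_pos _)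
    · exact hE.trans_lt (pow_lt_pow_right_of_lt_one₀ P.pi_pos P.pi_lt (by omega))

lemma ww_bad {y : Ω} (hyn : y ∈ P.near s.R y1)
    (hb : be (2 ^ i) l x1 + be (2 ^ i) l y1 * γ ^ (2 ^ i + 1) = 0) 
    (ht : P.pi ^ (2 ^ i) < P.dist γ y1 y) :
    P.dist γ y1 y ^ (2 ^ i - 1) = P.pi ^ (2 ^ i) := by
  obtain ⟨E, hE, h⟩ := P.ww_eq hg hx hy hax hay hγ hyn
  have h1 := P.ww_lhs hg hx hy hax hay hγ hyn
  have hQ := two_le_Q s.hi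
  have hγ0 : γ ≠ 0 := by
    rintro rfl
    rw [zero_pow (by positivity), zero_mul] at hγ
    exact hax hγ.symm
  have hne : be (2 ^ i) l y1 * γ ^ (2 ^ i) ≠ 0 := mul_ne_zero (be_ne_zero s.hl hy) (pow_ne_zero _ hγ0)
  have hd0 : P.dist γ y1 y ≠ 0 := (zero_le.trans_lt ht).ne'
  have hv : P.v (s.ι (be (2 ^ i) l y1 * γ ^ (2 ^ i)) * (s.x - s.ι x1) ^ (2 ^ i) * ((y - s.ι y1) - s.ι γ * (s.x - s.ι x1)))
      = P.pi ^ (2 ^ i) * P.dist γ y1 y := by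
    rw [map_mul, map_mul, P.triv _ hne, map_pow, one_mul]; rfl
  rw [hb, map_zero, zero_mul, zero_add] at h
  have h2 : P.dist γ y1 y ^ (2 ^ i) = P.pi ^ (2 ^ i) * P.dist γ y1 y := by
    rw [← h1, h, Valuation.map_add_eq_of_lt_left, hv]
    rw [hv]
    refine hE.trans_lt ?_
    rw [two_mul, pow_add]
    exact mul_lt_mul_of_pos_left ht (pow_pos P.pi_pos _)
  obtain ⟨m, hm⟩ : ∃ m, 2 ^ i = m + 1 := ⟨2 ^ i - 1, by omega⟩
  rw [hm] at h2 ⊢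
  rw [pow_succ] at h2
  exact mul_right_cancel₀ hd0 h2

/-- product of distances for a rational set -/
lemma ww_prod {S : Finset Ω} (hS : s.Rat S) :
    ∃ N : ℕ, (∀ y ∈ P.near S y1, P.dist γ y1 y ≠ 0) → ∏ y ∈ P.near S y1, P.dist γ y1 y = P.pi ^ N := by
  obtain ⟨D, hD⟩ := hS.2 (C y1 + C γ * (X - C x1))
  refine ⟨D.rootMultiplicity x1, fun hne => ?_⟩
  have hz : s.φ (C y1 + C γ * (X - C x1)) = s.ι y1 + s.ι γ * (s.x - s.ι x1) := by
    simp [Setup.ι, Setup.x]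
  have h1 := P.val_prod_at hS.1 (y1 := y1) (z := s.φ (C y1 + C γ * (X - C x1))) (by
    rw [hz, add_sub_cancel_left]
    exact (P.vγ _ _).trans_lt P.lt)
  have h2 : ∏ y ∈ P.near S y1, P.v (s.φ (C y1 + C γ * (X - C x1)) - y) = ∏ y ∈ P.near S y1, P.dist γ y1 y := by
    apply Finset.prod_congr rfl
    intro y _
    rw [hz, dist, ← Valuation.map_neg]
    congr 1; ring
  rw [h2] at h1
  have hD0 : D ≠ 0 := by
    rintro rfl
    rw [hD, map_zero, map_zero] at h1
    exact Finset.prod_ne_zero_iff.mpr hne h1.symm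
  rw [← h1, hD, P.vφ _ hD0]

omit hγ in
lemma WW_aux {A B : Finset Ω} (hA : s.Rat A) (hB : s.Rat B) (hd : Disjoint A B)
    (hAn : (P.near A y1).card = 2 ^ i - 1) (hBn : (P.near B y1).card = 1) :
    ∏ a ∈ P.near A y1, ∏ b ∈ P.near B y1, P.v (a - b) = P.pi ^ (2 ^ i) := by
  have he := ww_ee hg hx hy hax hay s
  obtain ⟨b, hb⟩ := Finset.card_eq_one.mp hBn
  have hbB : b ∈ P.near B y1 := by rw [hb]; simp
  have hbR : b ∈ P.near s.R y1 := P.near_sub hB.1 _ hbB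
  have h1 := P.der_near hbR hy
  rw [P.eq_val hg he hbR] at h1
  rw [← h1, hb]
  simp only [Finset.prod_singleton]
  have h2 : P.near A y1 = (P.near s.R y1).erase b := by
    apply Finset.eq_of_subset_of_card_le
    · intro a ha
      rw [Finset.mem_erase]
      refine ⟨?_, P.near_sub hA.1 _ ha⟩
      rintro rfl
      exact Finset.disjoint_left.mp hd (P.mem_near.mp ha).1 (P.mem_near.mp hbB).1
    · rw [Finset.card_erase_of_mem hbR, P.card_near_R hg, hAn, ee_wild s.hl s.hi hy hay]
  rw [← h2]
  apply Finset.prod_congr rfl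
  intro a _
  rw [Valuation.map_sub_swap]

/-- at most one type 2 root -/
lemma ww_type2 (hQ4 : 3 ≤ 2 ^ i) {y y' : Ω} (hyn : y ∈ P.near s.R y1) (hyn' : y' ∈ P.near s.R y1)
    (h : P.dist γ y1 y ≤ P.pi ^ (2 ^ i)) (h' : P.dist γ y1 y' ≤ P.pi ^ (2 ^ i)) : y' = y := by
  by_contra hne
  have he := ww_ee hg hx hy hax hay s
  have hd : ∀ z z', P.v (z - z') ≤ max (P.dist γ y1 z) (P.dist γ y1 z') := by
    intro z z'
    have : z - z' = ((z - s.ι y1) - s.ι γ * (s.x - s.ι x1)) - ((z' - s.ι y1) - s.ι γ * (s.x - s.ι x1)) := by ring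
    rw [this]; exact P.v.map_sub _ _
  have h1 := P.der_near hyn hy
  rw [P.eq_val hg he hyn] at h1
  have hy'' : y' ∈ (P.near s.R y1).erase y := Finset.mem_erase.mpr ⟨hne, hyn'⟩
  rw [← Finset.mul_prod_erase _ _ hy''] at h1
  have hcard : 1 ≤ (((P.near s.R y1).erase y).erase y').card := by
    rw [Finset.card_erase_of_mem hy'', Finset.card_erase_of_mem hyn, P.card_near_R hg, ee_wild s.hl s.hi hy hay]
    omega
  obtain ⟨z, hz⟩ := Finset.card_pos.mp hcard
  have hlt : ∀ z ∈ ((P.near s.R y1).erase y).erase y', P.v (y - z) < 1 := by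
    intro z hz
    have hz' := (Finset.mem_of_mem_erase (Finset.mem_of_mem_erase hz))
    exact (P.eq_diff_le hg he hyn hz').trans_lt P.pi_lt
  have h3 : ∏ z ∈ ((P.near s.R y1).erase y).erase y', P.v (y - z) < 1 := by
    rw [← Finset.mul_prod_erase _ _ hz]
    refine mul_lt_one_of_lt_of_le (hlt z hz) (Finset.prod_le_one' ?_)
    intro w hw
    exact (hlt w (Finset.mem_of_mem_erase hw)).le
  have h4 : P.v (y - y') ≤ P.pi ^ (2 ^ i) := (hd y y').trans (max_le h h')
  have h5 : P.v (y - y') * ∏ z ∈ ((P.near s.R y1).erase y).erase y', P.v (y - z) < P.pi ^ (2 ^ i) := by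
    calc _ ≤ P.pi ^ (2 ^ i) * ∏ z ∈ ((P.near s.R y1).erase y).erase y', P.v (y - z) := mul_le_mul_left h4 _
      _ < P.pi ^ (2 ^ i) * 1 := mul_lt_mul_of_pos_left h3 (pow_pos P.pi_pos _)
      _ = _ := mul_one _
  exact h5.ne h1

end WWcase
end
end FPl
end HM

end

section
open Polynomial
set_option linter.unusedSectionVars false

namespace HM
namespace FPl
noncomputable section
open scoped Classical
variable {k Ω : Type} [Field k] [Field Ω] [CharP k 2] [CharP Ω 2] [IsAlgClosed k] {i l : ℕ} {s : Setup k Ω i l}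
  {Γ : Type} [LinearOrderedCommGroupWithZero Γ] {x1 : k} (P : FPl s Γ x1)

section WWcase
variable {y1 : k} (hg : (gp k (2 ^ i) l).eval y1 = (gp k (2 ^ i) l).eval x1)
  (hx : (hc k l).eval x1 = 0) (hy : (hc k l).eval y1 = 0)
  (hax : al (2 ^ i) l x1 ≠ 0) (hay : al (2 ^ i) l y1 ≠ 0)
include hg hx hy hax hay

lemma ww_dvd {γ : k} (hγ : γ ^ (2 ^ i) * al (2 ^ i) l y1 = al (2 ^ i) l x1) {S : Finset Ω} (hS : s.Rat S)
    {e f : ℕ} (he : 0 < e) (hcop : Nat.Coprime e f)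
    (h : ∀ y ∈ P.near S y1, P.dist γ y1 y ^ e = P.pi ^ f) : e ∣ (P.near S y1).card := by
  obtain ⟨N, hN⟩ := P.ww_prod hg hx hy hax hay hγ hS
  have hne : ∀ y ∈ P.near S y1, P.dist γ y1 y ≠ 0 := by
    intro y hy h0
    have := h y hy
    rw [h0, zero_pow he.ne'] at this
    exact pow_ne_zero _ P.pi_ne this.symm
  have h1 := congrArg (fun z => z ^ e) (hN hne)
  rw [← Finset.prod_pow, Finset.prod_congr rfl h, Finset.prod_const, ← pow_mul, ← pow_mul] at h1
  have h2 := P.pi_pow_inj h1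
  exact hcop.dvd_of_dvd_mul_left (Dvd.intro_left _ h2.symm)

lemma WW_cards {A B : Finset Ω} (hA : s.Rat A) (hB : s.Rat B) (hd : Disjoint A B)
    (hAn : (P.near A y1).Nonempty) (hBn : (P.near B y1).Nonempty) :
    Bad i l x1 y1 ∧ (((P.near A y1).card = 2 ^ i - 1 ∧ (P.near B y1).card = 1) ∨
      ((P.near B y1).card = 2 ^ i - 1 ∧ (P.near A y1).card = 1)) := by
  obtain ⟨γ, hγ⟩ := IsAlgClosed.exists_pow_nat_eq (al (2 ^ i) l x1 / al (2 ^ i) l y1) (n := 2 ^ i) (by positivity)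
  have hγ : γ ^ (2 ^ i) * al (2 ^ i) l y1 = al (2 ^ i) l x1 := by
    rw [hγ, div_mul_cancel₀ _ hay]
  have hQ := two_le_Q s.hi
  have hle := P.card_add_le hA.1 hB.1 hd hg
  rw [ee_wild s.hl s.hi hy hay] at hle
  have ha := Finset.card_pos.mpr hAn
  have hb := Finset.card_pos.mpr hBn
  by_cases hbad : be (2 ^ i) l x1 + be (2 ^ i) l y1 * γ ^ (2 ^ i + 1) = 0
  swap
  · exfalso
    have key : ∀ S, s.Rat S → 2 ^ i ∣ (P.near S y1).card := by
      intro S hS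
      refine P.ww_dvd hg hx hy hax hay hγ hS (f := 2 ^ i + 1) (by positivity) (by simp) ?_
      intro y hyS
      exact P.ww_nonbad hg hx hy hax hay hγ (P.near_sub hS.1 _ hyS) hbad
    have h1 := Nat.le_of_dvd ha (key A hA)
    have h2 := Nat.le_of_dvd hb (key B hB)
    omega
  refine ⟨⟨γ, hγ, hbad⟩, ?_⟩
  by_cases hQ2 : 2 ^ i = 2
  · rw [hQ2] at hle ⊢; omega
  have hQ3 : 3 ≤ 2 ^ i := by omega
  have key : ∀ S, s.Rat S → (∀ y ∈ P.near S y1, P.pi ^ (2 ^ i) < P.dist γ y1 y) → 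
      2 ^ i - 1 ∣ (P.near S y1).card := by
    intro S hS h
    refine P.ww_dvd hg hx hy hax hay hγ hS (f := 2 ^ i) (by omega) ?_ ?_
    · obtain ⟨m, hm⟩ : ∃ m, 2 ^ i = m + 1 := ⟨2 ^ i - 1, by omega⟩
      rw [hm]; simp
    · intro y hyS
      exact P.ww_bad hg hx hy hax hay hγ (P.near_sub hS.1 _ hyS) hbad (h y hyS)
  by_cases h1 : ∀ y ∈ P.near A y1, P.pi ^ (2 ^ i) < P.dist γ y1 y
  · have := Nat.le_of_dvd ha (key A hA h1)
    omega
  by_cases h2 : ∀ y ∈ P.near B y1, P.pi ^ (2 ^ i) < P.dist γ y1 y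
  · have := Nat.le_of_dvd hb (key B hB h2)
    omega
  exfalso
  push Not at h1 h2
  obtain ⟨y, hyA, hyd⟩ := h1
  obtain ⟨z, hzB, hzd⟩ := h2
  have := P.ww_type2 hg hx hy hax hay hγ hQ3 (P.near_sub hA.1 _ hyA) (P.near_sub hB.1 _ hzB) hyd hzd
  rw [this] at hzB
  exact Finset.disjoint_left.mp hd (P.mem_near.mp hyA).1 (P.mem_near.mp hzB).1

lemma WW_prod {A B : Finset Ω} (hA : s.Rat A) (hB : s.Rat B) (hd : Disjoint A B)
    (hAn : (P.near A y1).Nonempty) (hBn : (P.near B y1).Nonempty) :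
    ∏ a ∈ P.near A y1, ∏ b ∈ P.near B y1, P.v (a - b) = P.pi ^ (2 ^ i) := by
  rcases (P.WW_cards hg hx hy hax hay hA hB hd hAn hBn).2 with h | h
  · exact P.WW_aux hg hx hy hax hay hA hB hd h.1 h.2
  · rw [Finset.prod_comm, ← P.WW_aux hg hx hy hax hay hB hA hd.symm h.1 h.2]
    apply Finset.prod_congr rfl; intro a _
    apply Finset.prod_congr rfl; intro b _
    rw [Valuation.map_sub_swap]

end WWcase

/-- set of tame, wild critical points -/
def tameC (k : Type) [Field k] (i l : ℕ) : Finset k := (hc k l).roots.toFinset.filter (fun z => al (2 ^ i) l z = 0)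
def wildC (k : Type) [Field k] (i l : ℕ) : Finset k := (hc k l).roots.toFinset.filter (fun z => al (2 ^ i) l z ≠ 0)

lemma mem_tameC (s : Setup k Ω i l) {z : k} : z ∈ tameC k i l ↔ (hc k l).eval z = 0 ∧ al (2 ^ i) l z = 0 := by
  simp [tameC, (hc_monic (k := k) s.hl s.hl3).1.ne_zero]
lemma mem_wildC (s : Setup k Ω i l) {z : k} : z ∈ wildC k i l ↔ (hc k l).eval z = 0 ∧ al (2 ^ i) l z ≠ 0 := by
  simp [wildC, (hc_monic (k := k) s.hl s.hl3).1.ne_zero]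

/-- the local bound on the intersection contribution -/
def contrib (i l : ℕ) (A B : Finset Ω) (y1 : k) : ℕ :=
  if (gp k (2 ^ i) l).eval y1 = (gp k (2 ^ i) l).eval x1 then
    if x1 ∈ tameC k i l ∧ y1 ∈ tameC k i l then (P.near A y1).card * (P.near B y1).card
    else if x1 ∈ wildC k i l ∧ y1 ∈ wildC k i l ∧ Bad i l x1 y1 ∧ (P.near A y1).Nonempty ∧ (P.near B y1).Nonempty
      then 2 ^ i else 0
  else 0

lemma local_contrib {A B : Finset Ω} (hA : s.Rat A) (hB : s.Rat B) (hd : Disjoint A B) (y1 : k)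
    (hg : (gp k (2 ^ i) l).eval y1 = (gp k (2 ^ i) l).eval x1) :
    ∏ a ∈ P.near A y1, ∏ b ∈ P.near B y1, P.v (a - b) = P.pi ^ (P.contrib i l A B y1) := by
  have hempty : (P.near A y1 = ∅ ∨ P.near B y1 = ∅) →
      ∏ a ∈ P.near A y1, ∏ b ∈ P.near B y1, P.v (a - b) = P.pi ^ (P.contrib i l A B y1) := by
    rintro (h | h) <;> simp [contrib, h]
  by_cases hne : P.near A y1 = ∅ ∨ P.near B y1 = ∅
  · exact hempty hne
  have hne' := hne
  push Not at hne
  obtain ⟨hAn, hBn⟩ := hne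
  have hcop : ¬ Nat.Coprime (ee (2 ^ i) l x1) (ee (2 ^ i) l y1) := fun h => hne' (P.mixed hA hB hd hg h)
  have hx : (hc k l).eval x1 = 0 := by
    by_contra h; rw [ee_noncrit s.hl s.hi h] at hcop; simp at hcop
  have hy : (hc k l).eval y1 = 0 := by
    by_contra h; rw [ee_noncrit s.hl s.hi h] at hcop; simp at hcop
  by_cases hax : al (2 ^ i) l x1 = 0
  · have hay : al (2 ^ i) l y1 = 0 := by
      by_contra h
      rw [ee_tame s.hl s.hi hx hax, ee_wild s.hl s.hi hy h] at hcop; simp at hcop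
    rw [contrib, if_pos hg, if_pos ⟨(mem_tameC s).mpr ⟨hx, hax⟩, (mem_tameC s).mpr ⟨hy, hay⟩⟩]
    rw [mul_comm, pow_mul, ← Finset.prod_const]
    apply Finset.prod_congr rfl; intro a ha
    rw [← Finset.prod_const]
    apply Finset.prod_congr rfl; intro b hb
    have he := ee_tame s.hl s.hi hy hay
    refine P.TT hg ?_ hy he (P.near_sub hA.1 _ ha) (P.near_sub hB.1 _ hb) ?_
    · rw [he, ee_tame s.hl s.hi hx hax]
    · rintro rfl
      exact Finset.disjoint_left.mp hd (P.mem_near.mp ha).1 (P.mem_near.mp hb).1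
  · have hay : al (2 ^ i) l y1 ≠ 0 := by
      intro h
      rw [ee_wild s.hl s.hi hx hax, ee_tame s.hl s.hi hy h] at hcop; simp at hcop
    rw [contrib, if_pos hg, if_neg, if_pos]
    · exact P.WW_prod hg hx hy hax hay hA hB hd hAn hBn
    · exact ⟨(mem_wildC s).mpr ⟨hx, hax⟩, (mem_wildC s).mpr ⟨hy, hay⟩, (P.WW_cards hg hx hy hax hay hA hB hd hAn hBn).1,
        hAn, hBn⟩
    · rintro ⟨h, _⟩
      exact hax ((mem_tameC s).mp h).2

/-- global valuation of the resultant at `x1` -/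
lemma res_val {A B : Finset Ω} (hA : s.Rat A) (hB : s.Rat B) (hd : Disjoint A B) {D : k[X]}
    (hD : ∏ a ∈ A, ∏ b ∈ B, (a - b) = s.φ D) :
    D.rootMultiplicity x1 = ∑ y1 ∈ tameC k i l ∪ wildC k i l, P.contrib i l A B y1 := by
  have hD0 : D ≠ 0 := by
    rintro rfl
    rw [map_zero, Finset.prod_eq_zero_iff] at hD
    obtain ⟨a, ha, hD⟩ := hD
    rw [Finset.prod_eq_zero_iff] at hD
    obtain ⟨b, hb, hD⟩ := hD
    rw [sub_eq_zero] at hD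
    exact Finset.disjoint_left.mp hd ha (hD ▸ hb)
  apply P.pi_pow_inj
  rw [← P.vφ D hD0, ← hD]
  set Z : Finset k := (gp k (2 ^ i) l - C ((gp k (2 ^ i) l).eval x1)).roots.toFinset with hZ
  have hpm : (gp k (2 ^ i) l - C ((gp k (2 ^ i) l).eval x1)) ≠ 0 := by
    have hm := (gp_monic (k := k) s.hl s.hl3 s.hi)
    have hdg : 0 < (gp k (2 ^ i) l).natDegree := by
      rw [hm.2]; have := s.hl3; positivity
    refine (hm.1.sub_of_left (by
      apply lt_of_le_of_lt degree_C_le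
      exact natDegree_pos_iff_degree_pos.mp hdg)).ne_zero
  have hmemZ : ∀ z, z ∈ Z ↔ (gp k (2 ^ i) l).eval z = (gp k (2 ^ i) l).eval x1 := by
    intro z; rw [hZ, Multiset.mem_toFinset, mem_roots hpm]; simp [sub_eq_zero]
  have hsum : ∑ y1 ∈ tameC k i l ∪ wildC k i l, P.contrib i l A B y1 = ∑ y1 ∈ Z, P.contrib i l A B y1 := by
    have h1 : ∑ y1 ∈ tameC k i l ∪ wildC k i l, P.contrib i l A B y1 =
        ∑ y1 ∈ (tameC k i l ∪ wildC k i l) ∪ Z, P.contrib i l A B y1 := by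
      apply Finset.sum_subset Finset.subset_union_left
      intro z _ hz
      rw [Finset.mem_union, not_or] at hz
      simp [contrib, hz.1, hz.2]
    rw [h1]
    symm
    apply Finset.sum_subset Finset.subset_union_right
    intro z _ hz
    rw [hmemZ] at hz
    simp [contrib, hz]
  rw [hsum, ← Finset.prod_pow_eq_pow_sum]
  simp only [map_prod]
  have h2 : ∀ a ∈ A, ∏ b ∈ B, P.v (a - b) = ∏ y1 ∈ Z, if P.v (a - s.ι y1) < 1 then ∏ b ∈ P.near B y1, P.v (a - b) else 1 := by
    intro a ha
    obtain ⟨y1, hy1, hgy⟩ := P.exists_near (hA.1 ha)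
    rw [Finset.prod_eq_single_of_mem y1 ((hmemZ y1).mpr hgy), if_pos hy1, ← P.val_prod_at hB.1 hy1, map_prod]
    intro z _ hz
    rw [if_neg]
    intro h
    exact hz (P.near_unique h hy1)
  rw [Finset.prod_congr rfl h2, Finset.prod_comm]
  apply Finset.prod_congr rfl
  intro y1 hy1
  rw [← P.local_contrib hA hB hd y1 ((hmemZ y1).mp hy1)]
  conv_rhs => rw [near, Finset.prod_filter]

end
end FPl
end HM

end

section
open Polynomial
set_option linter.unusedSectionVars false

namespace HM

/-- place at infinity -/
structure IPl {k Ω : Type} [Field k] [Field Ω] {i l : ℕ} (s : Setup k Ω i l) (Γ : Type)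
    [LinearOrderedCommGroupWithZero Γ] where
  v : Valuation Ω Γ
  triv : ∀ c : k, c ≠ 0 → v (s.ι c) = 1
  gt : 1 < v s.x

namespace IPl
noncomputable section
open scoped Classical
variable {k Ω : Type} [Field k] [Field Ω] [CharP k 2] [CharP Ω 2] [IsAlgClosed k] {i l : ℕ} {s : Setup k Ω i l}
  {Γ : Type} [LinearOrderedCommGroupWithZero Γ] (P : IPl s Γ)

def rho : Γ := P.v s.x
lemma rho_gt : 1 < P.rho := P.gt
lemma rho_pos : 0 < P.rho := zero_lt_one.trans P.rho_gt
lemma rho_ne : P.rho ≠ 0 := P.rho_pos.ne'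
lemma rho_pow_inj {a b : ℕ} (h : P.rho ^ a = P.rho ^ b) : a = b :=
  pow_right_injective₀ P.rho_pos P.rho_gt.ne' h
lemma rho_pow_le {a b : ℕ} (h : P.rho ^ a ≤ P.rho ^ b) : a ≤ b :=
  (pow_le_pow_iff_right₀ P.rho_gt).mp h
include P in
lemma x_ne : s.x ≠ 0 := by
  intro h; have := P.rho_ne; rw [rho, h] at this; simp at this

lemma vc (c : k) : P.v (s.ι c) ≤ 1 := by
  by_cases h : c = 0
  · simp [h]
  · exact (P.triv _ h).le

lemma vφ (p : k[X]) (hp : p ≠ 0) : P.v (s.φ p) = P.rho ^ p.natDegree := by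
  rw [s.φ_eq]; exact val_poly_far P.v s.ι P.triv p hp P.gt

lemma vy {y : Ω} (hy : y ∈ s.R) : P.v y = P.rho := by
  have hm := (gp_monic (k := k) s.hl s.hl3 s.hi)
  have hn : 0 < 2 ^ i * l := by have := s.hl3; positivity
  have h1 := (s.mem' y).mp hy
  have h2 := val_poly_far P.v s.ι P.triv _ hm.1.ne_zero P.gt
  rw [hm.2] at h2
  have h3 : 1 < P.v y := by
    by_contra hcon
    have h4 := val_poly_le P.v s.ι P.triv (gp k (2 ^ i) l) (not_lt.mp hcon)
    rw [h1, h2] at h4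
    exact absurd (one_lt_pow₀ P.gt hn.ne') (not_lt.mpr h4)
  have h5 := val_poly_far P.v s.ι P.triv _ hm.1.ne_zero h3
  rw [hm.2, h1, h2] at h5
  exact (FPl.pow_inj hn h5).symm

/-- the `l`-th roots of unity -/
def mu (k : Type) [Field k] (l : ℕ) : Finset k := (X ^ l - 1 : k[X]).roots.toFinset

lemma pol_ne (s : Setup k Ω i l) : (X ^ l - 1 : k[X]) ≠ 0 := by
  have := s.hl3
  exact X_pow_sub_C_ne_zero (by omega) (1 : k)

lemma mem_mu (s : Setup k Ω i l) {ω : k} : ω ∈ mu k l ↔ ω ^ l = 1 := by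
  rw [mu, Multiset.mem_toFinset, mem_roots (pol_ne s)]; simp [sub_eq_zero]

lemma card_mu (s : Setup k Ω i l) : (mu k l).card ≤ l := by
  refine (Multiset.toFinset_card_le _).trans ?_
  refine (card_roots' _).trans ?_
  rw [show (X ^ l - 1 : k[X]) = X ^ l - C 1 by simp, natDegree_X_pow_sub_C]

lemma far_of_ne {y : Ω} {ω ω' : k} (h : P.v (y - s.ι ω * s.x) < P.rho) (hne : ω' ≠ ω) :
    P.v (y - s.ι ω' * s.x) = P.rho := by
  have h1 : P.v (s.ι (ω - ω') * s.x) = P.rho := by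
    rw [map_mul, P.triv _ (sub_ne_zero.mpr hne.symm), one_mul]; rfl
  have : y - s.ι ω' * s.x = (y - s.ι ω * s.x) + s.ι (ω - ω') * s.x := by rw [map_sub]; ring
  rw [this, Valuation.map_add_eq_of_lt_right]
  · exact h1
  · rw [h1]; exact h

lemma near_unique {y : Ω} {ω ω' : k} (h : P.v (y - s.ι ω * s.x) < P.rho) (h' : P.v (y - s.ι ω' * s.x) < P.rho) :
    ω' = ω := by
  by_contra hne
  exact h'.ne (P.far_of_ne h hne)

lemma fund {y : Ω} (hy : y ∈ s.R) : ∃ E : Ω, P.v E ≤ P.rho ^ (2 ^ i * (l - 1)) ∧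
    (y ^ l - s.x ^ l) ^ (2 ^ i) = (y ^ (2 ^ i * (l - 1) + 1) - s.x ^ (2 ^ i * (l - 1) + 1)) + E := by
  obtain ⟨r, hr, hrd⟩ := gp_infty (k := k) s.hl s.hl3 s.hi
  have h1 := (s.mem' y).mp hy
  rw [hr] at h1
  simp only [eval₂_add, eval₂_pow, eval₂_X] at h1
  have hrv : ∀ z : Ω, P.v z = P.rho → P.v (r.eval₂ s.ι z) ≤ P.rho ^ (2 ^ i * (l - 1)) := by
    intro z hz
    by_cases hr0 : r = 0
    · simp [hr0]
    · rw [val_poly_far P.v s.ι P.triv r hr0 (by rw [hz]; exact P.rho_gt), hz]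
      exact pow_le_pow_right₀ P.rho_gt.le hrd
  refine ⟨r.eval₂ s.ι y - r.eval₂ s.ι s.x, P.v.map_sub_le (hrv _ (P.vy hy)) (hrv _ rfl), ?_⟩
  have e : (y ^ l - s.x ^ l) ^ (2 ^ i) = y ^ (2 ^ i * l) + s.x ^ (2 ^ i * l) := by
    rw [CharTwo.sub_eq_add, add_pow_Q, ← pow_mul, ← pow_mul, mul_comm l]
  have e3 : (2 : Ω) = 0 := CharTwo.two_eq_zero
  rw [e]
  linear_combination h1 + (s.x ^ (2 ^ i * l) - y ^ (2 ^ i * (l - 1) + 1)  + s.x ^ (2 ^ i * (l - 1) + 1)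
    - r.eval₂ s.ι y + r.eval₂ s.ι s.x) * e3

lemma prod_mu (s : Setup k Ω i l) (z : Ω) : ∏ ω ∈ mu k l, (z - s.ι ω) = z ^ l - 1 := by
  have hm : (X ^ l - 1 : k[X]).Monic := by
    have := s.hl3
    simpa using monic_X_pow_sub_C (1 : k) (n := l) (by omega)
  have h1 := (IsAlgClosed.splits (X ^ l - 1 : k[X])).eq_prod_roots_of_monic hm
  have hsep : (X ^ l - 1 : k[X]).Separable := by
    have := separable_X_pow_sub_C (n := l) (1 : k) (by rw [cast_odd s.hl]; exact one_ne_zero) one_ne_zero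
    simpa using this
  have hnd := nodup_roots hsep
  have h2 := congrArg (fun p => p.eval₂ s.ι z) h1
  simp only [eval₂_multiset_prod, Multiset.map_map] at h2
  simp only [eval₂_sub, eval₂_pow, eval₂_X, eval₂_one] at h2
  rw [h2, Finset.prod, mu, Multiset.toFinset_val, hnd.dedup]
  congr 1
  apply Multiset.map_congr rfl
  intro a _
  simp

lemma v_quot (z : Ω) (hz : P.v z = P.rho) : P.v (z / s.x) = 1 := by
  rw [map_div₀, hz]; exact div_self P.rho_ne

lemma QN (s : Setup k Ω i l) : 2 ^ i * (l - 1) + 1 < 2 ^ i * l ∧ 2 ^ i * l = 2 ^ i * (l - 1) + 2 ^ i := by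
  have := s.hl3
  have := two_le_Q s.hi
  obtain ⟨m, rfl⟩ : ∃ m, l = m + 1 := ⟨l - 1, by omega⟩
  simp only [Nat.add_sub_cancel, Nat.mul_succ]
  generalize 2 ^ i * m = z at *
  constructor
  · omega
  · trivial

lemma exists_near {y : Ω} (hy : y ∈ s.R) : ∃ ω ∈ mu k l, P.v (y - s.ι ω * s.x) < P.rho := by
  obtain ⟨E, hE, h⟩ := P.fund hy
  have hx := P.x_ne
  have h1 : P.v (y ^ l - s.x ^ l) < P.rho ^ l := by
    apply lt_of_pow_lt_pow_left₀ (2 ^ i) zero_le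
    rw [← map_pow, h, ← pow_mul, mul_comm l]
    have hlt := (QN s).1
    refine P.v.map_add_lt (P.v.map_sub_lt ?_ ?_) ?_
    · rw [map_pow, P.vy hy]; exact pow_lt_pow_right₀ P.rho_gt hlt
    · rw [map_pow]; exact pow_lt_pow_right₀ P.rho_gt hlt
    · exact hE.trans_lt (pow_lt_pow_right₀ P.rho_gt (by omega))
  have h2 : P.v ((y / s.x) ^ l - 1) < 1 := by
    have : (y / s.x) ^ l - 1 = (y ^ l - s.x ^ l) / s.x ^ l := by
      rw [div_pow, sub_div, div_self (pow_ne_zero _ hx)]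
    rw [this, map_div₀, map_pow P.v s.x]
    exact (div_lt_one₀ (pow_pos P.rho_pos _)).mpr h1
  rw [← prod_mu s, map_prod] at h2
  by_contra hcon
  push Not at hcon
  refine absurd h2 (not_lt.mpr (Finset.one_le_prod' ?_))
  intro ω hω
  have := hcon ω hω
  have e : y / s.x - s.ι ω = (y - s.ι ω * s.x) / s.x := by field_simp
  rw [e, map_div₀]
  exact (one_le_div₀ P.rho_pos).mpr this

lemma v_pow_sub {y : Ω} (hy : y ∈ s.R) {ω : k} (hω : ω ∈ mu k l) (h : P.v (y - s.ι ω * s.x) < P.rho) :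
    P.v (y ^ l - s.x ^ l) = P.v (y - s.ι ω * s.x) * P.rho ^ (l - 1) := by
  have hx := P.x_ne
  have hl3 := s.hl3
  have hc : (mu k l).card = l := by
    have h1 := prod_mu s (s.x)
    have hle := card_mu s
    -- compare with degree via valuations
    have h2 : P.v (∏ ω ∈ mu k l, (s.x - s.ι ω)) = P.rho ^ (mu k l).card := by
      rw [map_prod, ← Finset.prod_const]
      apply Finset.prod_congr rfl
      intro ω _
      rw [Valuation.map_sub_eq_of_lt_left]
      · rfl
      · exact (P.vc ω).trans_lt P.gt
    rw [h1, Valuation.map_sub_eq_of_lt_left, map_pow] at h2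
    · exact (P.rho_pow_inj h2).symm
    · rw [map_one, map_pow]; exact one_lt_pow₀ P.gt (by omega)
  have e1 : y ^ l - s.x ^ l = ∏ ω ∈ mu k l, (y - s.ι ω * s.x) := by
    have h1 := prod_mu s (y / s.x)
    have h2 : y ^ l - s.x ^ l = s.x ^ l * ((y / s.x) ^ l - 1) := by
      rw [div_pow, mul_sub, mul_div_cancel₀ _ (pow_ne_zero _ hx), mul_one]
    have h3 : s.x ^ l = ∏ _ω ∈ mu k l, s.x := by rw [Finset.prod_const, hc]
    rw [h2, ← h1, h3, ← Finset.prod_mul_distrib]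
    apply Finset.prod_congr rfl
    intro ω _; field_simp
  rw [e1, map_prod, ← Finset.mul_prod_erase _ _ hω]
  congr 1
  rw [Finset.prod_congr rfl (g := fun _ => P.rho), Finset.prod_const, Finset.card_erase_of_mem hω, hc]
  intro ω' hω'
  exact P.far_of_ne h (Finset.ne_of_mem_erase hω')

lemma wild_val {y : Ω} (hy : y ∈ s.R) {ω : k} (hω : ω ∈ mu k l) (h : P.v (y - s.ι ω * s.x) < P.rho)
    (hw : ω ^ (2 ^ i - 1) ≠ 1) : P.v (y - s.ι ω * s.x) ^ (2 ^ i) = P.rho := by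
  obtain ⟨E, hE, hf⟩ := P.fund hy
  have hx := P.x_ne
  have hQ := two_le_Q s.hi
  set N := 2 ^ i * (l - 1) with hN
  have h1 : P.v (y ^ (N + 1) - s.x ^ (N + 1)) = P.rho ^ (N + 1) := by
    have hp : (X ^ (N + 1) - 1 : k[X]) ≠ 0 := X_pow_sub_C_ne_zero (by omega) (1 : k)
    have hq : P.v (y / s.x - s.ι ω) < 1 := by
      have e : y / s.x - s.ι ω = (y - s.ι ω * s.x) / s.x := by field_simp
      rw [e, map_div₀]; exact (div_lt_one₀ P.rho_pos).mpr h
    have h2 := val_poly_near P.v s.ι P.triv _ hp hq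
    rw [rootMultiplicity_eq_zero, pow_zero] at h2
    · simp only [eval₂_sub, eval₂_pow, eval₂_X, eval₂_one] at h2
      have : y ^ (N + 1) - s.x ^ (N + 1) = s.x ^ (N + 1) * ((y / s.x) ^ (N + 1) - 1) := by
        rw [div_pow, mul_sub, mul_div_cancel₀ _ (pow_ne_zero _ hx), mul_one]
      rw [this, map_mul, h2, mul_one, map_pow]; rfl
    · simp only [IsRoot, eval_sub, eval_pow, eval_X, eval_one, sub_eq_zero]
      intro h3
      apply hw
      have h4 : ω ^ (N + 1) * ω ^ (2 ^ i - 1) = 1 := by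
        rw [← pow_add]
        have : N + 1 + (2 ^ i - 1) = l * 2 ^ i := by have := (QN s).2; rw [mul_comm l]; omega
        rw [this, pow_mul, (mem_mu s).mp hω, one_pow]
      rwa [h3, one_mul] at h4
  have h2 := congrArg P.v hf
  rw [map_pow, P.v_pow_sub hy hω h, Valuation.map_add_eq_of_lt_left, h1, mul_pow, ← pow_mul, mul_comm (l - 1), pow_succ,
    mul_comm (P.rho ^ _)] at h2
  · exact mul_right_cancel₀ (pow_ne_zero _ P.rho_ne) h2
  · rw [h1]; exact hE.trans_lt (pow_lt_pow_right₀ P.rho_gt (by omega))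

lemma tame_val {y : Ω} (hy : y ∈ s.R) {ω : k} (hω : ω ∈ mu k l) (h : P.v (y - s.ι ω * s.x) < P.rho)
    (hw : ω ^ (2 ^ i - 1) = 1) : P.v (y - s.ι ω * s.x) ≤ 1 := by
  obtain ⟨E, hE, hf⟩ := P.fund hy
  have hx := P.x_ne
  have hQ := two_le_Q s.hi
  set N := 2 ^ i * (l - 1) with hN
  have h4 : ω ^ (N + 1) = 1 := by
    have h4 : ω ^ (N + 1) * ω ^ (2 ^ i - 1) = 1 := by
      rw [← pow_add]
      have : N + 1 + (2 ^ i - 1) = l * 2 ^ i := by have := (QN s).2; rw [mul_comm l]; omega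
      rw [this, pow_mul, (mem_mu s).mp hω, one_pow]
    rwa [hw, mul_one] at h4
  have hωx : P.v (s.ι ω * s.x) ≤ P.rho := by rw [map_mul]; exact mul_le_of_le_one_left' (P.vc ω)
  have h1 : P.v (y ^ (N + 1) - s.x ^ (N + 1)) ≤ P.v (y - s.ι ω * s.x) * P.rho ^ N := by
    have e : s.x ^ (N + 1) = (s.ι ω * s.x) ^ (N + 1) := by rw [mul_pow, ← map_pow, h4, map_one, one_mul]
    rw [e, ← (Commute.all y _).mul_geom_sum₂, map_mul]
    refine mul_le_mul_right ?_ _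
    apply P.v.map_sum_le
    intro j hj
    rw [map_mul, map_pow, map_pow, P.vy hy]
    have hj := Finset.mem_range.mp hj
    calc _ ≤ P.rho ^ j * P.rho ^ (N + 1 - 1 - j) := mul_le_mul_right (pow_le_pow_left₀ zero_le hωx _) _
      _ = P.rho ^ N := by rw [← pow_add]; congr 1; omega
  have h2 := congrArg P.v hf
  rw [map_pow, P.v_pow_sub hy hω h, mul_pow, ← pow_mul, mul_comm (l - 1)] at h2
  by_contra hcon
  push Not at hcon
  have h3 : P.v (y - s.ι ω * s.x) ^ 2 ^ i * P.rho ^ N ≤ P.v (y - s.ι ω * s.x) * P.rho ^ N := by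
    rw [h2]
    refine P.v.map_add_le h1 (hE.trans ?_)
    exact le_mul_of_one_le_left' hcon.le
  have h5 : P.v (y - s.ι ω * s.x) ^ 2 ^ i ≤ P.v (y - s.ι ω * s.x) ^ 1 := by
    rw [pow_one]; exact le_of_mul_le_mul_right h3 (pow_pos P.rho_pos _)
  have := (pow_le_pow_iff_right₀ hcon).mp h5
  omega

end
end IPl
end HM

end

section
open Polynomial
set_option linter.unusedSectionVars false

namespace HM
namespace IPl
noncomputable section
open scoped Classical
variable {k Ω : Type} [Field k] [Field Ω] [CharP k 2] [CharP Ω 2] [IsAlgClosed k] {i l : ℕ} {s : Setup k Ω i l}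
  {Γ : Type} [LinearOrderedCommGroupWithZero Γ] (P : IPl s Γ)

def near (S : Finset Ω) (ω : k) : Finset Ω := S.filter (fun y => P.v (y - s.ι ω * s.x) < P.rho)

lemma mem_near {S : Finset Ω} {ω : k} {y : Ω} : y ∈ P.near S ω ↔ y ∈ S ∧ P.v (y - s.ι ω * s.x) < P.rho := by
  simp [near]

lemma not_near {y : Ω} (hy : y ∈ s.R) {ω : k} (h : ¬ P.v (y - s.ι ω * s.x) < P.rho) :
    P.v (y - s.ι ω * s.x) = P.rho := by
  obtain ⟨ω', _, h'⟩ := P.exists_near hy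
  refine P.far_of_ne h' ?_
  rintro rfl; exact h h'

lemma far_sub {y z : Ω} (hy : y ∈ s.R) {ω : k} (hz : P.v (z - s.ι ω * s.x) < P.rho)
    (h : ¬ P.v (y - s.ι ω * s.x) < P.rho) : P.v (z - y) = P.rho := by
  have e : z - y = (z - s.ι ω * s.x) - (y - s.ι ω * s.x) := by ring
  have h1 := P.not_near hy h
  rw [e, Valuation.map_sub_eq_of_lt_right _ (by rw [h1]; exact hz), h1]

lemma val_at {S : Finset Ω} (hS : S ⊆ s.R) {ω : k} {z : Ω} (hz : P.v (z - s.ι ω * s.x) < P.rho) :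
    P.v (∏ y ∈ S, (z - y)) * P.rho ^ (P.near S ω).card = (∏ y ∈ P.near S ω, P.v (z - y)) * P.rho ^ S.card := by
  rw [map_prod, ← Finset.prod_filter_mul_prod_filter_not S (fun y => P.v (y - s.ι ω * s.x) < P.rho)]
  rw [Finset.prod_congr (s₁ := S.filter (fun y => ¬ P.v (y - s.ι ω * s.x) < P.rho)) rfl (g := fun _ => P.rho)]
  · rw [Finset.prod_const, mul_assoc, ← pow_add]
    congr 2
    rw [near, add_comm]
    exact Finset.card_filter_add_card_filter_not _
  · intro y hy
    rw [Finset.mem_filter] at hy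
    exact P.far_sub (hS hy.1) hz hy.2

lemma card_near_le {S : Finset Ω} {ω : k} : (P.near S ω).card ≤ S.card := Finset.card_filter_le _ _

lemma wild_dvd {S : Finset Ω} (hS : s.Rat S) {ω : k} (hω : ω ∈ mu k l) (hw : ω ^ (2 ^ i - 1) ≠ 1) :
    2 ^ i ∣ (P.near S ω).card := by
  obtain ⟨D, hD⟩ := hS.2 (C ω * X)
  have hφ : s.φ (C ω * X) = s.ι ω * s.x := by rw [map_mul]; rfl
  rw [hφ] at hD
  have h1 := P.val_at hS.1 (ω := ω) (z := s.ι ω * s.x) (by rw [sub_self, map_zero]; exact P.rho_pos)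
  have h2 : (∏ y ∈ P.near S ω, P.v (s.ι ω * s.x - y)) ^ (2 ^ i) = P.rho ^ (P.near S ω).card := by
    rw [← Finset.prod_pow, ← Finset.prod_const]
    apply Finset.prod_congr rfl
    intro y hy
    rw [Valuation.map_sub_swap]
    exact P.wild_val (hS.1 (P.mem_near.mp hy).1) hω (P.mem_near.mp hy).2 hw
  have h3 := congrArg (· ^ (2 ^ i)) h1
  simp only [mul_pow] at h3
  rw [h2, hD] at h3
  have hD0 : D ≠ 0 := by
    rintro rfl
    rw [map_zero, map_zero, zero_pow (by positivity), zero_mul] at h3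
    exact (mul_ne_zero (pow_ne_zero _ P.rho_ne) (pow_ne_zero _ (pow_ne_zero _ P.rho_ne))) h3.symm
  rw [P.vφ D hD0, ← pow_mul, ← pow_mul, ← pow_mul, ← pow_add, ← pow_add] at h3
  have h4 := P.rho_pow_inj h3
  rw [← add_mul] at h4
  refine (Nat.dvd_add_left (Dvd.intro_left S.card rfl)).mp ?_
  rw [← h4]
  exact Dvd.intro_left _ rfl

lemma der_near {y : Ω} {ω : k} (hy : y ∈ P.near s.R ω) :
    (∏ y' ∈ (P.near s.R ω).erase y, P.v (y - y')) * P.rho ^ (2 ^ i) = P.rho ^ (P.near s.R ω).card := by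
  have hyR := (P.mem_near.mp hy).1
  have h1 := s.der y hyR
  have hm := hc_monic (k := k) s.hl s.hl3
  have hne : hc k l ^ 2 ^ i ≠ 0 := pow_ne_zero _ hm.1.ne_zero
  have h2 := val_poly_far P.v s.ι P.triv _ hne (by rw [P.vy hyR]; exact P.rho_gt)
  change ∏ y' ∈ s.R.erase y, (y - y') = eval₂ s.ι y _ at h1
  rw [← h1, P.vy hyR, hm.1.natDegree_pow, hm.2] at h2
  have h3 := P.val_at (S := s.R.erase y) (Finset.erase_subset _ _) (ω := ω) (z := y) (P.mem_near.mp hy).2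
  have h4 : P.near (s.R.erase y) ω = (P.near s.R ω).erase y := by
    ext z; simp only [mem_near, Finset.mem_erase]; tauto
  rw [h2, h4, ← pow_add, Finset.card_erase_of_mem hy, Finset.card_erase_of_mem hyR, s.card] at h3
  have hpos : 0 < (P.near s.R ω).card := Finset.card_pos.mpr ⟨y, hy⟩
  have hl3 := s.hl3
  have hQ := (QN s).2
  have hn : 0 < 2 ^ i := by positivity
  have e1 : (∏ y' ∈ (P.near s.R ω).erase y, P.v (y - y')) * P.rho ^ (2 ^ i) * P.rho ^ (2 ^ i * l - 1) =
    P.rho ^ (P.near s.R ω).card * P.rho ^ (2 ^ i * l - 1) := by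
    rw [mul_right_comm, ← h3, ← pow_add, ← pow_add]
    congr 1
    omega
  exact mul_right_cancel₀ (pow_ne_zero _ P.rho_ne) e1

lemma diff_tame {y y' : Ω} (hy : y ∈ s.R) (hy' : y' ∈ s.R) {ω : k} (hω : ω ∈ mu k l)
    (hn : P.v (y - s.ι ω * s.x) < P.rho) (hn' : P.v (y' - s.ι ω * s.x) < P.rho)
    (hw : ω ^ (2 ^ i - 1) = 1) : P.v (y - y') ≤ 1 := by
  have e : y - y' = (y - s.ι ω * s.x) - (y' - s.ι ω * s.x) := by ring
  rw [e]
  exact P.v.map_sub_le (P.tame_val hy hω hn hw) (P.tame_val hy' hω hn' hw)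

lemma diff_wild {y y' : Ω} (hy : y ∈ s.R) (hy' : y' ∈ s.R) {ω : k} (hω : ω ∈ mu k l)
    (hn : P.v (y - s.ι ω * s.x) < P.rho) (hn' : P.v (y' - s.ι ω * s.x) < P.rho)
    (hw : ω ^ (2 ^ i - 1) ≠ 1) : P.v (y - y') ^ (2 ^ i) ≤ P.rho := by
  have h1 := P.wild_val hy hω hn hw
  have h2 := P.wild_val hy' hω hn' hw
  have e3 := FPl.pow_inj (by positivity) (h1.trans h2.symm)
  have e : y - y' = (y - s.ι ω * s.x) - (y' - s.ι ω * s.x) := by ring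
  rw [e]
  calc _ ≤ P.v (y - s.ι ω * s.x) ^ (2 ^ i) :=
        pow_le_pow_left₀ zero_le (P.v.map_sub_le le_rfl e3.symm.le) _
    _ = _ := h1

lemma card_R_le {ω : k} (hω : ω ∈ mu k l) : (P.near s.R ω).card ≤ 2 ^ i := by
  rcases (P.near s.R ω).eq_empty_or_nonempty with h | ⟨y, hy⟩
  · rw [h]; simp
  have h := P.der_near hy
  obtain ⟨hyR, hyn⟩ := P.mem_near.mp hy
  by_cases hw : ω ^ (2 ^ i - 1) = 1
  · apply P.rho_pow_le
    rw [← h]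
    refine mul_le_of_le_one_left' (Finset.prod_le_one' ?_)
    intro y' hy'
    obtain ⟨h1, h2⟩ := P.mem_near.mp (Finset.mem_of_mem_erase hy')
    exact P.diff_tame hyR h1 hω hyn h2 hw
  · have hd := P.wild_dvd s.rat_R hω hw
    have h1 : (∏ y' ∈ (P.near s.R ω).erase y, P.v (y - y')) ^ (2 ^ i) ≤ P.rho ^ ((P.near s.R ω).card - 1) := by
      rw [← Finset.prod_pow, ← Finset.card_erase_of_mem hy, ← Finset.prod_const]
      refine Finset.prod_le_prod' ?_
      intro y' hy'
      obtain ⟨h1, h2⟩ := P.mem_near.mp (Finset.mem_of_mem_erase hy')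
      exact P.diff_wild hyR h1 hω hyn h2 hw
    have h2 := congrArg (· ^ (2 ^ i)) h
    simp only [mul_pow] at h2
    have h3 : P.rho ^ ((P.near s.R ω).card * 2 ^ i) ≤ P.rho ^ ((P.near s.R ω).card - 1 + 2 ^ i * 2 ^ i) := by
      rw [pow_mul, ← h2, pow_add, ← pow_mul P.rho]
      exact mul_le_mul_left h1 _
    have h4 := P.rho_pow_le h3
    have hpos : 0 < (P.near s.R ω).card := Finset.card_pos.mpr ⟨y, hy⟩
    obtain ⟨m, hm⟩ := hd
    have hQ := two_le_Q s.hi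
    rw [hm] at h4 hpos ⊢
    generalize 2 ^ i = Q at *
    have : m ≤ 1 := by
      by_contra hcon
      obtain ⟨n, rfl⟩ : ∃ n, m = n + 2 := ⟨m - 2, by omega⟩
      have h5 : Q * (n + 2) * Q < Q * (n + 2) + Q * Q := by omega
      have h6 : (n + 2) * Q < (n + 2) + Q := by
        by_contra h7
        have := Nat.mul_le_mul_left Q (not_lt.mp h7)
        nlinarith
      nlinarith
    calc Q * m ≤ Q * 1 := Nat.mul_le_mul_left _ this
      _ = Q := mul_one _

lemma sum_near {S : Finset Ω} (hS : S ⊆ s.R) : ∑ ω ∈ mu k l, (P.near S ω).card = S.card := by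
  rw [← Finset.card_biUnion]
  · congr 1
    ext y
    simp only [Finset.mem_biUnion, mem_near]
    constructor
    · rintro ⟨_, _, h, _⟩; exact h
    · intro h
      obtain ⟨ω, h1, h2⟩ := P.exists_near (hS h)
      exact ⟨ω, h1, h, h2⟩
  · intro ω _ ω' _ hne
    rw [Function.onFun, Finset.disjoint_left]
    intro y h1 h2
    exact hne (P.near_unique (P.mem_near.mp h2).2 (P.mem_near.mp h1).2)

lemma card_R {ω : k} (hω : ω ∈ mu k l) : (P.near s.R ω).card = 2 ^ i := by
  by_contra hne
  have hlt := lt_of_le_of_ne (P.card_R_le hω) hne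
  have h1 := P.sum_near (S := s.R) subset_rfl
  have h2 : ∑ ω ∈ mu k l, (P.near s.R ω).card < ∑ ω ∈ mu k l, 2 ^ i :=
    Finset.sum_lt_sum (fun ω h => P.card_R_le h) ⟨ω, hω, hlt⟩
  rw [h1, Finset.sum_const, s.card, smul_eq_mul, mul_comm] at h2
  have := lt_of_mul_lt_mul_right h2 (Nat.zero_le _)
  exact absurd (card_mu s) (not_le.mpr this)

lemma tame_diff_eq {y y' : Ω} {ω : k} (hω : ω ∈ mu k l) (hy : y ∈ P.near s.R ω) (hy' : y' ∈ P.near s.R ω)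
    (hne : y ≠ y') (hw : ω ^ (2 ^ i - 1) = 1) : P.v (y - y') = 1 := by
  have h := P.der_near hy
  obtain ⟨hyR, hyn⟩ := P.mem_near.mp hy
  rw [P.card_R hω] at h
  have h1 : ∏ y' ∈ (P.near s.R ω).erase y, P.v (y - y') = 1 :=
    mul_right_cancel₀ (pow_ne_zero _ P.rho_ne) (h.trans (one_mul _).symm)
  refine (Finset.prod_eq_one_iff_of_le_one' ?_).mp h1 y' (Finset.mem_erase.mpr ⟨hne.symm, hy'⟩)
  intro z hz
  obtain ⟨h1, h2⟩ := P.mem_near.mp (Finset.mem_of_mem_erase hz)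
  exact P.diff_tame hyR h1 hω hyn h2 hw

lemma wild_disj {A B : Finset Ω} (hA : s.Rat A) (hB : s.Rat B) (hd : Disjoint A B) {ω : k} (hω : ω ∈ mu k l)
    (hw : ω ^ (2 ^ i - 1) ≠ 1) {a b : Ω} (ha : a ∈ P.near A ω) (hb : b ∈ P.near B ω) : False := by
  have h1 := Nat.le_of_dvd (Finset.card_pos.mpr ⟨a, ha⟩) (P.wild_dvd hA hω hw)
  have h2 := Nat.le_of_dvd (Finset.card_pos.mpr ⟨b, hb⟩) (P.wild_dvd hB hω hw)
  have hd' : Disjoint (P.near A ω) (P.near B ω) := Finset.disjoint_filter_filter hd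
  have h3 : (P.near A ω ∪ P.near B ω).card ≤ (P.near s.R ω).card := by
    apply Finset.card_le_card
    intro y hy
    rw [Finset.mem_union, mem_near, mem_near] at hy
    rw [mem_near]
    rcases hy with h | h
    · exact ⟨hA.1 h.1, h.2⟩
    · exact ⟨hB.1 h.1, h.2⟩
  rw [Finset.card_union_of_disjoint hd', P.card_R hω] at h3
  have : 0 < 2 ^ i := by positivity
  omega

/-- tame roots of unity -/
def tameW (k : Type) [Field k] (i l : ℕ) : Finset k := (mu k l).filter (fun ω => ω ^ (2 ^ i - 1) = 1)

lemma mem_tameW (s : Setup k Ω i l) {ω : k} : ω ∈ tameW k i l ↔ ω ^ l = 1 ∧ ω ^ (2 ^ i - 1) = 1 := by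
  rw [tameW, Finset.mem_filter, mem_mu s]

lemma res_deg {A B : Finset Ω} (hA : s.Rat A) (hB : s.Rat B) (hd : Disjoint A B) {D : k[X]}
    (hD : ∏ a ∈ A, ∏ b ∈ B, (a - b) = s.φ D) :
    D.natDegree + ∑ ω ∈ tameW k i l, (P.near A ω).card * (P.near B ω).card = A.card * B.card := by
  have hne : ∀ a ∈ A, ∀ b ∈ B, a ≠ b := fun a ha b hb h => Finset.disjoint_left.mp hd ha (h ▸ hb)
  have hD0 : D ≠ 0 := by
    rintro rfl
    rw [map_zero, Finset.prod_eq_zero_iff] at hD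
    obtain ⟨a, ha, hD⟩ := hD
    rw [Finset.prod_eq_zero_iff] at hD
    obtain ⟨b, hb, hD⟩ := hD
    exact hne a ha b hb (sub_eq_zero.mp hD)
  -- exponent of one element
  have key : ∀ a ∈ A, P.v (∏ b ∈ B, (a - b)) *
      P.rho ^ (∑ ω ∈ tameW k i l, if a ∈ P.near A ω then (P.near B ω).card else 0) = P.rho ^ B.card := by
    intro a ha
    obtain ⟨ω, hω, hn⟩ := P.exists_near (hA.1 ha)
    have hin : a ∈ P.near A ω := P.mem_near.mpr ⟨ha, hn⟩
    have h0 := P.val_at hB.1 hn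
    by_cases hw : ω ^ (2 ^ i - 1) = 1
    · have hs : (∑ ω ∈ tameW k i l, if a ∈ P.near A ω then (P.near B ω).card else 0) = (P.near B ω).card := by
        rw [Finset.sum_eq_single ω, if_pos hin]
        · intro ω' _ hne'
          rw [if_neg]
          intro h
          exact hne' (P.near_unique hn (P.mem_near.mp h).2)
        · intro h
          exact absurd (Finset.mem_filter.mpr ⟨hω, hw⟩) h
      rw [hs, h0, Finset.prod_eq_one, one_mul]
      intro b hb
      obtain ⟨hb1, hb2⟩ := P.mem_near.mp hb
      exact P.tame_diff_eq hω (P.mem_near.mpr ⟨hA.1 ha, hn⟩) (P.mem_near.mpr ⟨hB.1 hb1, hb2⟩) (hne a ha b hb1) hw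
    · have hs : (∑ ω ∈ tameW k i l, if a ∈ P.near A ω then (P.near B ω).card else 0) = 0 := by
        apply Finset.sum_eq_zero
        intro ω' hω'
        rw [if_neg]
        intro h
        have := P.near_unique hn (P.mem_near.mp h).2
        rw [this] at hω'
        exact hw (Finset.mem_filter.mp hω').2
      have he : P.near B ω = ∅ := by
        by_contra hcon
        obtain ⟨b, hb⟩ := Finset.nonempty_iff_ne_empty.mpr hcon
        exact P.wild_disj hA hB hd hω hw hin hb
      rw [he] at h0
      rw [hs]
      simpa using h0
  have h1 : ∏ a ∈ A, (P.v (∏ b ∈ B, (a - b)) *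
      P.rho ^ (∑ ω ∈ tameW k i l, if a ∈ P.near A ω then (P.near B ω).card else 0)) = ∏ a ∈ A, P.rho ^ B.card :=
    Finset.prod_congr rfl key
  rw [Finset.prod_mul_distrib, ← map_prod, hD, P.vφ D hD0, Finset.prod_const, Finset.prod_pow_eq_pow_sum,
    ← pow_add, ← pow_mul, Finset.sum_comm] at h1
  have h2 := P.rho_pow_inj h1
  rw [mul_comm A.card, ← h2]
  congr 1
  apply Finset.sum_congr rfl
  intro ω _
  rw [← Finset.sum_filter, Finset.sum_const, smul_eq_mul]
  congr 2
  ext y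
  simp only [Finset.mem_filter, mem_near]
  tauto

lemma deg_le {S : Finset Ω} (hS : s.Rat S) {ω : k} (hω : ω ∈ tameW k i l) {c : k} {D : k[X]}
    (hD : ∏ y ∈ S, (s.φ (C ω * X + C c) - y) = s.φ D) : D.natDegree + (P.near S ω).card ≤ S.card := by
  by_cases hD0 : D = 0
  · rw [hD0, natDegree_zero, zero_add]; exact P.card_near_le
  obtain ⟨hω, hw⟩ := Finset.mem_filter.mp hω
  have hφ : s.φ (C ω * X + C c) = s.ι ω * s.x + s.ι c := by rw [map_add, map_mul]; rfl
  have e : s.ι ω * s.x + s.ι c - s.ι ω * s.x = s.ι c := by ring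
  have h1 := P.val_at hS.1 (ω := ω) (z := s.φ (C ω * X + C c))
    (by rw [hφ, e]; exact (P.vc c).trans_lt P.rho_gt)
  rw [hD, P.vφ D hD0, ← pow_add] at h1
  apply P.rho_pow_le
  rw [h1]
  refine mul_le_of_le_one_left' (Finset.prod_le_one' ?_)
  intro y hy
  obtain ⟨h2, h3⟩ := P.mem_near.mp hy
  have e : s.φ (C ω * X + C c) - y = s.ι c - (y - s.ι ω * s.x) := by rw [hφ]; ring
  rw [e]
  exact P.v.map_sub_le (P.vc c) (P.tame_val (hS.1 h2) hω h3 hw)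

lemma deg_eq {S : Finset Ω} (hS : s.Rat S) {ω : k} (hω : ω ∈ tameW k i l) : ∃ c : k, ∀ D : k[X],
    ∏ y ∈ S, (s.φ (C ω * X + C c) - y) = s.φ D → D.natDegree + (P.near S ω).card = S.card := by
  obtain ⟨hω, hw⟩ := Finset.mem_filter.mp hω
  have hfin : (⋃ y ∈ (P.near S ω : Set Ω), {c : k | P.v (s.ι c - (y - s.ι ω * s.x)) < 1}).Finite := by
    apply Set.Finite.biUnion (Finset.finite_toSet _)
    intro y _
    apply Set.Subsingleton.finite
    intro c hc c' hc'
    by_contra hne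
    have h1 : P.v (s.ι (c - c')) < 1 := by
      have : s.ι (c - c') = (s.ι c - (y - s.ι ω * s.x)) - (s.ι c' - (y - s.ι ω * s.x)) := by
        rw [map_sub]; ring
      rw [this]; exact P.v.map_sub_lt hc hc'
    rw [P.triv _ (sub_ne_zero.mpr hne)] at h1
    exact lt_irrefl _ h1
  haveI : Infinite k := IsAlgClosed.instInfinite
  obtain ⟨c, hc⟩ := hfin.exists_notMem
  refine ⟨c, fun D hD => ?_⟩
  have hφ : s.φ (C ω * X + C c) = s.ι ω * s.x + s.ι c := by rw [map_add, map_mul]; rfl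
  have e : s.ι ω * s.x + s.ι c - s.ι ω * s.x = s.ι c := by ring
  have h1 := P.val_at hS.1 (ω := ω) (z := s.φ (C ω * X + C c))
    (by rw [hφ, e]; exact (P.vc c).trans_lt P.rho_gt)
  rw [hD, Finset.prod_eq_one, one_mul] at h1
  · have hD0 : D ≠ 0 := by
      rintro rfl
      rw [map_zero, map_zero, zero_mul] at h1
      exact pow_ne_zero _ P.rho_ne h1.symm
    rw [P.vφ D hD0, ← pow_add] at h1
    exact P.rho_pow_inj h1
  · intro y hy
    obtain ⟨h2, h3⟩ := P.mem_near.mp hy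
    have e : s.φ (C ω * X + C c) - y = s.ι c - (y - s.ι ω * s.x) := by rw [hφ]; ring
    rw [e]
    refine le_antisymm (P.v.map_sub_le (P.vc c) (P.tame_val (hS.1 h2) hω h3 hw)) ?_
    by_contra hlt
    apply hc
    rw [Set.mem_iUnion₂]
    exact ⟨y, hy, not_le.mp hlt⟩

end
end IPl
end HM

end

section
open Polynomial
set_option linter.unusedSectionVars false
set_option linter.style.haveILetI false

namespace HM
noncomputable section
open scoped Classical
variable {k Ω : Type} [Field k] [Field Ω] [CharP k 2] [CharP Ω 2] [IsAlgClosed k] [IsAlgClosed Ω]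
  [Algebra k[X] Ω] {i l : ℕ}

/-- the two-variable polynomial `g(Y) - g(X)` -/
def FF (k : Type) [Field k] (i l : ℕ) : k[X][X] := (gp k (2 ^ i) l).map C - C (gp k (2 ^ i) l)

lemma FF_monic (hl : Odd l) (hl3 : 3 ≤ l) (hi : 1 ≤ i) :
    (FF k i l).Monic ∧ (FF k i l).natDegree = 2 ^ i * l := by
  have hm := gp_monic (k := k) hl hl3 hi
  have hd : 0 < 2 ^ i * l := by positivity
  have h1 : ((gp k (2 ^ i) l).map (C : k →+* k[X])).natDegree = 2 ^ i * l := by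
    rw [hm.1.natDegree_map, hm.2]
  have hlt : (C (gp k (2 ^ i) l) : k[X][X]).natDegree < ((gp k (2 ^ i) l).map (C : k →+* k[X])).natDegree := by
    rw [natDegree_C, h1]; exact hd
  constructor
  · exact (hm.1.map C).sub_of_left (degree_lt_degree hlt)
  · rw [FF, natDegree_sub_eq_left_of_natDegree_lt hlt, h1]

variable (hinj : Function.Injective (algebraMap k[X] Ω)) (hl : Odd l) (hl3 : 3 ≤ l) (hi : 1 ≤ i)

/-- `FF` in `Ω` -/
def FO (k Ω : Type) [Field k] [Field Ω] [Algebra k[X] Ω] (i l : ℕ) : Polynomial Ω := (FF k i l).map (algebraMap k[X] Ω)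

lemma FO_eq : FO k Ω i l = (gp k (2 ^ i) l).map ((algebraMap k[X] Ω).comp C) - C (algebraMap k[X] Ω (gp k (2 ^ i) l)) := by
  simp [FO, FF, Polynomial.map_map]

include hinj hl hl3 hi in
lemma hc_ne {y : Ω} (hy : (gp k (2 ^ i) l).eval₂ ((algebraMap k[X] Ω).comp C) y = algebraMap k[X] Ω (gp k (2 ^ i) l)) :
    (hc k l).eval₂ ((algebraMap k[X] Ω).comp C) y ≠ 0 := by
  intro h
  have hm := hc_monic (k := k) hl hl3
  have h1 := (IsAlgClosed.splits (hc k l)).eq_prod_roots_of_monic hm.1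
  rw [h1, eval₂_multiset_prod, Multiset.prod_eq_zero_iff, Multiset.map_map, Multiset.mem_map] at h
  obtain ⟨z, _, hz⟩ := h
  simp only [Function.comp, eval₂_sub, eval₂_X, eval₂_C, sub_eq_zero] at hz
  rw [hz, eval₂_at_apply] at hy
  have h2 := hinj hy
  have hg := gp_monic (k := k) hl hl3 hi
  have h3 := congrArg natDegree h2
  rw [natDegree_C, hg.2] at h3
  have : 0 < 2 ^ i * l := by positivity
  omega

include hl hi in
lemma FO_der : derivative (FO k Ω i l) = (hc k l ^ (2 ^ i)).map ((algebraMap k[X] Ω).comp C) := by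
  rw [FO_eq, derivative_sub, derivative_C, sub_zero, derivative_map, derivative_gp hl hi]

include hl hl3 hi in
lemma FO_monic : (FO k Ω i l).Monic ∧ (FO k Ω i l).natDegree = 2 ^ i * l := by
  have := FF_monic (k := k) hl hl3 hi
  exact ⟨this.1.map _, by rw [FO, this.1.natDegree_map, this.2]⟩

include hinj hl hl3 hi in
lemma FO_nodup : (FO k Ω i l).roots.Nodup := by
  rw [Multiset.nodup_iff_count_le_one]
  intro y
  rw [count_roots]
  by_contra hcon
  have hne := (FO_monic (k := k) (Ω := Ω) hl hl3 hi).1.ne_zero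
  obtain ⟨h2, h1⟩ := (one_lt_rootMultiplicity_iff_isRoot hne).mp (not_le.mp hcon)
  rw [FO_der hl hi, IsRoot, eval_map, eval₂_pow] at h1
  refine hc_ne hinj hl hl3 hi (y := y) ?_ (pow_eq_zero_iff (by positivity) |>.mp h1)
  rw [FO_eq, IsRoot] at h2
  simpa [sub_eq_zero, eval_map] using h2

def mkSetup : Setup k Ω i l where
  φ := algebraMap k[X] Ω
  inj := hinj
  hi := hi
  hl := hl
  hl3 := hl3
  R := (FO k Ω i l).roots.toFinset
  card := by
    rw [Multiset.toFinset_card_of_nodup (FO_nodup hinj hl hl3 hi), ← (IsAlgClosed.splits _).natDegree_eq_card_roots,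
      (FO_monic hl hl3 hi).2]
  mem := by
    intro y
    rw [Multiset.mem_toFinset, mem_roots (FO_monic hl hl3 hi).1.ne_zero, FO_eq]
    simp [sub_eq_zero, eval_map]
  prod := by
    intro z
    have h1 := (IsAlgClosed.splits (FO k Ω i l)).eq_prod_roots_of_monic (FO_monic hl hl3 hi).1
    have h2 := congrArg (eval z) h1
    rw [eval_multiset_prod, Multiset.map_map] at h2
    rw [Finset.prod, Multiset.toFinset_val, (FO_nodup hinj hl hl3 hi).dedup]
    simp only [Function.comp, eval_sub, eval_X, eval_C] at h2
    rw [← h2, FO_eq]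
    simp [eval_map]
  der := by
    intro y hy hdec
    obtain rfl : hdec = fun a b => Classical.propDecidable (a = b) := Subsingleton.elim _ _
    rw [Multiset.mem_toFinset] at hy
    have h1 := (IsAlgClosed.splits (FO k Ω i l)).eval_root_derivative (FO_monic hl hl3 hi).1 hy
    rw [FO_der hl hi, eval_map] at h1
    rw [h1, Finset.prod, Finset.erase_val, Multiset.toFinset_val, (FO_nodup hinj hl hl3 hi).dedup]

end
end HM

end

section
open Polynomial
set_option linter.unusedSectionVars false
set_option linter.style.haveILetI false

namespace HM
noncomputable section
open scoped Classical
variable {k Ω : Type} [Field k] [Field Ω] [CharP k 2] [CharP Ω 2] [IsAlgClosed k] [IsAlgClosed Ω]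
   {i l : ℕ}

def IsComp (i l : ℕ) (D : k[X][X]) : Prop := D.Monic ∧ Irreducible D ∧ D ∣ FF k i l

namespace Setup
variable (s : Setup k Ω i l)

def fib (D : k[X][X]) : Finset Ω := s.R.filter (fun y => D.eval₂ s.φ y = 0)

lemma mem_fib {D : k[X][X]} {y : Ω} : y ∈ s.fib D ↔ y ∈ s.R ∧ D.eval₂ s.φ y = 0 := by simp [fib]

lemma FF_map : (FF k i l).map s.φ = ∏ y ∈ s.R, (X - C y) := by
  haveI : Infinite k[X] := Infinite.of_injective _ (C_injective (R := k))
  haveI : Infinite Ω := Infinite.of_injective _ s.inj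
  apply Polynomial.funext
  intro z
  rw [eval_prod]
  simp only [eval_sub, eval_X, eval_C]
  rw [s.prod, FF]
  simp [Polynomial.map_map, eval_map]

variable {s}
lemma fib_prod {D : k[X][X]} (hD : IsComp i l D) : D.map s.φ = ∏ y ∈ s.fib D, (X - C y) := by
  have hdvd : D.map s.φ ∣ ∏ y ∈ s.R, (X - C y) := by
    rw [← s.FF_map]; exact Polynomial.map_dvd _ hD.2.2
  have hne : (∏ y ∈ s.R, (X - C y)) ≠ 0 := Finset.prod_ne_zero_iff.mpr (fun y _ => X_sub_C_ne_zero y)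
  have hle := roots.le_of_dvd hne hdvd
  rw [roots_prod_X_sub_C] at hle
  have hnd : (D.map s.φ).roots.Nodup := Multiset.nodup_of_le hle s.R.nodup
  have h1 := (IsAlgClosed.splits (D.map s.φ)).eq_prod_roots_of_monic (hD.1.map _)
  have h2 : (D.map s.φ).roots.toFinset = s.fib D := by
    ext y
    rw [Multiset.mem_toFinset, mem_fib]
    constructor
    · intro h
      refine ⟨Multiset.mem_of_le hle h, ?_⟩
      rw [← eval_map]; exact (mem_roots'.mp h).2
    · rintro ⟨_, h⟩
      rw [mem_roots (hD.1.map _).ne_zero, IsRoot, eval_map]; exact h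
  rw [h1, ← h2, Finset.prod, Multiset.toFinset_val, hnd.dedup]

lemma fib_eval {D : k[X][X]} (hD : IsComp i l D) (p : k[X]) : ∏ y ∈ s.fib D, (s.φ p - y) = s.φ (D.eval p) := by
  have h := congrArg (eval (s.φ p)) (fib_prod (s := s) hD)
  rw [eval_prod] at h
  simp only [eval_sub, eval_X, eval_C] at h
  rw [← h, eval_map, eval₂_at_apply]

lemma fib_rat {D : k[X][X]} (hD : IsComp i l D) : s.Rat (s.fib D) :=
  ⟨Finset.filter_subset _ _, fun p => ⟨_, fib_eval hD p⟩⟩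

lemma fib_card {D : k[X][X]} (hD : IsComp i l D) : (s.fib D).card = D.natDegree := by
  have h := congrArg natDegree (fib_prod (s := s) hD)
  rw [hD.1.natDegree_map, natDegree_finsetProd_X_sub_C_eq_card] at h
  exact h.symm

variable (s) in
def mp (y : Ω) : k[X][X] := @minpoly k[X] Ω _ _ s.φ.toAlgebra y

lemma mp_facts {y : Ω} (hy : y ∈ s.R) : IsComp i l (s.mp y) ∧ (s.mp y).eval₂ s.φ y = 0 ∧
    ∀ p : k[X][X], p.eval₂ s.φ y = 0 → s.mp y ∣ p := by
  letI : Algebra k[X] Ω := s.φ.toAlgebra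
  haveI : FaithfulSMul k[X] Ω := (faithfulSMul_iff_algebraMap_injective _ _).mpr s.inj
  have hFF : (FF k i l).eval₂ s.φ y = 0 := by
    rw [← eval_map, s.FF_map, eval_prod]
    exact Finset.prod_eq_zero hy (by simp)
  have hIntg : IsIntegral k[X] y := ⟨FF k i l, (FF_monic s.hl s.hl3 s.hi).1, hFF⟩
  have hdv : ∀ p : k[X][X], p.eval₂ s.φ y = 0 → s.mp y ∣ p := fun p hp =>
    minpoly.isIntegrallyClosed_dvd hIntg hp
  exact ⟨⟨minpoly.monic hIntg, minpoly.irreducible hIntg, hdv _ hFF⟩, minpoly.aeval k[X] y, hdv⟩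

lemma eq_mp {D : k[X][X]} (hD : IsComp i l D) {y : Ω} (hy : y ∈ s.fib D) : D = s.mp y := by
  obtain ⟨h1, h2⟩ := s.mem_fib.mp hy
  obtain ⟨h3, _, h4⟩ := mp_facts h1
  have h5 := (h3.2.1.associated_of_dvd hD.2.1 (h4 _ h2))
  exact (eq_of_monic_of_associated h3.1 hD.1 h5).symm

lemma fib_disj {D E : k[X][X]} (hD : IsComp i l D) (hE : IsComp i l E) (hne : D ≠ E) : Disjoint (s.fib D) (s.fib E) := by
  rw [Finset.disjoint_left]
  intro y h1 h2
  exact hne ((eq_mp hD h1).trans (eq_mp hE h2).symm)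

variable (s) in
def comps : Finset k[X][X] := s.R.image s.mp

lemma fib_nonempty {D : k[X][X]} (hD : IsComp i l D) : (s.fib D).Nonempty := by
  rw [← Finset.card_pos, fib_card hD]
  by_contra h
  have := hD.1.natDegree_eq_zero.mp (by omega)
  rw [this] at hD
  exact hD.2.1.not_isUnit isUnit_one

lemma mem_comps {D : k[X][X]} : D ∈ s.comps ↔ IsComp i l D := by
  rw [comps, Finset.mem_image]
  constructor
  · rintro ⟨y, hy, rfl⟩; exact (mp_facts hy).1
  · intro h
    obtain ⟨y, hy⟩ := fib_nonempty (s := s) h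
    exact ⟨y, (s.mem_fib.mp hy).1, (eq_mp h hy).symm⟩

/-- sums over components of filtered counts -/
lemma sum_filter (p : Ω → Prop) [DecidablePred p] : ∑ D ∈ s.comps, ((s.fib D).filter p).card = (s.R.filter p).card := by
  rw [← Finset.card_biUnion]
  · congr 1
    ext y
    simp only [Finset.mem_biUnion, Finset.mem_filter, mem_comps, mem_fib]
    constructor
    · rintro ⟨D, _, h⟩; exact ⟨h.1.1, h.2⟩
    · rintro ⟨h, hp⟩
      exact ⟨s.mp y, (mp_facts h).1, ⟨h, (mp_facts h).2.1⟩, hp⟩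
  · intro D hD E hE hne
    exact Finset.disjoint_filter_filter (fib_disj (mem_comps.mp hD) (mem_comps.mp hE) hne)

lemma sum_deg : ∑ D ∈ s.comps, D.natDegree = 2 ^ i * l := by
  have := sum_filter (s := s) (fun _ => True)
  simp only [Finset.filter_true] at this
  rw [← s.card, ← this]
  exact Finset.sum_congr rfl (fun D hD => (fib_card (mem_comps.mp hD)).symm)

lemma exists_res {D E : k[X][X]} (hD : IsComp i l D) (hE : IsComp i l E) :
    ∃ r : k[X], ∏ a ∈ s.fib D, ∏ b ∈ s.fib E, (a - b) = s.φ r := by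
  refine ⟨resultant D E, ?_⟩
  have h := resultant_eq_prod_eval (D.map s.φ) (E.map s.φ) E.natDegree (by rw [hE.1.natDegree_map])
    (IsAlgClosed.splits _)
  rw [resultant_map_map, hD.1.natDegree_map, (hD.1.map _).leadingCoeff, one_pow, one_mul] at h
  rw [h, fib_prod hD, roots_prod_X_sub_C]
  change _ = ∏ a ∈ s.fib D, _
  apply Finset.prod_congr rfl
  intro a _
  rw [fib_prod hE, eval_prod]
  simp

end Setup
end
end HM

end

section
open Polynomial
set_option linter.unusedSectionVars false
set_option linter.style.haveILetI false

namespace HM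
noncomputable section
open scoped Classical
variable {k Ω : Type} [Field k] [Field Ω] [CharP k 2] [CharP Ω 2] [IsAlgClosed k] [IsAlgClosed Ω]
   {i l : ℕ}

namespace Setup
variable (s : Setup k Ω i l)

lemma exists_FPl (x1 : k) : ∃ (Γ : Type) (_ : LinearOrderedCommGroupWithZero Γ), Nonempty (FPl s Γ x1) := by
  obtain ⟨B, h1, h2⟩ := exists_val s.ι (s.x - s.ι x1) (by
    intro p hp
    have e : s.x - s.ι x1 = s.φ (X - C x1) := by rw [map_sub]; rfl
    rw [e, s.eval₂_φ] at hp
    have h3 : p.comp (X - C x1) = 0 := s.inj (hp.trans (map_zero _).symm)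
    have h4 := congrArg (fun q => q.comp (X + C x1)) h3
    simpa [comp_assoc] using h4)
  exact ⟨_, inferInstance, ⟨⟨B.valuation, h1, h2⟩⟩⟩

lemma exists_IPl : ∃ (Γ : Type) (_ : LinearOrderedCommGroupWithZero Γ), Nonempty (IPl s Γ) := by
  have hx : s.x ≠ 0 := by
    intro h
    exact X_ne_zero (s.inj ((show s.φ X = 0 from h).trans (map_zero _).symm))
  obtain ⟨B, h1, h2⟩ := exists_val s.ι (s.x⁻¹) (by
    intro p hp
    letI : Invertible s.x⁻¹ := invertibleOfNonzero (inv_ne_zero hx)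
    have h3 := (eval₂_reverse_eq_zero_iff s.ι (s.x⁻¹) p).mpr hp
    rw [invOf_eq_inv, inv_inv, ← s.φ_eq] at h3
    have h4 : p.reverse = 0 := s.inj (h3.trans (map_zero _).symm)
    exact reverse_eq_zero.mp h4)
  refine ⟨_, inferInstance, ⟨⟨B.valuation, h1, ?_⟩⟩⟩
  rw [map_inv₀] at h2
  exact (inv_lt_one₀ (zero_lt_iff.mpr ((Valuation.ne_zero_iff _).mpr hx))).mp h2

end Setup

def cc (D : k[X][X]) (x1 y1 : k) : ℕ := (D.eval (C y1)).rootMultiplicity x1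
def ww (D : k[X][X]) (ω : k) : ℕ :=
  sInf (Set.range fun c : k => D.natDegree - (D.eval (C ω * X + C c)).natDegree)

/-- same value of `g` -/
def SV (i l : ℕ) (x1 y1 : k) : Prop := (gp k (2 ^ i) l).eval y1 = (gp k (2 ^ i) l).eval x1

def TP (k : Type) [Field k] (i l : ℕ) : Finset (k × k) :=
  (FPl.tameC k i l ×ˢ FPl.tameC k i l).filter (fun p => SV i l p.1 p.2)
def WP (k : Type) [Field k] (i l : ℕ) : Finset (k × k) :=
  (FPl.wildC k i l ×ˢ FPl.wildC k i l).filter (fun p => SV i l p.1 p.2 ∧ Bad i l p.1 p.2)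

def dd (D : k[X][X]) (x1 y1 : k) : ℕ := if cc D x1 y1 = 0 then 0 else 1

def pair (i l : ℕ) (D E : k[X][X]) : ℕ := (∑ ω ∈ IPl.tameW k i l, ww D ω * ww E ω)
  + (∑ p ∈ TP k i l, cc D p.1 p.2 * cc E p.1 p.2) + 2 ^ i * ∑ p ∈ WP k i l, dd D p.1 p.2 * dd E p.1 p.2

lemma ee_TP (s : Setup k Ω i l) {x1 : k} (h : x1 ∈ FPl.tameC k i l) : ee (2 ^ i) l x1 = 2 ^ i + 1 := by
  have := (FPl.mem_tameC s).mp h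
  exact ee_tame s.hl s.hi this.1 this.2

lemma ee_WP (s : Setup k Ω i l) {x1 : k} (h : x1 ∈ FPl.wildC k i l) : ee (2 ^ i) l x1 = 2 ^ i := by
  have := (FPl.mem_wildC s).mp h
  exact ee_wild s.hl s.hi this.1 this.2

variable {s : Setup k Ω i l}
lemma cc_eq {Γ : Type} [LinearOrderedCommGroupWithZero Γ] {x1 y1 : k} (P : FPl s Γ x1) {D : k[X][X]} (hD : IsComp i l D)
    (hg : SV i l x1 y1) (he : ee (2 ^ i) l x1 = ee (2 ^ i) l y1) : cc D x1 y1 = (P.near (s.fib D) y1).card :=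
  P.eq_card hg he (Setup.fib_rat hD).1 (Setup.fib_eval hD _)

lemma ww_eq {Γ : Type} [LinearOrderedCommGroupWithZero Γ] (P : IPl s Γ) {D : k[X][X]} (hD : IsComp i l D)
    {ω : k} (hω : ω ∈ IPl.tameW k i l) : ww D ω = (P.near (s.fib D) ω).card := by
  obtain ⟨c, hc⟩ := P.deg_eq (Setup.fib_rat hD) hω
  have h1 := hc _ (Setup.fib_eval hD _)
  rw [Setup.fib_card hD] at h1
  apply le_antisymm
  · have h2 : ww D ω ≤ D.natDegree - (D.eval (C ω * X + C c)).natDegree := Nat.sInf_le ⟨c, rfl⟩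
    omega
  · refine le_csInf ⟨_, ⟨c, rfl⟩⟩ ?_
    rintro _ ⟨c', rfl⟩
    have h2 := P.deg_le (Setup.fib_rat hD) hω (Setup.fib_eval hD (C ω * X + C c'))
    rw [Setup.fib_card hD] at h2
    simp only
    omega

lemma bezout (s : Setup k Ω i l) {D E : k[X][X]} (hD : IsComp i l D) (hE : IsComp i l E) (hne : D ≠ E) :
    D.natDegree * E.natDegree ≤ pair i l D E := by
  obtain ⟨r, hr⟩ := Setup.exists_res (s := s) hD hE
  have hdisj := Setup.fib_disj (s := s) hD hE hne
  have hDr := Setup.fib_rat (s := s) hD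
  have hEr := Setup.fib_rat (s := s) hE
  obtain ⟨Γ, _, ⟨P⟩⟩ := s.exists_IPl
  have h1 := P.res_deg hDr hEr hdisj hr
  rw [Setup.fib_card hD, Setup.fib_card hE] at h1
  have h2 : ∑ ω ∈ IPl.tameW k i l, (P.near (s.fib D) ω).card * (P.near (s.fib E) ω).card =
      ∑ ω ∈ IPl.tameW k i l, ww D ω * ww E ω :=
    Finset.sum_congr rfl (fun ω hω => by rw [ww_eq P hD hω, ww_eq P hE hω])
  rw [h2] at h1
  -- the finite part
  have hloc : ∀ x1 : k, r.rootMultiplicity x1 =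
      ∑ y1 ∈ FPl.tameC k i l, (if x1 ∈ FPl.tameC k i l ∧ SV i l x1 y1 then cc D x1 y1 * cc E x1 y1 else 0) +
      ∑ y1 ∈ FPl.wildC k i l, (if x1 ∈ FPl.wildC k i l ∧ SV i l x1 y1 ∧ Bad i l x1 y1 then 
        2 ^ i * (dd D x1 y1 * dd E x1 y1) else 0) := by
    intro x1
    obtain ⟨Γ', _, ⟨P'⟩⟩ := s.exists_FPl x1
    have hdj : Disjoint (FPl.tameC k i l) (FPl.wildC k i l) := by
      rw [Finset.disjoint_left]; intro z h h'
      exact ((FPl.mem_wildC s).mp h').2 ((FPl.mem_tameC s).mp h).2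
    rw [P'.res_val hDr hEr hdisj hr, Finset.sum_union hdj]
    congr 1
    · apply Finset.sum_congr rfl
      intro y1 hy1
      have hnw : y1 ∉ FPl.wildC k i l := Finset.disjoint_left.mp hdj hy1
      unfold FPl.contrib
      by_cases hg : SV i l x1 y1
      · rw [if_pos (show eval y1 (gp k (2 ^ i) l) = eval x1 (gp k (2 ^ i) l) from hg)]
        by_cases hx : x1 ∈ FPl.tameC k i l
        · have he : ee (2 ^ i) l x1 = ee (2 ^ i) l y1 := by rw [ee_TP s hx, ee_TP s hy1]
          rw [if_pos ⟨hx, hy1⟩, if_pos ⟨hx, hg⟩, cc_eq P' hD hg he, cc_eq P' hE hg he]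
        · rw [if_neg (by tauto), if_neg (by tauto), if_neg (by tauto)]
      · rw [if_neg (show ¬ eval y1 (gp k (2 ^ i) l) = eval x1 (gp k (2 ^ i) l) from hg), if_neg (by tauto)]
    · apply Finset.sum_congr rfl
      intro y1 hy1
      have hnw : y1 ∉ FPl.tameC k i l := fun h => Finset.disjoint_left.mp hdj h hy1
      unfold FPl.contrib
      by_cases hg : SV i l x1 y1
      · rw [if_pos (show eval y1 (gp k (2 ^ i) l) = eval x1 (gp k (2 ^ i) l) from hg), if_neg (by tauto)]
        by_cases hx : x1 ∈ FPl.wildC k i l ∧ Bad i l x1 y1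
        · have he : ee (2 ^ i) l x1 = ee (2 ^ i) l y1 := by rw [ee_WP s hx.1, ee_WP s hy1]
          rw [if_pos (by tauto : x1 ∈ FPl.wildC k i l ∧ SV i l x1 y1 ∧ Bad i l x1 y1)]
          simp only [dd, cc_eq P' hD hg he, cc_eq P' hE hg he]
          by_cases hA : (P'.near (s.fib D) y1).Nonempty
          · by_cases hB : (P'.near (s.fib E) y1).Nonempty
            · rw [if_pos ⟨hx.1, hy1, hx.2, hA, hB⟩, if_neg (Finset.card_pos.mpr hA).ne', if_neg (Finset.card_pos.mpr hB).ne']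
              ring
            · rw [if_neg (by tauto)]
              simp [Finset.not_nonempty_iff_eq_empty.mp hB]
          · rw [if_neg (by tauto)]
            simp [Finset.not_nonempty_iff_eq_empty.mp hA]
        · rw [if_neg (by tauto), if_neg (by tauto)]
      · rw [if_neg (show ¬ eval y1 (gp k (2 ^ i) l) = eval x1 (gp k (2 ^ i) l) from hg), if_neg (by tauto)]
  have hr0 : r ≠ 0 := by
    rintro rfl
    rw [map_zero, Finset.prod_eq_zero_iff] at hr
    obtain ⟨a, ha, hr⟩ := hr
    rw [Finset.prod_eq_zero_iff] at hr
    obtain ⟨b, hb, hr⟩ := hr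
    rw [sub_eq_zero] at hr
    exact Finset.disjoint_left.mp hdisj ha (hr ▸ hb)
  have hdeg : r.natDegree ≤ ∑ x1 ∈ r.roots.toFinset, r.rootMultiplicity x1 := by
    rw [(IsAlgClosed.splits r).natDegree_eq_card_roots, ← Multiset.toFinset_sum_count_eq]
    exact Finset.sum_le_sum (fun x _ => (count_roots r).le)
  have hdeg2 : ∑ x1 ∈ r.roots.toFinset, r.rootMultiplicity x1 ≤
      (∑ p ∈ TP k i l, cc D p.1 p.2 * cc E p.1 p.2) + 2 ^ i * ∑ p ∈ WP k i l, dd D p.1 p.2 * dd E p.1 p.2 := by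
    rw [Finset.sum_congr rfl (fun x1 _ => hloc x1), Finset.sum_add_distrib]
    refine add_le_add ?_ ?_
    · rw [TP, Finset.sum_filter, Finset.sum_product]
      have e : ∀ x1, (∑ y1 ∈ FPl.tameC k i l, (if x1 ∈ FPl.tameC k i l ∧ SV i l x1 y1 then cc D x1 y1 * cc E x1 y1 else 0))
        = if x1 ∈ FPl.tameC k i l then (∑ y1 ∈ FPl.tameC k i l, (if SV i l x1 y1 then cc D x1 y1 * cc E x1 y1 else 0)) else 0 := by
        intro x1; by_cases h : x1 ∈ FPl.tameC k i l <;> simp [h]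
      rw [Finset.sum_congr rfl (fun x1 _ => e x1), ← Finset.sum_filter]
      apply Finset.sum_le_sum_of_subset
      intro x hx; exact (Finset.mem_filter.mp hx).2
    · rw [WP, Finset.sum_filter, Finset.sum_product, Finset.mul_sum]
      have e : ∀ x1, (∑ y1 ∈ FPl.wildC k i l, (if x1 ∈ FPl.wildC k i l ∧ SV i l x1 y1 ∧ Bad i l x1 y1 then 
          2 ^ i * (dd D x1 y1 * dd E x1 y1) else 0))
        = if x1 ∈ FPl.wildC k i l then 2 ^ i * (∑ y1 ∈ FPl.wildC k i l, (if SV i l x1 y1 ∧ Bad i l x1 y1 then dd D x1 y1 * dd E x1 y1 else 0)) else 0 := by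
        intro x1; by_cases h : x1 ∈ FPl.wildC k i l <;> simp [h, Finset.mul_sum]
      rw [Finset.sum_congr rfl (fun x1 _ => e x1), ← Finset.sum_filter]
      apply Finset.sum_le_sum_of_subset
      intro x hx; exact (Finset.mem_filter.mp hx).2
  unfold pair
  omega

variable (s) in
lemma sum_ww {ω : k} (hω : ω ∈ IPl.tameW k i l) : ∑ D ∈ s.comps, ww D ω = 2 ^ i := by
  obtain ⟨Γ, _, ⟨P⟩⟩ := s.exists_IPl
  rw [Finset.sum_congr rfl (fun D hD => ww_eq P (Setup.mem_comps.mp hD) hω)]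
  have := Setup.sum_filter (s := s) (fun y => P.v (y - s.ι ω * s.x) < P.rho)
  exact this.trans (P.card_R (Finset.mem_filter.mp hω).1)

variable (s) in
lemma sum_cc {x1 y1 : k} (hg : SV i l x1 y1) (he : ee (2 ^ i) l x1 = ee (2 ^ i) l y1) :
    ∑ D ∈ s.comps, cc D x1 y1 = ee (2 ^ i) l y1 := by
  obtain ⟨Γ, _, ⟨P⟩⟩ := s.exists_FPl x1
  rw [Finset.sum_congr rfl (fun D hD => cc_eq P (Setup.mem_comps.mp hD) hg he)]
  have := Setup.sum_filter (s := s) (fun y => P.v (y - s.ι y1) < 1)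
  exact this.trans (P.card_near_R hg)

lemma two_at_wild (s : Setup k Ω i l) {x1 y1 : k} (hx : x1 ∈ FPl.wildC k i l) (hy : y1 ∈ FPl.wildC k i l) (hg : SV i l x1 y1)
    {D E G : k[X][X]} (hD : IsComp i l D) (hE : IsComp i l E) (hG : IsComp i l G)
    (hDE : D ≠ E) (hDG : D ≠ G) (hEG : E ≠ G) (h1 : cc D x1 y1 ≠ 0) (h2 : cc E x1 y1 ≠ 0) : cc G x1 y1 = 0 := by
  have he : ee (2 ^ i) l x1 = ee (2 ^ i) l y1 := by rw [ee_WP s hx, ee_WP s hy]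
  have hs := sum_cc s hg he
  rw [ee_WP s hy] at hs
  obtain ⟨Γ, _, ⟨P⟩⟩ := s.exists_FPl x1
  have hx' := (FPl.mem_wildC s).mp hx
  have hy' := (FPl.mem_wildC s).mp hy
  have h3 := (P.WW_cards hg hx'.1 hy'.1 hx'.2 hy'.2 (Setup.fib_rat hD) (Setup.fib_rat hE) (Setup.fib_disj hD hE hDE)
    (Finset.card_pos.mp (by rw [← cc_eq P hD hg he]; omega)) (Finset.card_pos.mp (by rw [← cc_eq P hE hg he]; omega))).2
  rw [← cc_eq P hD hg he, ← cc_eq P hE hg he] at h3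
  have hQ := two_le_Q s.hi
  have h4 : ∑ A ∈ ({D, E, G} : Finset k[X][X]), cc A x1 y1 ≤ ∑ A ∈ s.comps, cc A x1 y1 := by
    apply Finset.sum_le_sum_of_subset
    intro A hA
    simp only [Finset.mem_insert, Finset.mem_singleton] at hA
    rw [Setup.mem_comps]
    rcases hA with rfl | rfl | rfl <;> assumption
  rw [hs, Finset.sum_insert (by simp [hDE, hDG]), Finset.sum_insert (by simp [hEG]), Finset.sum_singleton] at h4
  omega

end
end HM

end

section
open Polynomial
set_option linter.unusedSectionVars false
set_option linter.style.haveILetI false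

namespace HM
noncomputable section
open scoped Classical
variable {k Ω : Type} [Field k] [Field Ω] [CharP k 2] [CharP Ω 2] [IsAlgClosed k] [IsAlgClosed Ω]
   {i l : ℕ}

lemma sum_mul_le {α : Type} (S : Finset α) (e : α ≃ α) (he : ∀ a, a ∈ S ↔ e a ∈ S) (f f' : α → ℕ)
    (h : ∀ a, f' (e a) = f a) : ∑ a ∈ S, f a * f' a ≤ ∑ a ∈ S, f a * f a := by
  have h1 : ∑ a ∈ S, f a * f a = ∑ a ∈ S, f' a * f' a :=
    Finset.sum_equiv e he (fun a _ => by rw [h])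
  have h2 : ∑ a ∈ S, (2 * (f a * f' a)) ≤ ∑ a ∈ S, (f a * f a + f' a * f' a) := by
    apply Finset.sum_le_sum
    intro a _
    zify
    nlinarith [sq_nonneg ((f a : ℤ) - f' a)]
  rw [← Finset.mul_sum, Finset.sum_add_distrib, ← h1] at h2
  omega

variable (τ : k ≃+* k)

def sg (D : k[X][X]) : k[X][X] := D.map (mapRingHom (τ : k →+* k))

lemma gp_map : (gp k (2 ^ i) l).map (τ : k →+* k) = gp k (2 ^ i) l := by simp [gp]
lemma hc_map : (hc k l).map (τ : k →+* k) = hc k l := by simp [hc]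

lemma eval_gp (z : k) : (gp k (2 ^ i) l).eval (τ z) = τ ((gp k (2 ^ i) l).eval z) := by simp [gp]
lemma eval_hc (z : k) : (hc k l).eval (τ z) = τ ((hc k l).eval z) := by simp [hc]
lemma al_map (z : k) : al (2 ^ i) l (τ z) = τ (al (2 ^ i) l z) := by simp [al]
lemma be_map (z : k) : be (2 ^ i) l (τ z) = τ (be (2 ^ i) l z) := by simp [be]

lemma SV_map (x y : k) : SV i l (τ x) (τ y) ↔ SV i l x y := by
  rw [SV, SV, eval_gp, eval_gp, τ.injective.eq_iff]

lemma Bad_map' {x y : k} (h : Bad i l x y) : Bad i l (τ x) (τ y) := by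
  obtain ⟨γ, h1, h2⟩ := h
  refine ⟨τ γ, ?_, ?_⟩
  · rw [al_map, al_map, ← map_pow, ← map_mul, h1]
  · rw [be_map, be_map, ← map_pow, ← map_mul, ← map_add, h2, map_zero]

lemma Bad_map (x y : k) : Bad i l (τ x) (τ y) ↔ Bad i l x y :=
  ⟨fun h => by simpa using Bad_map' τ.symm h, Bad_map' τ⟩

lemma FF_sg : sg τ (FF k i l) = FF k i l := by
  have h : (mapRingHom (τ : k →+* k)).comp C = (C : k →+* k[X]).comp (τ : k →+* k) := by
    ext x; simp
  rw [sg, FF, Polynomial.map_sub, map_C, Polynomial.map_map, h, ← Polynomial.map_map, coe_mapRingHom, gp_map]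

lemma IsComp_sg {D : k[X][X]} (hD : IsComp i l D) : IsComp i l (sg τ D) := by
  refine ⟨hD.1.map _, ?_, ?_⟩
  · have e : sg τ D = mapEquiv (mapEquiv τ) D := by
      ext n; simp [sg]
    rw [e, MulEquiv.irreducible_iff]
    exact hD.2.1
  · rw [← FF_sg τ]
    exact Polynomial.map_dvd _ hD.2.2

lemma sg_eval (D : k[X][X]) (p : k[X]) : (sg τ D).eval (p.map (τ : k →+* k)) = (D.eval p).map (τ : k →+* k) := by
  have := eval₂_at_apply (p := D) (mapRingHom (τ : k →+* k)) p
  rw [sg, eval_map]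
  exact this

lemma sg_natDegree {D : k[X][X]} (hD : D.Monic) : (sg τ D).natDegree = D.natDegree := hD.natDegree_map _

lemma cc_sg (D : k[X][X]) (x y : k) : cc (sg τ D) (τ x) (τ y) = cc D x y := by
  have h := sg_eval τ D (C y)
  rw [map_C] at h
  rw [cc, cc]
  change ((sg τ D).eval (C ((τ : k →+* k) y))).rootMultiplicity _ = _
  rw [h]
  exact (eq_rootMultiplicity_map (p := D.eval (C y)) (f := (τ : k →+* k)) τ.injective x).symm

lemma dd_sg (D : k[X][X]) (x y : k) : dd (sg τ D) (τ x) (τ y) = dd D x y := by rw [dd, dd, cc_sg]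

lemma ww_sg {D : k[X][X]} (hD : D.Monic) (ω : k) : ww (sg τ D) (τ ω) = ww D ω := by
  rw [ww, ww, sg_natDegree τ hD]
  congr 1
  rw [← τ.surjective.range_comp]
  congr 1
  funext c
  have h := sg_eval τ D (C ω * X + C c)
  simp only [Polynomial.map_add, Polynomial.map_mul, map_C, map_X] at h
  change _ - ((sg τ D).eval (C ((τ : k →+* k) ω) * X + C ((τ : k →+* k) c))).natDegree = _
  rw [h, natDegree_map_eq_of_injective τ.injective]

lemma tameC_map (s : Setup k Ω i l) (x : k) : τ x ∈ FPl.tameC k i l ↔ x ∈ FPl.tameC k i l := by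
  rw [FPl.mem_tameC s, FPl.mem_tameC s, eval_hc, al_map]; simp
lemma wildC_map (s : Setup k Ω i l) (x : k) : τ x ∈ FPl.wildC k i l ↔ x ∈ FPl.wildC k i l := by
  rw [FPl.mem_wildC s, FPl.mem_wildC s, eval_hc, al_map]; simp
lemma tameW_map (s : Setup k Ω i l) (x : k) : τ x ∈ IPl.tameW k i l ↔ x ∈ IPl.tameW k i l := by
  rw [IPl.mem_tameW s, IPl.mem_tameW s, ← map_pow, ← map_pow, map_eq_one_iff τ τ.injective, map_eq_one_iff τ τ.injective]

lemma pair_sg (s : Setup k Ω i l) {D : k[X][X]} (hD : D.Monic) : pair i l D (sg τ D) ≤ pair i l D D := by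
  refine add_le_add (add_le_add ?_ ?_) (Nat.mul_le_mul_left _ ?_)
  · exact sum_mul_le _ τ.toEquiv (fun a => (tameW_map τ s a).symm) _ _ (fun a => ww_sg τ hD a)
  · refine sum_mul_le _ (τ.toEquiv.prodCongr τ.toEquiv) ?_ (fun p => cc D p.1 p.2) (fun p => cc (sg τ D) p.1 p.2)
      (fun p => cc_sg τ D _ _)
    intro p
    simp only [TP, Finset.mem_filter, Finset.mem_product, Equiv.prodCongr_apply, Prod.map]
    exact (and_congr (and_congr (tameC_map τ s _) (tameC_map τ s _)) (SV_map τ _ _)).symm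
  · refine sum_mul_le _ (τ.toEquiv.prodCongr τ.toEquiv) ?_ (fun p => dd D p.1 p.2) (fun p => dd (sg τ D) p.1 p.2)
      (fun p => dd_sg τ D _ _)
    intro p
    simp only [WP, Finset.mem_filter, Finset.mem_product, Equiv.prodCongr_apply, Prod.map]
    exact (and_congr (and_congr (wildC_map τ s _) (wildC_map τ s _)) (and_congr (SV_map τ _ _) (Bad_map τ _ _))).symm

/-- trivial components -/
def T0 (k : Type) [Field k] (c : k) : k[X][X] := X - C (X + C c)

lemma ww_T0 (c : k) : ww (T0 k c) 1 = 1 := by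
  have h : (fun c' : k => (T0 k c).natDegree - ((T0 k c).eval (C 1 * X + C c')).natDegree) = fun _ => 1 := by
    funext c'
    have : (T0 k c).eval (C 1 * X + C c') = C (c' - c) := by
      simp [T0]
    rw [this, natDegree_C, T0, natDegree_X_sub_C]
  rw [ww, h]
  simp

lemma one_mem_tameW (s : Setup k Ω i l) : (1 : k) ∈ IPl.tameW k i l := by
  rw [IPl.mem_tameW s]; simp

lemma T0_comp (s : Setup k Ω i l) {c : k} (hc : c = 0 ∨ c = 1) : IsComp i l (T0 k c) := by
  refine ⟨monic_X_sub_C _, irreducible_X_sub_C _, ?_⟩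
  rw [T0, dvd_iff_isRoot, IsRoot, FF, eval_sub, eval_C, eval_map]
  have h2 : (2 : k[X]) = 0 := CharTwo.two_eq_zero
  rcases hc with rfl | rfl
  · simp [gp, eval₂_add, eval₂_pow]
  · simp only [gp, eval₂_add, eval₂_pow, eval₂_X, eval₂_one, map_one]
    rw [add_assoc, show (1 + 1 : k[X]) = 0 by linear_combination h2, add_zero]
    ring

lemma pair_T0 (s : Setup k Ω i l) (c : k) : 1 ≤ pair i l (T0 k c) (T0 k c) := by
  have h : ww (T0 k c) 1 * ww (T0 k c) 1 ≤ ∑ ω ∈ IPl.tameW k i l, ww (T0 k c) ω * ww (T0 k c) ω :=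
    Finset.single_le_sum (f := fun ω => ww (T0 k c) ω * ww (T0 k c) ω) (fun _ _ => Nat.zero_le _) (one_mem_tameW s)
  rw [ww_T0] at h
  unfold pair
  omega

lemma sum_dd (s : Setup k Ω i l) {p : k × k} (hp : p ∈ WP k i l) : ∑ D ∈ s.comps, dd D p.1 p.2 ≤ 2 := by
  simp only [WP, Finset.mem_filter, Finset.mem_product] at hp
  simp only [dd]
  rw [Finset.sum_ite, Finset.sum_const_zero, zero_add, Finset.sum_const, smul_eq_mul, mul_one]
  by_contra hcon
  obtain ⟨D, hD, E, hE, G, hG, h1, h2, h3⟩ := Finset.two_lt_card.mp (not_le.mp hcon)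
  simp only [Finset.mem_filter, Setup.mem_comps] at hD hE hG
  exact hG.2 (two_at_wild s hp.1.1 hp.1.2 hp.2.1 hD.1 hE.1 hG.1 h1 h2 h3 hD.2 hE.2)

lemma sum_sum_mul {α β : Type} (A : Finset α) (S : Finset β) (f : α → β → ℕ) :
    ∑ D ∈ A, ∑ E ∈ A, ∑ b ∈ S, f D b * f E b = ∑ b ∈ S, (∑ D ∈ A, f D b) * ∑ D ∈ A, f D b := by
  simp_rw [Finset.sum_mul_sum]
  rw [Finset.sum_comm]
  refine (Finset.sum_congr rfl fun D _ => Finset.sum_comm).trans ?_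
  rw [Finset.sum_comm]
  refine Finset.sum_congr rfl fun D _ => Finset.sum_comm

theorem count_ineq (s : Setup k Ω i l)
    (h : ∀ D, IsComp i l D → D ≠ T0 k 0 → D ≠ T0 k 1 → sg τ D ≠ D) :
    (2 ^ i * l) * (2 ^ i * l) ≤ (IPl.tameW k i l).card * (2 ^ i * 2 ^ i)
      + (TP k i l).card * ((2 ^ i + 1) * (2 ^ i + 1)) + 2 ^ i * ((WP k i l).card * 4) := by
  have h1 : ∀ D ∈ s.comps, ∀ E ∈ s.comps, D.natDegree * E.natDegree ≤ pair i l D E := by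
    intro D hD E hE
    rw [Setup.mem_comps] at hD hE
    by_cases hne : D = E
    · subst hne
      by_cases h0 : D = T0 k 0
      · rw [h0]; refine le_trans ?_ (pair_T0 s 0); rw [T0, natDegree_X_sub_C]
      by_cases h1 : D = T0 k 1
      · rw [h1]; refine le_trans ?_ (pair_T0 s 1); rw [T0, natDegree_X_sub_C]
      have := bezout s hD (IsComp_sg τ hD) (h D hD h0 h1).symm
      rw [sg_natDegree τ hD.1] at this
      exact this.trans (pair_sg τ s hD.1)
    · exact bezout s hD hE hne
  have h2 : (2 ^ i * l) * (2 ^ i * l) ≤ ∑ D ∈ s.comps, ∑ E ∈ s.comps, pair i l D E := by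
    rw [← Setup.sum_deg (s := s), Finset.sum_mul_sum]
    exact Finset.sum_le_sum fun D hD => Finset.sum_le_sum fun E hE => h1 D hD E hE
  refine h2.trans ?_
  simp only [pair, Finset.sum_add_distrib, ← Finset.mul_sum]
  have e2 := sum_sum_mul s.comps (TP k i l) (fun D p => cc D p.1 p.2)
  have e3 := sum_sum_mul s.comps (WP k i l) (fun D p => dd D p.1 p.2)
  rw [sum_sum_mul, e2, e3]
  refine add_le_add (add_le_add ?_ ?_) (Nat.mul_le_mul_left _ ?_)
  · rw [← smul_eq_mul, ← Finset.sum_const]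
    exact Finset.sum_le_sum fun ω hω => by rw [sum_ww s hω]
  · rw [← smul_eq_mul, ← Finset.sum_const]
    refine Finset.sum_le_sum fun p hp => ?_
    simp only [TP, Finset.mem_filter, Finset.mem_product] at hp
    have he := ee_TP s hp.1.2
    rw [sum_cc s hp.2 (by rw [he, ee_TP s hp.1.1]), he]
  · rw [← smul_eq_mul, ← Finset.sum_const]
    exact Finset.sum_le_sum fun p hp => Nat.mul_le_mul (sum_dd s hp) (sum_dd s hp)

end
end HM

end

section
open Polynomial
set_option linter.unusedSectionVars false
set_option linter.style.haveILetI false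

namespace HM
noncomputable section
open scoped Classical
variable {k Ω : Type} [Field k] [Field Ω] [CharP k 2] [CharP Ω 2] [IsAlgClosed k] [IsAlgClosed Ω]
   {i l : ℕ}

lemma card_tameW (s : Setup k Ω i l) : (IPl.tameW k i l).card ≤ Nat.gcd l (2 ^ i - 1) := by
  have hpos : 0 < Nat.gcd l (2 ^ i - 1) := Nat.gcd_pos_of_pos_left _ s.hl.pos
  have h : IPl.tameW k i l ⊆ (nthRoots (Nat.gcd l (2 ^ i - 1)) (1 : k)).toFinset := by
    intro ω hω
    rw [IPl.mem_tameW s] at hω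
    rw [Multiset.mem_toFinset, mem_nthRoots hpos]
    exact pow_gcd_eq_one.mpr hω
  exact (Finset.card_le_card h).trans ((Multiset.toFinset_card_le _).trans (card_nthRoots _ _))

lemma zeta_facts (s : Setup k Ω i l) {z : k} (hz : (hc k l).eval z = 0) :
    z ≠ 0 ∧ ((z + 1) / z) ^ l = 1 ∧ (al (2 ^ i) l z = 0 ↔ ((z + 1) / z) ^ (2 ^ i - 1) = 1) := by
  obtain ⟨h0, h1, h2⟩ := crit_facts s.hl hz
  have h3 : ((z + 1) / z) ^ l = 1 := by
    rw [div_pow, h2, div_self (pow_ne_zero _ h0)]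
  refine ⟨h0, h3, ?_⟩
  have hne : (z + 1) / z ≠ 0 := div_ne_zero h1 h0
  have e : (2 ^ i * (l - 1) + 1) + (2 ^ i - 1) = l * 2 ^ i := by
    have := s.hl.pos
    have h2' : 1 ≤ 2 ^ i := Nat.one_le_two_pow
    obtain ⟨l', rfl⟩ := Nat.exists_eq_add_of_le this
    rw [Nat.add_sub_cancel_left]
    generalize 2 ^ i = Q at h2' ⊢
    obtain ⟨c, rfl⟩ := Nat.exists_eq_add_of_le h2'
    rw [Nat.add_sub_cancel_left]; ring
  have h4 : ((z + 1) / z) ^ (2 ^ i * (l - 1) + 1) * ((z + 1) / z) ^ (2 ^ i - 1) = 1 := by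
    rw [← pow_add, e, pow_mul, h3, one_pow]
  have h5 : al (2 ^ i) l z = 0 ↔ ((z + 1) / z) ^ (2 ^ i * (l - 1) + 1) = 1 := by
    rw [al, CharTwo.add_eq_zero, div_pow, div_eq_one_iff_eq (pow_ne_zero _ h0)]
  rw [h5]
  constructor
  · intro h; rwa [h, one_mul] at h4
  · intro h; rwa [h, mul_one] at h4

lemma card_tameC (s : Setup k Ω i l) : (FPl.tameC k i l).card ≤ (IPl.tameW k i l).card - 1 := by
  rw [← Finset.card_erase_of_mem (one_mem_tameW s)]
  refine Finset.card_le_card_of_injOn (fun z => (z + 1) / z) ?_ ?_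
  · intro z hz
    have hz' := (FPl.mem_tameC s).mp hz
    obtain ⟨h0, h1, h2⟩ := zeta_facts s hz'.1
    rw [Finset.mem_coe, Finset.mem_erase, IPl.mem_tameW s]
    refine ⟨?_, h1, h2.mp hz'.2⟩
    dsimp only
    rw [Ne, div_eq_one_iff_eq h0]
    simp
  · intro z hz w hw h
    have hz' := (zeta_facts s ((FPl.mem_tameC s).mp hz).1).1
    have hw' := (zeta_facts s ((FPl.mem_tameC s).mp hw).1).1
    dsimp only at h
    rw [div_eq_div_iff hz' hw'] at h
    linear_combination -h

lemma card_wildC (s : Setup k Ω i l) : (FPl.wildC k i l).card ≤ l - 1 := by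
  rw [← (hc_monic (k := k) s.hl s.hl3).2]
  exact (Finset.card_filter_le _ _).trans ((Multiset.toFinset_card_le _).trans (card_roots' _))

lemma wildC_empty (s : Setup k Ω i l) (h : l ∣ 2 ^ i - 1) : (FPl.wildC k i l).card = 0 := by
  rw [Finset.card_eq_zero, Finset.eq_empty_iff_forall_notMem]
  intro z hz
  rw [FPl.mem_wildC s] at hz
  obtain ⟨h0, h1, h2⟩ := zeta_facts s hz.1
  apply hz.2
  rw [h2]
  obtain ⟨c, hc⟩ := h
  rw [hc, pow_mul, h1, one_pow]

lemma card_TP : (TP k i l).card ≤ (FPl.tameC k i l).card * (FPl.tameC k i l).card :=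
  (Finset.card_filter_le _ _).trans (Finset.card_product _ _).le
lemma card_WP : (WP k i l).card ≤ (FPl.wildC k i l).card * (FPl.wildC k i l).card :=
  (Finset.card_filter_le _ _).trans (Finset.card_product _ _).le

lemma numerics_one {Q l : ℕ} (hl3 : 3 ≤ l) (hQ : 3 * l + 1 ≤ Q)
    (h : (Q * l) * (Q * l) ≤ l * (Q * Q) + ((l - 1) * (l - 1)) * ((Q + 1) * (Q + 1))) : False := by
  obtain ⟨a, rfl⟩ := Nat.exists_eq_add_of_le hl3
  obtain ⟨b, rfl⟩ := Nat.exists_eq_add_of_le hQ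
  rw [show 3 + a - 1 = 2 + a by omega] at h
  zify at h
  have ha : (0 : ℤ) ≤ a := by positivity
  have hb : (0 : ℤ) ≤ b := by positivity
  have : (0 : ℤ) ≤ a * b := by positivity
  have : (0 : ℤ) ≤ a * b * b := by positivity
  have : (0 : ℤ) ≤ a * a * b := by positivity
  have : (0 : ℤ) ≤ a * a * a := by positivity
  have : (0 : ℤ) ≤ a * a := by positivity
  have : (0 : ℤ) ≤ b * b := by positivity
  nlinarith

lemma numerics_two {Q l g : ℕ} (hQ : 8 ≤ Q) (hl3 : 3 ≤ l) (hg : 1 ≤ g) (hgl : 3 * g ≤ l)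
    (h : (Q * l) * (Q * l) ≤ g * (Q * Q) + ((g - 1) * (g - 1)) * ((Q + 1) * (Q + 1))
      + Q * (((l - 1) * (l - 1)) * 4)) : False := by
  have h1 : (g - 1) * (g - 1) ≤ g * g := Nat.mul_le_mul (by omega) (by omega)
  have h2 : 9 * (g * g) ≤ l * l := by nlinarith
  have h3 : (l - 1) * (l - 1) ≤ l * l := Nat.mul_le_mul (by omega) (by omega)
  have h4 : 64 * ((Q + 1) * (Q + 1)) ≤ 81 * (Q * Q) := by nlinarith
  have h5 : 9 * g ≤ l * l := by nlinarith
  have h6 : 8 * Q ≤ Q * Q := by nlinarith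
  set L := l * l
  set P := Q * Q
  have a1 : 9 * (g * P) ≤ L * P := by nlinarith
  have a2 : 576 * (((g - 1) * (g - 1)) * ((Q + 1) * (Q + 1))) ≤ 81 * (L * P) := by
    calc _ = (9 * ((g - 1) * (g - 1))) * (64 * ((Q + 1) * (Q + 1))) := by ring
      _ ≤ L * (81 * P) := Nat.mul_le_mul (by omega) h4
      _ = _ := by ring
  have a3 : 2 * (Q * (((l - 1) * (l - 1)) * 4)) ≤ L * P := by
    calc _ = ((l - 1) * (l - 1)) * (8 * Q) := by ring
      _ ≤ _ := Nat.mul_le_mul h3 h6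
  have a4 : (Q * l) * (Q * l) = L * P := by simp only [L, P]; ring
  rw [a4] at h
  have : 0 < L * P := by positivity
  omega

lemma numerics_four {l g : ℕ} (hl3 : 3 ≤ l) (hgl : 3 * g ≤ l) (hg : g = 1 ∨ g = 3)
    (h : (4 * l) * (4 * l) ≤ g * (4 * 4) + ((g - 1) * (g - 1)) * ((4 + 1) * (4 + 1))
      + 4 * (((l - 1) * (l - 1)) * 4)) : False := by
  obtain ⟨a, rfl⟩ := Nat.exists_eq_add_of_le hl3
  rw [show 3 + a - 1 = 2 + a by omega] at h
  rcases hg with rfl | rfl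
  · ring_nf at h; omega
  · ring_nf at h; omega

lemma part_big (s : Setup k Ω i l) (τ : k ≃+* k) (hi : 2 ≤ i) (hK : l ≠ 2 ^ i - 1) :
    ∃ D, IsComp i l D ∧ D ≠ T0 k 0 ∧ D ≠ T0 k 1 ∧ sg τ D = D := by
  by_contra hcon
  push Not at hcon
  have h := count_ineq τ s hcon
  set g := Nat.gcd l (2 ^ i - 1) with hg
  have h1 := card_tameW s
  have h2 := card_tameC s
  have h3 := card_wildC s
  have h4 := card_TP (k := k) (i := i) (l := l)
  have h5 := card_WP (k := k) (i := i) (l := l)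
  have hl3 := s.hl3
  have hgpos : 1 ≤ g := Nat.gcd_pos_of_pos_left _ s.hl.pos
  have hQ : 4 ≤ 2 ^ i := by
    calc 4 = 2 ^ 2 := by norm_num
      _ ≤ _ := Nat.pow_le_pow_right (by norm_num) hi
  have h6 : (TP k i l).card ≤ (g - 1) * (g - 1) := h4.trans (Nat.mul_le_mul (by omega) (by omega))
  have hodd : Odd (2 ^ i - 1) := by
    refine Nat.Even.sub_odd (by omega) ?_ odd_one
    exact (Nat.even_pow.mpr ⟨even_two, by omega⟩)
  by_cases hgl : g = l
  · have hd : l ∣ 2 ^ i - 1 := hgl ▸ Nat.gcd_dvd_right _ _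
    have h7 := wildC_empty s hd
    rw [h7] at h5
    have h8 : (WP k i l).card = 0 := by omega
    rw [h8] at h
    obtain ⟨c, hc⟩ := hd
    have hcodd : Odd c := by
      rw [hc] at hodd; exact (Nat.odd_mul.mp hodd).2
    have hc1 : c ≠ 1 := by rintro rfl; apply hK; omega
    have hc3 : 3 ≤ c := by
      obtain ⟨r, hr⟩ := hcodd; omega
    have : l * 3 ≤ l * c := Nat.mul_le_mul_left _ hc3
    refine numerics_one hl3 (Q := 2 ^ i) (by omega) ?_
    refine h.trans ?_
    rw [zero_mul, mul_zero, add_zero]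
    rw [← hg] at h1
    rw [hgl] at h6 h1
    exact add_le_add (Nat.mul_le_mul_right _ h1) (Nat.mul_le_mul_right _ h6)
  · obtain ⟨c, hc⟩ := Nat.gcd_dvd_left l (2 ^ i - 1)
    rw [← hg] at hc
    have hcodd : Odd c := by
      have := s.hl
      rw [hc] at this; exact (Nat.odd_mul.mp this).2
    have hc1 : c ≠ 1 := by rintro rfl; apply hgl; omega
    have hc3 : 3 ≤ c := by
      obtain ⟨r, hr⟩ := hcodd; omega
    have h9 : g * 3 ≤ g * c := Nat.mul_le_mul_left _ hc3
    rw [← hc] at h9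
    have h7 : (WP k i l).card ≤ (l - 1) * (l - 1) := h5.trans (Nat.mul_le_mul h3 h3)
    have h10 := h.trans (add_le_add (add_le_add (Nat.mul_le_mul_right _ h1) (Nat.mul_le_mul_right _ h6))
      (Nat.mul_le_mul_left _ (Nat.mul_le_mul_right _ h7)))
    by_cases hi2 : i = 2
    · subst hi2
      norm_num at h10
      refine numerics_four hl3 (g := g) (by omega) ?_ ?_
      · have hd : g ∣ 3 := by
          have := Nat.gcd_dvd_right l (2 ^ 2 - 1)
          rw [← hg] at this; norm_num at this; exact this
        exact (Nat.dvd_prime Nat.prime_three).mp hd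
      · norm_num; exact h10
    · refine numerics_two (Q := 2 ^ i) (g := g) ?_ hl3 hgpos (by omega) h10
      calc 8 = 2 ^ 3 := by norm_num
        _ ≤ _ := Nat.pow_le_pow_right (by norm_num) (by omega)

lemma T0_ne : T0 k 0 ≠ T0 k 1 := by
  intro h
  have := congrArg (fun p => (p.eval 0).eval 0) h
  simp [T0] at this

lemma cc_T0 {x c : k} : cc (T0 k c) x (x + c) ≠ 0 := by
  have e : (T0 k c).eval (C (x + c)) = -(X - C x) := by simp [T0]
  rw [cc, e, ← Nat.pos_iff_ne_zero, rootMultiplicity_pos (neg_ne_zero.mpr (X_sub_C_ne_zero x))]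
  simp

lemma bad_two (s : Setup k Ω 1 l) {x y : k} (h : (x, y) ∈ WP k 1 l) : y = x + 0 ∨ y = x + 1 := by
  simp only [WP, Finset.mem_filter, Finset.mem_product] at h
  obtain ⟨⟨hx, hy⟩, hg, γ, h1, h2⟩ := h
  rw [FPl.mem_wildC s] at hx hy
  obtain ⟨x0, x1, hx2⟩ := crit_facts s.hl hx.1
  obtain ⟨y0, y1, hy2⟩ := crit_facts s.hl hy.1
  have key : ∀ z : k, z ≠ 0 → z + 1 ≠ 0 → (z + 1) ^ l = z ^ l → (gp k (2 ^ 1) l).eval z = (z ^ l) ^ 2 ∧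
      al (2 ^ 1) l z * (z * (z + 1)) = (z ^ l) ^ 2 ∧ be (2 ^ 1) l z * (z * (z + 1)) ^ 2 = (z ^ l) ^ 2 := by
    intro z z0 z1 hz
    have c2 : (2 : k) = 0 := CharTwo.two_eq_zero
    obtain ⟨m, hm⟩ : ∃ m, l = m + 1 := ⟨l - 1, by have := s.hl.pos; omega⟩
    subst hm
    rw [al, be, Nat.add_sub_cancel]
    refine ⟨?_, ?_, ?_⟩
    · simp only [gp, eval_add, eval_pow, eval_X, eval_one]
      have : ∀ w : k, w ^ (2 ^ 1 * (m + 1) + 1) = (w ^ (m + 1)) ^ 2 * w := by intro w; ring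
      rw [this, this, hz]
      linear_combination ((z ^ (m + 1)) ^ 2 * z) * c2
    · have : ∀ w : k, w ^ (2 ^ 1 * m + 1) * w = (w ^ (m + 1)) ^ 2 := by intro w; ring
      have a := this z
      have b := this (z + 1)
      rw [hz] at b
      linear_combination z * b + (z + 1) * a + (z * (z ^ (m + 1)) ^ 2) * c2
    · have : ∀ w : k, w ^ (2 ^ 1 * m) * w ^ 2 = (w ^ (m + 1)) ^ 2 := by intro w; ring
      have a := this z
      have b := this (z + 1)
      rw [hz] at b
      linear_combination z ^ 2 * b + (z + 1) ^ 2 * a + ((z + z ^ 2) * (z ^ (m + 1)) ^ 2) * c2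
  obtain ⟨a1, a2, a3⟩ := key x x0 x1 hx2
  obtain ⟨b1, b2, b3⟩ := key y y0 y1 hy2
  rw [SV, a1, b1] at hg
  rw [hg] at b2 b3
  set A := (x ^ l) ^ 2 with hA
  have hA0 : A ≠ 0 := pow_ne_zero _ (pow_ne_zero _ x0)
  set p := x * (x + 1) with hp
  set r := y * (y + 1) with hr
  have p0 : p ≠ 0 := mul_ne_zero x0 x1
  have r0 : r ≠ 0 := mul_ne_zero y0 y1
  have e1 : al (2 ^ 1) l x = A / p := by rw [eq_div_iff p0]; exact a2
  have e2 : al (2 ^ 1) l y = A / r := by rw [eq_div_iff r0]; exact b2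
  have e3 : be (2 ^ 1) l x = A / p ^ 2 := by rw [eq_div_iff (pow_ne_zero _ p0)]; exact a3
  have e4 : be (2 ^ 1) l y = A / r ^ 2 := by rw [eq_div_iff (pow_ne_zero _ r0)]; exact b3
  rw [e1, e2] at h1
  rw [e3, e4] at h2
  norm_num at h1 h2
  have c1 : γ ^ 2 * p = r := by
    field_simp at h1
    linear_combination h1
  have c2 : r ^ 2 = p ^ 2 * γ ^ 3 := by
    rw [CharTwo.add_eq_zero] at h2
    field_simp at h2
    linear_combination h2
  have c3 : γ ^ 3 * p ^ 2 * (γ + 1) = 0 := by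
    have t2 : (2 : k) = 0 := CharTwo.two_eq_zero
    rw [← c1] at c2
    linear_combination c2 + γ ^ 3 * p ^ 2 * t2
  have γ0 : γ ≠ 0 := by rintro rfl; apply r0; rw [← c1]; ring
  have hγ : γ + 1 = 0 := by
    rcases mul_eq_zero.mp c3 with h | h
    · exact absurd h (mul_ne_zero (pow_ne_zero _ γ0) (pow_ne_zero _ p0))
    · exact h
  have hγ1 : γ = 1 := by rw [CharTwo.add_eq_zero] at hγ; exact hγ
  rw [hγ1, one_pow, one_mul, hp, hr] at c1
  have t2 : (2 : k) = 0 := CharTwo.two_eq_zero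
  have : (y - (x + 0)) * (y - (x + 1)) = 0 := by linear_combination -c1 + (x ^ 2 + x - x * y - y ) * t2
  rcases mul_eq_zero.mp this with h | h
  · left; exact sub_eq_zero.mp h
  · right; exact sub_eq_zero.mp h

lemma part_two (s : Setup k Ω 1 l) (τ : k ≃+* k) :
    ∃ D, IsComp 1 l D ∧ D ≠ T0 k 0 ∧ D ≠ T0 k 1 ∧ sg τ D = D := by
  have hex : ∃ D, IsComp 1 l D ∧ D ≠ T0 k 0 ∧ D ≠ T0 k 1 := by
    by_contra hcon
    push Not at hcon
    have h : s.comps ⊆ {T0 k 0, T0 k 1} := by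
      intro D hD
      rw [Finset.mem_insert, Finset.mem_singleton]
      by_contra hc
      push Not at hc
      exact hc.2 (hcon D (Setup.mem_comps.mp hD) hc.1)
    have h1 := Finset.sum_le_sum_of_subset (f := fun D : k[X][X] => D.natDegree) h
    rw [Setup.sum_deg, Finset.sum_pair T0_ne, T0, T0, natDegree_X_sub_C, natDegree_X_sub_C] at h1
    have := s.hl3
    omega
  obtain ⟨D, hD, h0, h1⟩ := hex
  refine ⟨D, hD, h0, h1, ?_⟩
  by_contra hne
  have hE := IsComp_sg τ hD
  have E0 : sg τ D ≠ T0 k 0 := by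
    intro h
    apply h0
    have : sg τ.symm (sg τ D) = D := by
      rw [sg, sg, Polynomial.map_map]
      have : (mapRingHom (τ.symm : k →+* k)).comp (mapRingHom (τ : k →+* k)) = RingHom.id _ := by
        ext x <;> simp
      rw [this, Polynomial.map_id]
    rw [← this, h]
    simp [sg, T0]
  have E1 : sg τ D ≠ T0 k 1 := by
    intro h
    apply h1
    have : sg τ.symm (sg τ D) = D := by
      rw [sg, sg, Polynomial.map_map]
      have : (mapRingHom (τ.symm : k →+* k)).comp (mapRingHom (τ : k →+* k)) = RingHom.id _ := by
        ext x <;> simp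
      rw [this, Polynomial.map_id]
    rw [← this, h]
    simp [sg, T0]
  have hb := bezout s hD hE (Ne.symm hne)
  have hdeg : 0 < D.natDegree := by
    rcases Nat.eq_zero_or_pos D.natDegree with h | h
    · exact absurd ((Polynomial.Monic.natDegree_eq_zero hD.1).mp h ▸ isUnit_one) hD.2.1.not_isUnit
    · exact h
  have hdeg2 : 0 < (sg τ D).natDegree := by rw [sg_natDegree τ hD.1]; exact hdeg
  have hpos := Nat.mul_pos hdeg hdeg2
  have hw := card_tameW s
  norm_num at hw
  have htc : (FPl.tameC k 1 l) = ∅ := by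
    have := card_tameC s
    rw [← Finset.card_eq_zero]; omega
  have hTP : TP k 1 l = ∅ := by simp [TP, htc]
  have hww : ∀ ω ∈ IPl.tameW k 1 l, ww D ω * ww (sg τ D) ω = 0 := by
    intro ω hω
    have hω1 : ω = 1 := by
      have := ((IPl.mem_tameW s).mp hω).2
      norm_num at this; exact this
    subst hω1
    have hs := sum_ww s hω
    have hsub : ({T0 k 0, T0 k 1, D} : Finset (k[X][X])) ⊆ s.comps := by
      intro E hE
      rw [Setup.mem_comps]
      simp only [Finset.mem_insert, Finset.mem_singleton] at hE
      rcases hE with rfl | rfl | rfl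
      · exact T0_comp s (Or.inl rfl)
      · exact T0_comp s (Or.inr rfl)
      · exact hD
    have h2 := Finset.sum_le_sum_of_subset (f := fun D : k[X][X] => ww D 1) hsub
    rw [hs, Finset.sum_insert, Finset.sum_pair h1.symm, ww_T0, ww_T0] at h2
    · have : ww D 1 = 0 := by omega
      rw [this, zero_mul]
    · simp only [Finset.mem_insert, Finset.mem_singleton, not_or]
      exact ⟨T0_ne, h0.symm⟩
  have hdd : ∀ p ∈ WP k 1 l, dd D p.1 p.2 * dd (sg τ D) p.1 p.2 = 0 := by
    rintro ⟨x, y⟩ hp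
    have hb := bad_two s hp
    simp only [WP, Finset.mem_filter, Finset.mem_product] at hp
    obtain ⟨⟨hx, hy⟩, hg, -⟩ := hp
    by_cases hcD : cc D x y = 0
    · simp [dd, hcD]
    have : cc (sg τ D) x y = 0 := by
      rcases hb with hb | hb
      · refine two_at_wild s hx hy hg hD (T0_comp s (Or.inl rfl)) hE h0 (Ne.symm hne) E0.symm hcD ?_
        rw [hb]; exact cc_T0
      · refine two_at_wild s hx hy hg hD (T0_comp s (Or.inr rfl)) hE h1 (Ne.symm hne) E1.symm hcD ?_
        rw [hb]; exact cc_T0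
    simp [dd, this]
  rw [pair, hTP, Finset.sum_eq_zero hww, Finset.sum_eq_zero hdd] at hb
  simp at hb
  omega

theorem part_one (hl : Odd l) (hl3 : 3 ≤ l) (hi : 1 ≤ i) (hK : l ≠ 2 ^ i - 1) (τ : k ≃+* k) :
    ∃ D, IsComp i l D ∧ D ≠ T0 k 0 ∧ D ≠ T0 k 1 ∧ sg τ D = D := by
  letI : CharP (AlgebraicClosure (RatFunc k)) 2 :=
    charP_of_injective_algebraMap (FaithfulSMul.algebraMap_injective k (AlgebraicClosure (RatFunc k))) 2
  have s : Setup k (AlgebraicClosure (RatFunc k)) i l :=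
    mkSetup (by
      rw [IsScalarTower.algebraMap_eq k[X] (RatFunc k) (AlgebraicClosure (RatFunc k))]
      exact (algebraMap (RatFunc k) (AlgebraicClosure (RatFunc k))).injective.comp
        (IsFractionRing.injective k[X] (RatFunc k))) hl hl3 hi
  by_cases h : i = 1
  · subst h; exact part_two s τ
  · exact part_big s τ (by omega) hK

end
end HM

end

section
open Polynomial
set_option linter.unusedSectionVars false
set_option linter.style.haveILetI false

namespace HM
noncomputable section
open scoped Classical

lemma indep_pow {k L : Type} [Field k] [Field L] [Algebra k L] [CharP L 2]
    (hconst : ∀ z : L, (∀ e : ℕ, ∃ w : L, w ^ 2 ^ e = z) → ∃ c : k, algebraMap k L c = z) :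
    ∀ (n : ℕ) (v : Fin n → L), LinearIndependent k v →
      ∃ e0, ∀ e, e0 ≤ e → ∀ u : Fin n → L, ∑ s, v s * u s ^ 2 ^ e = 0 → u = 0 := by
  intro n
  induction n with
  | zero => intro v _; exact ⟨0, fun e _ u _ => Subsingleton.elim _ _⟩
  | succ n ih =>
    intro v hv
    obtain ⟨e0, he0⟩ := ih (fun s => v s.castSucc) (hv.comp _ (Fin.castSucc_injective n))
    by_contra hcon
    push Not at hcon
    have h1 : ∀ e, e0 ≤ e → ∃ w : Fin n → L, v (Fin.last n) = ∑ s, v (Fin.castSucc s) * w s ^ 2 ^ e := by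
      intro e he
      obtain ⟨e', he', u, hu, hu0⟩ := hcon e
      rw [Fin.sum_univ_castSucc] at hu
      have hl : u (Fin.last n) ≠ 0 := by
        intro h
        rw [h, zero_pow (by positivity), mul_zero, add_zero] at hu
        have := he0 e' (he.trans he') (fun s => u s.castSucc) hu
        apply hu0
        funext s
        refine Fin.lastCases ?_ (fun s => ?_) s
        · exact h
        · exact congrFun this s
      refine ⟨fun s => (u s.castSucc / u (Fin.last n)) ^ 2 ^ (e' - e), ?_⟩
      have e1 : ∀ s : Fin n, ((u s.castSucc / u (Fin.last n)) ^ 2 ^ (e' - e)) ^ 2 ^ e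
          = u s.castSucc ^ 2 ^ e' / u (Fin.last n) ^ 2 ^ e' := by
        intro s
        rw [← pow_mul, ← pow_add, Nat.sub_add_cancel he', div_pow]
      simp only [e1]
      have h2 : (u (Fin.last n)) ^ 2 ^ e' ≠ 0 := pow_ne_zero _ hl
      simp only [mul_div_assoc']
      rw [← Finset.sum_div, eq_div_iff h2]
      exact (CharTwo.add_eq_zero.mp hu).symm
    choose! w hw using h1
    have h2 : ∀ s, ∃ c : k, algebraMap k L c = w e0 s ^ 2 ^ e0 := by
      intro s
      apply hconst
      intro e
      rcases le_total e0 e with he | he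
      · refine ⟨w e s, ?_⟩
        have h3 : ∑ s, v (Fin.castSucc s) * (w e s ^ 2 ^ (e - e0) - w e0 s) ^ 2 ^ e0 = 0 := by
          have e1 : ∀ s, (w e s ^ 2 ^ (e - e0) - w e0 s) ^ 2 ^ e0 = w e s ^ 2 ^ e - w e0 s ^ 2 ^ e0 := by
            intro s
            rw [sub_pow_char_pow, ← pow_mul, ← pow_add, Nat.sub_add_cancel he]
          simp only [e1, mul_sub]
          rw [Finset.sum_sub_distrib, ← hw e he, ← hw e0 le_rfl, sub_self]
        have h4 := congrFun (he0 e0 le_rfl _ h3) s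
        have h5 : w e s ^ 2 ^ (e - e0) = w e0 s := sub_eq_zero.mp h4
        rw [← h5, ← pow_mul, ← pow_add, Nat.sub_add_cancel he]
      · refine ⟨w e0 s ^ 2 ^ (e0 - e), ?_⟩
        rw [← pow_mul, ← pow_add, Nat.sub_add_cancel he]
    choose c hc using h2
    have h3 := Fintype.linearIndependent_iff.mp hv (Fin.snoc c (-1)) (by
      rw [Fin.sum_univ_castSucc]
      simp only [Fin.snoc_castSucc, Fin.snoc_last, neg_smul, one_smul]
      rw [hw e0 le_rfl, add_neg_eq_zero]
      refine Finset.sum_congr rfl fun s _ => ?_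
      rw [Algebra.smul_def, hc, mul_comm]) (Fin.last n)
    simp at h3

lemma ratfunc_const {k : Type} [Field k] [IsAlgClosed k] (r : RatFunc k)
    (h : ∀ e : ℕ, ∃ w : RatFunc k, w ^ 2 ^ e = r) : ∃ c : k, algebraMap k (RatFunc k) c = r := by
  by_cases hr : r = 0
  · exact ⟨0, by rw [hr, map_zero]⟩
  have key : r.num.natDegree = 0 ∧ r.denom.natDegree = 0 := by
    obtain ⟨w, hw⟩ := h (r.num.natDegree + r.denom.natDegree)
    set N := r.num.natDegree + r.denom.natDegree with hN
    have hlt : N < 2 ^ N := Nat.lt_two_pow_self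
    have h1 : r.num * w.denom ^ 2 ^ N = w.num ^ 2 ^ N * r.denom := by
      apply (IsFractionRing.injective k[X] (RatFunc k))
      have a := RatFunc.num_div_denom r
      have b := RatFunc.num_div_denom w
      have hr' : algebraMap k[X] (RatFunc k) r.denom ≠ 0 := RatFunc.algebraMap_ne_zero r.denom_ne_zero
      have hw' : algebraMap k[X] (RatFunc k) w.denom ≠ 0 := RatFunc.algebraMap_ne_zero w.denom_ne_zero
      rw [← b, ← a, div_pow, div_eq_div_iff (pow_ne_zero _ hw') hr'] at hw
      simp only [map_mul, map_pow]
      exact hw.symm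
    have c1 : IsCoprime (w.num ^ 2 ^ N) (w.denom ^ 2 ^ N) := (RatFunc.isCoprime_num_denom w).pow
    have c2 := RatFunc.isCoprime_num_denom r
    have a1 : w.num ^ 2 ^ N ∣ r.num := c1.dvd_of_dvd_mul_right ⟨_, h1⟩
    have a2 : w.denom ^ 2 ^ N ∣ r.denom := c1.symm.dvd_of_dvd_mul_left ⟨r.num, by rw [← h1]; ring⟩
    have a3 : r.num ∣ w.num ^ 2 ^ N := c2.dvd_of_dvd_mul_right ⟨_, h1.symm⟩
    have a4 : r.denom ∣ w.denom ^ 2 ^ N := c2.symm.dvd_of_dvd_mul_left ⟨w.num ^ 2 ^ N, by rw [h1]; ring⟩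
    have hn0 : r.num ≠ 0 := RatFunc.num_ne_zero hr
    have d1 := natDegree_le_of_dvd a1 hn0
    have d2 := natDegree_le_of_dvd a2 r.denom_ne_zero
    have w0 : w ≠ 0 := by
      rintro rfl
      rw [zero_pow (by positivity)] at hw
      exact hr hw.symm
    have d3 := natDegree_le_of_dvd a3 (pow_ne_zero _ (RatFunc.num_ne_zero w0))
    have d4 := natDegree_le_of_dvd a4 (pow_ne_zero _ w.denom_ne_zero)
    rw [natDegree_pow] at d1 d2 d3 d4
    have f1 : w.num.natDegree = 0 := by
      by_contra hne
      have := Nat.mul_le_mul_left (2 ^ N) (Nat.one_le_iff_ne_zero.mpr hne)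
      omega
    have f2 : w.denom.natDegree = 0 := by
      by_contra hne
      have := Nat.mul_le_mul_left (2 ^ N) (Nat.one_le_iff_ne_zero.mpr hne)
      omega
    rw [f1] at d3
    rw [f2] at d4
    omega
  refine ⟨r.num.coeff 0 / r.denom.coeff 0, ?_⟩
  have h1 : algebraMap k (RatFunc k) (r.num.coeff 0) = algebraMap k[X] (RatFunc k) r.num := by
    rw [IsScalarTower.algebraMap_apply k k[X] (RatFunc k), algebraMap_eq, ← eq_C_of_natDegree_eq_zero key.1]
  have h2 : algebraMap k (RatFunc k) (r.denom.coeff 0) = algebraMap k[X] (RatFunc k) r.denom := by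
    rw [IsScalarTower.algebraMap_apply k k[X] (RatFunc k), algebraMap_eq, ← eq_C_of_natDegree_eq_zero key.2]
  rw [map_div₀, h1, h2, RatFunc.num_div_denom]

/-- elements with all `2^e`-th roots in a finite extension of `k(X)` are constants -/
lemma const_of_roots {k L : Type} [Field k] [IsAlgClosed k] [Field L] [Algebra k L] [Algebra (RatFunc k) L]
    [IsScalarTower k (RatFunc k) L] [FiniteDimensional (RatFunc k) L] (z : L)
    (h : ∀ e : ℕ, ∃ w : L, w ^ 2 ^ e = z) [CharP L 2] : ∃ c : k, algebraMap k L c = z := by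
  set K := RatFunc k
  set p : Polynomial K := (LinearMap.charpoly (Algebra.lmul K L z)) with hp
  have hev : ∀ c : K, p.eval c = Algebra.norm K (algebraMap K L c - z) := by
    intro c
    rw [hp, LinearMap.eval_charpoly, Algebra.norm_apply]
    congr 1
    ext x
    simp [Algebra.smul_def, sub_mul]
  have h1 : ∀ c : k, ∃ c' : k, algebraMap k K c' = p.eval (algebraMap k K c) := by
    intro c
    rw [hev]
    apply ratfunc_const
    intro e
    obtain ⟨w, hw⟩ := h e
    obtain ⟨a, ha⟩ := IsAlgClosed.exists_pow_nat_eq c (n := 2 ^ e) (by positivity)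
    refine ⟨Algebra.norm K (algebraMap K L (algebraMap k K a) - w), ?_⟩
    rw [← map_pow, sub_pow_char_pow, hw, ← map_pow, ← map_pow, ha]
  choose g hg using h1
  obtain ⟨S, hS⟩ := Infinite.exists_subset_card_eq k (p.natDegree + 1)
  set q : k[X] := Lagrange.interpolate S id g with hq
  have hpm : p.Monic := LinearMap.charpoly_monic _
  have hqp : q.map (algebraMap k K) = p := by
    have hcard : (S.map ⟨algebraMap k K, (algebraMap k K).injective⟩).card = p.natDegree + 1 := by
      rw [Finset.card_map, hS]
    refine Polynomial.eq_of_degrees_lt_of_eval_finset_eq (S.map ⟨algebraMap k K, (algebraMap k K).injective⟩) ?_ ?_ ?_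
    · rw [degree_map, hcard, ← hS]
      exact Lagrange.degree_interpolate_lt _ Function.injective_id.injOn
    · rw [hcard]
      exact degree_le_natDegree.trans_lt (by exact_mod_cast Nat.lt_succ_self _)
    · intro x hx
      obtain ⟨c, hc, rfl⟩ := Finset.mem_map.mp hx
      dsimp
      rw [eval_map_algebraMap, aeval_algebraMap_apply, ← hg]
      congr 1
      exact Lagrange.eval_interpolate_at_node g Function.injective_id.injOn hc
  have hpd : p.natDegree ≠ 0 := by
    rw [hp, LinearMap.charpoly_natDegree]
    exact Module.finrank_pos.ne'
  have hqd : q.degree ≠ 0 := by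
    intro h0
    apply hpd
    rw [← hqp, natDegree_map]
    exact natDegree_eq_of_degree_eq_some h0
  obtain ⟨c, hc⟩ := IsAlgClosed.exists_root q hqd
  refine ⟨c, ?_⟩
  have : p.eval (algebraMap k K c) = 0 := by
    rw [← hqp, eval_map_algebraMap, aeval_algebraMap_apply]
    rw [IsRoot] at hc
    rw [coe_aeval_eq_eval, hc, map_zero]
  rw [hev, Algebra.norm_eq_zero_iff, sub_eq_zero, ← IsScalarTower.algebraMap_apply] at this
  exact this

end
end HM

end

section
open Polynomial
set_option linter.unusedSectionVars false
set_option linter.style.haveILetI false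

namespace HM
noncomputable section
open scoped Classical

lemma siegel {k ι σ : Type} [Field k] [IsAlgClosed k] [Fintype ι] [Fintype σ] (w : σ → ι → k[X]) (M : ℕ) (hM : 0 < M)
    (hcard : M * Fintype.card ι < Fintype.card σ) :
    ∃ (I : ℕ) (a : Fin I × σ → k), a ≠ 0 ∧
      ∀ t : ι, ∑ p, C (a p ^ M) * (X ^ ((p.1 : ℕ) * M) * w p.2 t) = 0 := by
  set c : ℕ := (∑ s, ∑ t, (w s t).natDegree) + 1 with hc
  have hw : ∀ s t, (w s t).natDegree < c := by
    intro s t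
    have h1 := Finset.single_le_sum (f := fun t => (w s t).natDegree) (fun _ _ => Nat.zero_le _) (Finset.mem_univ t)
    have h2 := Finset.single_le_sum (f := fun s => ∑ t, (w s t).natDegree) (fun _ _ => Nat.zero_le _)
      (Finset.mem_univ s)
    exact Nat.lt_succ_of_le (h1.trans h2)
  set I : ℕ := Fintype.card ι * c + 1 with hI
  set N : ℕ := I * M + c with hN
  let A : Matrix (ι × Fin N) (Fin I × σ) k := fun tn p => (X ^ ((p.1 : ℕ) * M) * w p.2 tn.1).coeff tn.2
  have hlt : Module.finrank k (ι × Fin N → k) < Module.finrank k (Fin I × σ → k) := by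
    rw [Module.finrank_fintype_fun_eq_card, Module.finrank_fintype_fun_eq_card, Fintype.card_prod, Fintype.card_prod,
      Fintype.card_fin, Fintype.card_fin]
    have h1 : I * (M * Fintype.card ι + 1) ≤ I * Fintype.card σ := Nat.mul_le_mul_left _ hcard
    have h2 : Fintype.card ι * N + 1 = I * (M * Fintype.card ι + 1) := by
      simp only [hN, hI]; ring
    omega
  have hk := LinearMap.ker_ne_bot_of_finrank_lt (f := A.mulVecLin) hlt
  obtain ⟨b, hb, hb0⟩ := (Submodule.ne_bot_iff _).mp hk
  rw [LinearMap.mem_ker, Matrix.mulVecLin_apply] at hb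
  have hroot : ∀ p, ∃ a : k, a ^ M = b p := fun p => IsAlgClosed.exists_pow_nat_eq (b p) hM
  choose a ha using hroot
  refine ⟨I, a, ?_, ?_⟩
  · intro h
    apply hb0
    funext p
    rw [← ha p, h]
    simp [hM.ne']
  · intro t
    ext n
    rw [finsetSum_coeff, coeff_zero]
    simp only [ha, coeff_C_mul]
    by_cases hn : n < N
    · have := congrFun hb (t, ⟨n, hn⟩)
      simp only [Matrix.mulVec, dotProduct, A, Pi.zero_apply] at this
      rw [← this]
      exact Finset.sum_congr rfl fun p _ => mul_comm _ _
    · refine Finset.sum_eq_zero fun p _ => ?_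
      rw [coeff_eq_zero_of_natDegree_lt, mul_zero]
      refine (natDegree_mul_le).trans_lt ?_
      rw [natDegree_X_pow]
      have h1 := hw p.2 t
      have h2 : (p.1 : ℕ) * M ≤ I * M := Nat.mul_le_mul_right _ p.1.2.le
      omega

variable {k : Type} [Field k]

/-- bounded representatives modulo `f` -/
def Bd (f : k[X][X]) (n : ℕ) (z : AdjoinRoot f) : Prop :=
  ∃ p : k[X][X], AdjoinRoot.mk f p = z ∧ p.degree < f.degree ∧ ∀ j, (p.coeff j).natDegree ≤ n

lemma Bd.add {f : k[X][X]} {n : ℕ} {z z' : AdjoinRoot f} (h : Bd f n z) (h' : Bd f n z') : Bd f n (z + z') := by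
  obtain ⟨p, h1, h2, h3⟩ := h
  obtain ⟨p', h1', h2', h3'⟩ := h'
  refine ⟨p + p', by rw [map_add, h1, h1'], (degree_add_le _ _).trans_lt (max_lt h2 h2'), fun j => ?_⟩
  rw [coeff_add]
  exact (natDegree_add_le _ _).trans (max_le (h3 j) (h3' j))

lemma Bd.zero {f : k[X][X]} (hf : f ≠ 0) (n : ℕ) : Bd f n 0 :=
  ⟨0, map_zero _, by rw [degree_zero]; exact bot_lt_iff_ne_bot.mpr (degree_ne_bot.mpr hf), by simp⟩

lemma Bd.sum {f : k[X][X]} (hf : f ≠ 0) {n : ℕ} {σ : Type} (S : Finset σ) (z : σ → AdjoinRoot f) (h : ∀ s ∈ S, Bd f n (z s)) :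
    Bd f n (∑ s ∈ S, z s) := by
  induction S using Finset.induction_on with
  | empty => rw [Finset.sum_empty]; exact Bd.zero hf n
  | insert s S hs ih =>
    rw [Finset.sum_insert hs]
    exact (h s (Finset.mem_insert_self _ _)).add (ih fun s' hs' => h s' (Finset.mem_insert_of_mem hs'))

lemma Bd.mono {f : k[X][X]} {n m : ℕ} (hnm : n ≤ m) {z : AdjoinRoot f} (h : Bd f n z) : Bd f m z := by
  obtain ⟨p, h1, h2, h3⟩ := h
  exact ⟨p, h1, h2, fun j => (h3 j).trans hnm⟩

lemma Bd.smul {f : k[X][X]} {n a : ℕ} (c : k[X]) (hc : c.natDegree ≤ a) {z : AdjoinRoot f} (h : Bd f n z) :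
    Bd f (a + n) (AdjoinRoot.of f c * z) := by
  obtain ⟨p, h1, h2, h3⟩ := h
  refine ⟨C c * p, by rw [map_mul, AdjoinRoot.mk_C, h1], ?_, fun j => ?_⟩
  · rw [← smul_eq_C_mul]
    exact (degree_smul_le c p).trans_lt h2
  · rw [coeff_C_mul]
    exact natDegree_mul_le.trans (add_le_add hc (h3 j))

lemma Bd.root_mul {f : k[X][X]} (hf : f.Monic) {H : ℕ} (hH : ∀ j, (f.coeff j).natDegree ≤ H) {n : ℕ} {z : AdjoinRoot f}
    (h : Bd f n z) : Bd f (n + H) (AdjoinRoot.root f * z) := by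
  obtain ⟨p, h1, h2, h3⟩ := h
  have hd : f.degree = f.natDegree := degree_eq_natDegree hf.ne_zero
  by_cases hd0 : f.natDegree = 0
  · have hp : p = 0 := by
      rw [hd, hd0] at h2
      exact degree_eq_bot.mp (Nat.WithBot.lt_zero_iff.mp h2)
    rw [← h1, hp, map_zero, mul_zero]
    exact Bd.zero hf.ne_zero _
  refine ⟨X * p - C (p.coeff (f.natDegree - 1)) * f, ?_, ?_, fun j => ?_⟩
  · rw [map_sub, map_mul, map_mul, AdjoinRoot.mk_self, mul_zero, sub_zero, AdjoinRoot.mk_X, h1]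
  · rw [hd, degree_lt_iff_coeff_zero] at h2
    rw [hd, degree_lt_iff_coeff_zero]
    intro m hm
    obtain ⟨m', rfl⟩ : ∃ m', m = m' + 1 := ⟨m - 1, by omega⟩
    rw [coeff_sub, coeff_X_mul, coeff_C_mul]
    rcases Nat.lt_or_ge m' f.natDegree with hlt | hge
    · have : m' = f.natDegree - 1 := by omega
      have e : m' + 1 = f.natDegree := by omega
      rw [this, ← this, e, hf.coeff_natDegree, mul_one, sub_self]
    · rw [h2 m' hge, coeff_eq_zero_of_natDegree_lt (by omega : f.natDegree < m' + 1), mul_zero, sub_self]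
  · rw [coeff_sub]
    refine (natDegree_sub_le _ _).trans (max_le ?_ ?_)
    · cases j with
      | zero => simp
      | succ j => rw [coeff_X_mul]; exact (h3 j).trans (Nat.le_add_right _ _)
    · rw [coeff_C_mul]
      exact natDegree_mul_le.trans (add_le_add (h3 _) (hH _))

lemma Bd.root_pow {f : k[X][X]} (hf : f.Monic) (hd : 0 < f.natDegree) {H : ℕ} (hH : ∀ j, (f.coeff j).natDegree ≤ H) (n : ℕ) :
    Bd f (n * H) (AdjoinRoot.root f ^ n) := by
  induction n with
  | zero =>
    refine ⟨1, by simp, ?_, ?_⟩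
    · rw [degree_one, degree_eq_natDegree hf.ne_zero]; exact_mod_cast hd
    · intro j; rw [coeff_one]; split_ifs <;> simp
  | succ n ih =>
    rw [pow_succ', Nat.succ_mul]
    exact ih.root_mul hf hH

end
end HM

end

section
open Polynomial
set_option linter.unusedSectionVars false
set_option linter.style.haveILetI false

namespace HM
noncomputable section
open scoped Classical

variable {k : Type} [Field k]

lemma siegel_mod [IsAlgClosed k] {N ι σ : Type} [AddCommGroup N] [Module k[X] N] [Fintype ι] [Fintype σ]
    (b : Module.Basis ι k[X] N) (w : σ → N) (M : ℕ) (hM : 0 < M)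
    (hcard : M * Fintype.card ι < Fintype.card σ) :
    ∃ (I : ℕ) (a : Fin I × σ → k), a ≠ 0 ∧ ∑ p, (C (a p ^ M) * X ^ ((p.1 : ℕ) * M)) • w p.2 = 0 := by
  obtain ⟨I, a, ha, h⟩ := siegel (fun s t => b.repr (w s) t) M hM hcard
  refine ⟨I, a, ha, ?_⟩
  apply b.repr.injective
  ext1 t
  rw [map_sum, map_zero, Finsupp.finset_sum_apply, Finsupp.zero_apply, ← h t]
  refine Finset.sum_congr rfl fun p _ => ?_
  rw [map_smul, Finsupp.smul_apply, smul_eq_mul, mul_assoc]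

lemma relation [IsAlgClosed k] {f : k[X][X]} (hf : f.Monic) (hd : 0 < f.natDegree) (K M : ℕ) (hM : 0 < M)
    (hKM : M * (f.natDegree - 1) < f.natDegree * K) :
    ∃ (I : ℕ) (a : Fin I × (Fin f.natDegree × Fin K × Fin f.natDegree) → k), a ≠ 0 ∧
      ∀ x η η' : k, f.eval₂ (evalRingHom x) η = 0 → f.eval₂ (evalRingHom x) η' = 0 → η ≠ η' →
        ∑ p, a p ^ M * x ^ ((p.1 : ℕ) * M) *
          (η ^ ((p.2.1 : ℕ) * M) * x ^ (p.2.2.1 : ℕ) * η' ^ (p.2.2.2 : ℕ)) = 0 := by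
  have hdeg : f.degree ≠ 0 := by
    rw [degree_eq_natDegree hf.ne_zero]; exact_mod_cast hd.ne'
  haveI : Nontrivial (AdjoinRoot f) := AdjoinRoot.nontrivial f hdeg
  set y : AdjoinRoot f := AdjoinRoot.root f with hy
  set E : Polynomial (AdjoinRoot f) := (f.map (AdjoinRoot.of f)) /ₘ (X - C y) with hE
  have hmul : (X - C y) * E = f.map (AdjoinRoot.of f) := by
    rw [hE, mul_divByMonic_eq_iff_isRoot]
    exact AdjoinRoot.isRoot_root f
  have hEm : E.Monic := (monic_X_sub_C y).of_mul_monic_left (hmul ▸ hf.map _)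
  have hEd : E.natDegree = f.natDegree - 1 := by
    rw [hE, natDegree_divByMonic _ (monic_X_sub_C y), natDegree_X_sub_C, hf.natDegree_map]
  let b := (AdjoinRoot.powerBasis' hf).basis.smulTower (AdjoinRoot.powerBasis' hEm).basis
  obtain ⟨I, a, ha, h⟩ := siegel_mod b (σ := Fin f.natDegree × Fin K × Fin f.natDegree)
    (fun s => AdjoinRoot.of E (y ^ ((s.1 : ℕ) * M) * AdjoinRoot.of f (X ^ (s.2.1 : ℕ))) * AdjoinRoot.root E ^ (s.2.2 : ℕ)) M hM (by
      simp only [Fintype.card_prod, Fintype.card_fin, AdjoinRoot.powerBasis'_dim, hEd]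
      nlinarith)
  refine ⟨I, a, ha, ?_⟩
  intro x η η' h1 h2 hne
  let ev : AdjoinRoot f →+* k := AdjoinRoot.lift (evalRingHom x) η h1
  have hE0 : E.eval₂ ev η' = 0 := by
    have e := congrArg (eval₂ ev η') hmul
    rw [eval₂_mul, eval₂_sub, eval₂_X, eval₂_C, eval₂_map] at e
    have e2 : ev.comp (AdjoinRoot.of f) = evalRingHom x := by
      ext1 <;> simp [ev]
    rw [e2, h2, AdjoinRoot.lift_root] at e
    rcases mul_eq_zero.mp e with h | h
    · exact absurd (sub_eq_zero.mp h).symm hne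
    · exact h
  let ψ : AdjoinRoot E →+* k := AdjoinRoot.lift ev η' hE0
  have h3 := congrArg ψ h
  rw [map_sum, map_zero] at h3
  rw [← h3]
  refine Finset.sum_congr rfl fun p _ => ?_
  rw [Algebra.smul_def, map_mul]
  have e : algebraMap k[X] (AdjoinRoot E) = (AdjoinRoot.of E).comp (AdjoinRoot.of f) := rfl
  simp [e, ψ, ev, hy, mul_assoc]

end
end HM

end

section
open Polynomial
set_option linter.unusedSectionVars false
set_option linter.style.haveILetI false

namespace HM
noncomputable section
open scoped Classical

variable {k : Type} [Field k]

lemma linind_L {L : Type} [Field L] [Algebra k L] [Algebra (RatFunc k) L] [IsScalarTower k (RatFunc k) L]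
    {d : ℕ} (y : L) (hy : LinearIndependent (RatFunc k) (fun j : Fin d => y ^ (j : ℕ))) (I : ℕ) :
    LinearIndependent k (fun p : Fin I × Fin d => algebraMap (RatFunc k) L (RatFunc.X ^ (p.1 : ℕ)) * y ^ (p.2 : ℕ)) := by
  rw [Fintype.linearIndependent_iff]
  intro c hc p
  rw [Fintype.sum_prod_type_right] at hc
  have h1 := Fintype.linearIndependent_iff.mp hy (fun j => ∑ i : Fin I, algebraMap k[X] (RatFunc k) (C (c (i, j)) * X ^ (i : ℕ)))
    (by
      rw [← hc]
      refine Finset.sum_congr rfl fun j _ => ?_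
      rw [Finset.sum_smul]
      refine Finset.sum_congr rfl fun i _ => ?_
      rw [Algebra.smul_def, Algebra.smul_def, map_mul, map_mul, map_pow, RatFunc.algebraMap_X,
        IsScalarTower.algebraMap_apply k (RatFunc k) L, mul_assoc]
      rfl) p.2
  rw [← map_sum, ← (algebraMap k[X] (RatFunc k)).map_zero] at h1
  have h2 := congrArg (fun q => q.coeff (p.1 : ℕ)) (IsFractionRing.injective k[X] (RatFunc k) h1)
  simp only [finsetSum_coeff, coeff_C_mul, coeff_X_pow, coeff_zero] at h2
  rw [Finset.sum_eq_single p.1] at h2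
  · simpa using h2
  · intro i _ hi
    rw [if_neg (fun h => hi (Fin.ext h.symm)), mul_zero]
  · intro h; exact absurd (Finset.mem_univ _) h

lemma nonvanish [IsAlgClosed k] [CharP k 2] {f : k[X][X]} (hf : f.Monic) (hirr : Irreducible f) (I K : ℕ) :
    ∃ e0, ∀ e, e0 ≤ e → ∀ a : Fin I × (Fin f.natDegree × Fin K × Fin f.natDegree) → k,
      ∑ p, AdjoinRoot.of f (C (a p) * X ^ (p.1 : ℕ)) * AdjoinRoot.root f ^ (p.2.1 : ℕ) *
        (AdjoinRoot.of f (X ^ (p.2.2.1 : ℕ)) * AdjoinRoot.root f ^ (p.2.2.2 : ℕ)) ^ 2 ^ e = 0 → a = 0 := by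
  set F : Polynomial (RatFunc k) := f.map (algebraMap k[X] (RatFunc k)) with hF
  have hFi : Irreducible F := (hf.irreducible_iff_irreducible_map_fraction_map).mp hirr
  have hFm : F.Monic := hf.map _
  have hFd : F.natDegree = f.natDegree := hf.natDegree_map _
  haveI : Fact (Irreducible F) := ⟨hFi⟩
  set L := AdjoinRoot F
  haveI : FiniteDimensional (RatFunc k) L := (AdjoinRoot.powerBasis hFi.ne_zero).finite
  haveI : CharP L 2 := charP_of_injective_algebraMap (algebraMap k L).injective 2
  set y : L := AdjoinRoot.root F
  have hy : LinearIndependent (RatFunc k) (fun j : Fin f.natDegree => y ^ (j : ℕ)) := by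
    have h := (AdjoinRoot.powerBasis' hFm).basis.linearIndependent
    rw [PowerBasis.coe_basis] at h
    have e : f.natDegree = (AdjoinRoot.powerBasis' hFm).dim := by rw [AdjoinRoot.powerBasis'_dim, hFd]
    have := h.comp (Fin.cast e) (Fin.cast_injective e)
    simpa [Function.comp_def] using this
  let φ : AdjoinRoot f →+* L := AdjoinRoot.lift ((algebraMap (RatFunc k) L).comp (algebraMap k[X] (RatFunc k))) y (by
    have := AdjoinRoot.eval₂_root F
    rw [hF, eval₂_map] at this
    exact this)
  have hφ : ∀ c : k[X], φ (AdjoinRoot.of f c) = algebraMap (RatFunc k) L (algebraMap k[X] (RatFunc k) c) :=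
    fun c => AdjoinRoot.lift_of _
  have hφC : ∀ c : k, φ (AdjoinRoot.of f (C c)) = algebraMap k L c := by
    intro c
    rw [hφ, IsScalarTower.algebraMap_apply k (RatFunc k) L, IsScalarTower.algebraMap_apply k k[X] (RatFunc k),
      algebraMap_eq]
  have hφX : φ (AdjoinRoot.of f X) = algebraMap (RatFunc k) L RatFunc.X := by
    rw [hφ, RatFunc.algebraMap_X]
  have hφy : φ (AdjoinRoot.root f) = y := AdjoinRoot.lift_root _
  have li := linind_L y hy
  let σ := Fin I × Fin f.natDegree
  let eq := Fintype.equivFin σ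
  obtain ⟨e0, h0⟩ := indep_pow (k := k) (L := L) (fun z hz => const_of_roots z hz) _
    (fun s => algebraMap (RatFunc k) L (RatFunc.X ^ ((eq.symm s).1 : ℕ)) * y ^ ((eq.symm s).2 : ℕ))
    ((li I).comp _ eq.symm.injective)
  refine ⟨e0, fun e he a ha => ?_⟩
  have hroot : ∀ p, ∃ b : k, b ^ 2 ^ e = a p := fun p => IsAlgClosed.exists_pow_nat_eq (a p) (by positivity)
  choose b hb using hroot
  let u : σ → L := fun ij => ∑ kl : Fin K × Fin f.natDegree, b (ij.1, (ij.2, kl)) •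
    (algebraMap (RatFunc k) L (RatFunc.X ^ (kl.1 : ℕ)) * y ^ (kl.2 : ℕ))
  have hrel : ∑ ij : σ, (algebraMap (RatFunc k) L (RatFunc.X ^ (ij.1 : ℕ)) * y ^ (ij.2 : ℕ)) * u ij ^ 2 ^ e = 0 := by
    rw [← map_zero φ, ← ha, map_sum, Fintype.sum_prod_type, Fintype.sum_prod_type]
    refine Finset.sum_congr rfl fun i _ => ?_
    rw [Fintype.sum_prod_type]
    refine Finset.sum_congr rfl fun j _ => ?_
    simp only [u]
    rw [sum_pow_char_pow, Finset.mul_sum]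
    refine Finset.sum_congr rfl fun kl _ => ?_
    simp only [map_mul, map_pow, hφC, hφX, hφy, ← hb, Algebra.smul_def, mul_pow]
    ring
  have hu := h0 e he (fun s => u (eq.symm s)) (by
    rw [← hrel]
    exact Equiv.sum_comp eq.symm (fun ij : σ => (algebraMap (RatFunc k) L (RatFunc.X ^ (ij.1 : ℕ)) * y ^ (ij.2 : ℕ)) * u ij ^ 2 ^ e))
  funext p
  have h1 : u (p.1, p.2.1) = 0 := by
    have := congrFun hu (eq (p.1, p.2.1))
    simpa using this
  have h2 := Fintype.linearIndependent_iff.mp (li K) _ h1 p.2.2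
  rw [← hb p]
  have h3 : b p = 0 := h2
  rw [h3]
  simp

end
end HM

end

section
open Polynomial
set_option linter.unusedSectionVars false
set_option linter.style.haveILetI false

namespace HM
noncomputable section
open scoped Classical

variable {k : Type} [Field k]

lemma frob_eval [CharP k 2] {f : k[X][X]} (hfix : f.map (mapRingHom (frobenius k 2)) = f) (x η : k)
    (h : f.eval₂ (evalRingHom x) η = 0) : f.eval₂ (evalRingHom (x ^ 2)) (η ^ 2) = 0 := by
  have h1 := hom_eval₂ f (evalRingHom x) (frobenius k 2) η
  rw [h, map_zero] at h1
  have e : (frobenius k 2).comp (evalRingHom x) = (evalRingHom (x ^ 2)).comp (mapRingHom (frobenius k 2)) := by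
    ext1
    · ext1 c; simp [frobenius_def]
    · simp [frobenius_def]
  rw [e, ← eval₂_map, hfix, frobenius_def] at h1
  exact h1.symm

lemma frob_eval_pow [CharP k 2] {f : k[X][X]} (hfix : f.map (mapRingHom (frobenius k 2)) = f) (x η : k)
    (h : f.eval₂ (evalRingHom x) η = 0) (m : ℕ) : f.eval₂ (evalRingHom (x ^ 2 ^ m)) (η ^ 2 ^ m) = 0 := by
  induction m with
  | zero => simpa using h
  | succ m ih =>
    have := frob_eval hfix _ _ ih
    rwa [← pow_mul, ← pow_mul, ← pow_succ] at this

lemma card_Fq [IsAlgClosed k] [CharP k 2] {m : ℕ} (hm : 0 < m) :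
    ∃ S : Finset k, S.card = 2 ^ m ∧ ∀ x ∈ S, x ^ 2 ^ m = x := by
  have hq : 1 < 2 ^ m := Nat.one_lt_two_pow hm.ne'
  have hsep : (X ^ 2 ^ m - X : k[X]).Separable := galois_poly_separable 2 _ (dvd_pow_self 2 hm.ne')
  have h0 := FiniteField.X_pow_card_sub_X_ne_zero k hq
  refine ⟨(X ^ 2 ^ m - X : k[X]).roots.toFinset, ?_, ?_⟩
  · rw [Multiset.toFinset_card_of_nodup (nodup_roots hsep), ← (IsAlgClosed.splits _).natDegree_eq_card_roots,
      FiniteField.X_pow_card_sub_X_natDegree_eq k hq]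
  · intro x hx
    rw [Multiset.mem_toFinset, mem_roots h0] at hx
    simpa [IsRoot, sub_eq_zero] using hx

theorem stepanov [IsAlgClosed k] [CharP k 2] {f : k[X][X]} (hf : f.Monic) (hirr : Irreducible f)
    (hfix : f.map (mapRingHom (frobenius k 2)) = f) (U : Finset k)
    (hsep : ∀ x, x ∉ U → (f.map (evalRingHom x)).Separable) :
    ∃ m0, ∀ m, m0 ≤ m → ∃ x, x ∉ U ∧ ∃ η, x ^ 2 ^ m = x ∧ η ^ 2 ^ m = η ∧ f.eval₂ (evalRingHom x) η = 0 := by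
  have hd : 0 < f.natDegree := by
    rcases Nat.eq_zero_or_pos f.natDegree with h | h
    · exact absurd ((Polynomial.Monic.natDegree_eq_zero hf).mp h ▸ isUnit_one) hirr.not_isUnit
    · exact h
  obtain ⟨H, hH⟩ : ∃ H, ∀ j, (f.coeff j).natDegree ≤ H := by
    refine ⟨∑ j ∈ f.support, (f.coeff j).natDegree, fun j => ?_⟩
    by_cases hj : j ∈ f.support
    · exact Finset.single_le_sum (f := fun j => (f.coeff j).natDegree) (fun _ _ => Nat.zero_le _) hj
    · rw [notMem_support_iff.mp hj]; simp
  set d := f.natDegree with hdd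
  set μ := d * (d * H + 1) + d * H + 1 with hμ
  have hMμ : μ < 2 ^ μ := Nat.lt_two_pow_self
  obtain ⟨K, hK⟩ : ∃ K, 2 ^ μ = K + (d * H + 1) := ⟨2 ^ μ - (d * H + 1), by omega⟩
  have hKM : 2 ^ μ * (d - 1) < d * K := by
    have h1 : d * (d * H + 1) < K := by omega
    obtain ⟨d', hd'⟩ : ∃ d', d = d' + 1 := ⟨d - 1, by omega⟩
    rw [hK, hd', Nat.add_sub_cancel]
    rw [hd'] at h1
    nlinarith
  obtain ⟨I, a, ha, hrel⟩ := relation hf hd K (2 ^ μ) (by positivity) hKM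
  obtain ⟨e0, he0⟩ := nonvanish hf hirr I K
  refine ⟨μ + (e0 + I + d * H + U.card + 1), fun m hm => ?_⟩
  by_contra hcon
  push Not at hcon
  obtain ⟨e, rfl⟩ : ∃ e, m = e + μ := ⟨m - μ, by omega⟩
  apply ha
  apply he0 e (by omega)
  set θ : AdjoinRoot f := ∑ p : Fin I × (Fin d × Fin K × Fin d), AdjoinRoot.of f (C (a p) * X ^ (p.1 : ℕ)) * AdjoinRoot.root f ^ (p.2.1 : ℕ) *
        (AdjoinRoot.of f (X ^ (p.2.2.1 : ℕ)) * AdjoinRoot.root f ^ (p.2.2.2 : ℕ)) ^ 2 ^ e with hθ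
  have hB : Bd f (I + d * H + (K + d * H) * 2 ^ e) θ := by
    refine Bd.sum hf.ne_zero _ _ fun p _ => ?_
    have e1 : AdjoinRoot.of f (C (a p) * X ^ (p.1 : ℕ)) * AdjoinRoot.root f ^ (p.2.1 : ℕ) *
        (AdjoinRoot.of f (X ^ (p.2.2.1 : ℕ)) * AdjoinRoot.root f ^ (p.2.2.2 : ℕ)) ^ 2 ^ e
        = AdjoinRoot.of f (C (a p) * X ^ ((p.1 : ℕ) + p.2.2.1 * 2 ^ e)) * AdjoinRoot.root f ^ ((p.2.1 : ℕ) + p.2.2.2 * 2 ^ e) := by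
      simp only [map_mul, map_pow]
      ring
    rw [e1]
    refine Bd.mono ?_ (Bd.smul _ (natDegree_C_mul_X_pow_le _ _) (Bd.root_pow hf hd hH _))
    have h1 : (p.1 : ℕ) ≤ I := p.1.2.le
    have h2 : (p.2.1 : ℕ) ≤ d := p.2.1.2.le
    have h3 : (p.2.2.1 : ℕ) ≤ K := p.2.2.1.2.le
    have h4 : (p.2.2.2 : ℕ) ≤ d := p.2.2.2.2.le
    calc (p.1 : ℕ) + p.2.2.1 * 2 ^ e + ((p.2.1 : ℕ) + p.2.2.2 * 2 ^ e) * H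
        ≤ I + K * 2 ^ e + (d + d * 2 ^ e) * H := by gcongr
      _ = _ := by ring
  obtain ⟨p, hp1, hp2, hp3⟩ := hB
  have hpd : p.natDegree < d := by
    by_cases h0 : p = 0
    · rw [h0]; simpa using hd
    · exact natDegree_lt_natDegree h0 hp2
  obtain ⟨S, hScard, hS⟩ := card_Fq (k := k) (m := e + μ) (by omega)
  have hvan : ∀ x ∈ S \ U, p.map (evalRingHom x) = 0 := by
    intro x hx
    rw [Finset.mem_sdiff] at hx
    have hxq := hS x hx.1
    have hs := hsep x hx.2
    have hfm : (f.map (evalRingHom x)).Monic := hf.map _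
    refine eq_zero_of_natDegree_lt_card_of_eval_eq_zero' _ (f.map (evalRingHom x)).roots.toFinset ?_ ?_
    · intro η hη
      rw [Multiset.mem_toFinset, mem_roots hfm.ne_zero, IsRoot, eval_map] at hη
      rw [eval_map]
      have hne := hcon x hx.2 η hxq
      have hη' := frob_eval_pow hfix x η hη (e + μ)
      rw [hxq] at hη'
      have hneq : η ≠ η ^ 2 ^ (e + μ) := fun h => hne h.symm hη
      have hr := hrel x η _ hη hη' hneq
      let ev : AdjoinRoot f →+* k := AdjoinRoot.lift (evalRingHom x) η hη
      have hevp : p.eval₂ (evalRingHom x) η = ev θ := by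
        rw [← hp1]; exact (AdjoinRoot.lift_mk hη p).symm
      rw [hevp]
      refine pow_eq_zero_iff (n := 2 ^ μ) (by positivity) |>.mp ?_
      rw [hθ, map_sum, sum_pow_char_pow, ← hr]
      refine Finset.sum_congr rfl fun p _ => ?_
      have e1 : ∀ c : k[X], ev (AdjoinRoot.of f c) = c.eval x := fun c => AdjoinRoot.lift_of hη
      have e2 : ev (AdjoinRoot.root f) = η := AdjoinRoot.lift_root hη
      simp only [map_mul, map_pow, e1, e2, eval_C, eval_X]
      have e3 : x ^ (p.2.2.1 : ℕ) = ((x ^ (p.2.2.1 : ℕ)) ^ 2 ^ e) ^ 2 ^ μ := by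
        rw [← pow_mul, ← pow_mul, ← pow_add, mul_comm, pow_mul, hxq]
      have e4 : (η ^ 2 ^ (e + μ)) ^ (p.2.2.2 : ℕ) = ((η ^ (p.2.2.2 : ℕ)) ^ 2 ^ e) ^ 2 ^ μ := by
        rw [pow_add]; ring
      simp only [mul_pow]
      rw [e4, ← e3, pow_mul, pow_mul]
      ring
    · rw [Multiset.toFinset_card_of_nodup (nodup_roots hs), ← (IsAlgClosed.splits _).natDegree_eq_card_roots,
        hf.natDegree_map]
      exact natDegree_map_le.trans_lt hpd
  have hp0 : p = 0 := by
    ext1 j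
    rw [coeff_zero]
    refine eq_zero_of_natDegree_lt_card_of_eval_eq_zero' _ (S \ U) ?_ ?_
    · intro x hx
      have := congrArg (fun r => r.coeff j) (hvan x hx)
      simpa [coeff_map] using this
    · refine (hp3 j).trans_lt ?_
      have h1 := Finset.le_card_sdiff U S
      have h2 : 2 ^ (e + μ) = (K + d * H) * 2 ^ e + 2 ^ e := by
        rw [pow_add, hK]; ring
      have h3 : e < 2 ^ e := Nat.lt_two_pow_self
      omega
  rw [← hp1, hp0, map_zero]

end
end HM

end

section
open Polynomial
set_option linter.unusedSectionVars false
set_option linter.style.haveILetI false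



namespace HM
noncomputable section
open scoped Classical

variable {k : Type} [Field k]

lemma sep_off [IsAlgClosed k] [CharP k 2] {i l : ℕ} (hl : Odd l) (hl3 : 3 ≤ l) (hi : 1 ≤ i) {D : k[X][X]} (hD : IsComp i l D) (x : k)
    (hx : ∀ z, (hc k l).eval z = 0 → (gp k (2 ^ i) l).eval x ≠ (gp k (2 ^ i) l).eval z) :
    (D.map (evalRingHom x)).Separable := by
  have h1 : D.map (evalRingHom x) ∣ (FF k i l).map (evalRingHom x) := Polynomial.map_dvd _ hD.2.2
  have h2 : (FF k i l).map (evalRingHom x) = gp k (2 ^ i) l - C ((gp k (2 ^ i) l).eval x) := by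
    rw [FF, Polynomial.map_sub, map_C, Polynomial.map_map]
    have : (evalRingHom x).comp (C : k →+* k[X]) = RingHom.id k := by ext c; simp
    rw [this, Polynomial.map_id]
    simp
  rw [h2] at h1
  refine Separable.of_dvd ?_ h1
  rw [Separable, derivative_sub, derivative_C, sub_zero, derivative_gp hl hi]
  refine IsCoprime.pow_right ?_
  rw [Polynomial.isCoprime_iff_aeval_ne_zero_of_isAlgClosed k k]
  intro z
  by_cases hz : (hc k l).eval z = 0
  · left
    simp only [coe_aeval_eq_eval, eval_sub, eval_C]
    rw [sub_ne_zero]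
    exact (hx z hz).symm
  · right
    simpa [coe_aeval_eq_eval] using hz

lemma not_T0 {i l : ℕ} {D : k[X][X]} (hD : IsComp i l D) {c : k} (h : D ≠ T0 k c) : D.eval (X + C c) ≠ 0 := by
  intro h0
  apply h
  have h1 : T0 k c ∣ D := dvd_iff_isRoot.mpr h0
  have h2 : Associated (T0 k c) D := (irreducible_X_sub_C (X + C c : k[X])).associated_of_dvd hD.2.1 h1
  exact (eq_of_monic_of_associated (monic_X_sub_C _) hD.1 h2).symm

lemma three_sols [IsAlgClosed k] [CharP k 2] {i l : ℕ} (hl : Odd l) (hl3 : 3 ≤ l) (hi : 1 ≤ i) (hK : l ≠ 2 ^ i - 1) :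
    ∃ m0, ∀ m, m0 ≤ m → ∃ x η : k, x ^ 2 ^ m = x ∧ η ^ 2 ^ m = η ∧ η ≠ x ∧ η ≠ x + 1 ∧
      (gp k (2 ^ i) l).eval η = (gp k (2 ^ i) l).eval x := by
  obtain ⟨D, hD, h0, h1, hτ⟩ := part_one hl hl3 hi hK (frobeniusEquiv k 2)
  have hfix : D.map (mapRingHom (frobenius k 2)) = D := hτ
  set U : Finset k := ((hc k l).roots.toFinset.biUnion
    (fun z => (gp k (2 ^ i) l - C ((gp k (2 ^ i) l).eval z)).roots.toFinset)) ∪ (D.eval (X + C 0)).roots.toFinset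
      ∪ (D.eval (X + C 1)).roots.toFinset with hU
  have hne : ∀ c : k, gp k (2 ^ i) l - C c ≠ 0 := by
    intro c h
    have h2 := congrArg derivative h
    rw [derivative_sub, derivative_C, sub_zero, derivative_gp hl hi, derivative_zero] at h2
    exact (hc_monic hl hl3).1.ne_zero (pow_eq_zero_iff (by positivity) |>.mp h2)
  obtain ⟨m0, hm0⟩ := stepanov hD.1 hD.2.1 hfix U (by
    intro x hx
    apply sep_off hl hl3 hi hD
    intro z hz he
    apply hx
    simp only [hU, Finset.mem_union, Finset.mem_biUnion, Multiset.mem_toFinset]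
    refine Or.inl (Or.inl ⟨z, ?_, ?_⟩)
    · rw [mem_roots (hc_monic hl hl3).1.ne_zero]; exact hz
    · rw [mem_roots (hne _), IsRoot, eval_sub, eval_C, he, sub_self])
  refine ⟨m0, fun m hm => ?_⟩
  obtain ⟨x, hx, η, hxq, hηq, hf⟩ := hm0 m hm
  have key : ∀ c : k, x ∉ (D.eval (X + C c)).roots.toFinset → D ≠ T0 k c → η ≠ x + c := by
    intro c hx h he
    apply hx
    rw [Multiset.mem_toFinset, mem_roots (not_T0 hD h), IsRoot]
    have := hom_eval₂ D (RingHom.id _) (evalRingHom x) (X + C c)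
    rw [eval₂_id, RingHom.comp_id] at this
    simp only [coe_evalRingHom, eval_add, eval_X, eval_C] at this
    rw [this, ← he]
    exact hf
  simp only [hU, Finset.mem_union, not_or] at hx
  refine ⟨x, η, hxq, hηq, ?_, key 1 hx.2 h1, ?_⟩
  · have := key 0 hx.1.2 h0; rwa [add_zero] at this
  · obtain ⟨G, hG⟩ := hD.2.2
    have h3 : (FF k i l).eval₂ (evalRingHom x) η = 0 := by rw [hG, eval₂_mul, hf, zero_mul]
    rw [FF, eval₂_sub, eval₂_C, eval₂_map] at h3
    have : (evalRingHom x).comp (C : k →+* k[X]) = RingHom.id k := by ext c; simp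
    rw [this] at h3
    exact sub_eq_zero.mp h3

lemma lift_GF {m : ℕ} (hm : m ≠ 0) [IsAlgClosed k] [CharP k 2] (ι : GaloisField 2 m →+* k) (z : k) (hz : z ^ 2 ^ m = z) :
    ∃ w, ι w = z := by
  haveI : Fintype (GaloisField 2 m) := Fintype.ofFinite _
  have hcard : Fintype.card (GaloisField 2 m) = 2 ^ m := by
    rw [← Nat.card_eq_fintype_card, GaloisField.card 2 m hm]
  have hq : 1 < 2 ^ m := Nat.one_lt_two_pow hm
  have h0 := FiniteField.X_pow_card_sub_X_ne_zero k hq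
  have hmem : ∀ w : k, w ∈ (X ^ 2 ^ m - X : k[X]).roots.toFinset ↔ w ^ 2 ^ m = w := by
    intro w
    rw [Multiset.mem_toFinset, mem_roots h0]
    simp [IsRoot, sub_eq_zero]
  have hsub : Finset.univ.image ι ⊆ (X ^ 2 ^ m - X : k[X]).roots.toFinset := by
    intro w hw
    obtain ⟨v, -, rfl⟩ := Finset.mem_image.mp hw
    rw [hmem, ← map_pow, ← hcard, FiniteField.pow_card]
  have heq := Finset.eq_of_subset_of_card_le hsub (by
    rw [Finset.card_image_of_injective _ ι.injective, Finset.card_univ, hcard]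
    refine (Multiset.toFinset_card_le _).trans ((card_roots' _).trans ?_)
    rw [FiniteField.X_pow_card_sub_X_natDegree_eq k hq])
  have := (hmem z).mpr hz
  rw [← heq] at this
  obtain ⟨w, -, hw⟩ := Finset.mem_image.mp this
  exact ⟨w, hw⟩

lemma not_APN {i l m : ℕ} (hm : m ≠ 0) [IsAlgClosed k] [CharP k 2] [Algebra (ZMod 2) k] {x η : k}
    (hx : x ^ 2 ^ m = x) (hη : η ^ 2 ^ m = η) (h0 : η ≠ x) (h1 : η ≠ x + 1)
    (hg : (gp k (2 ^ i) l).eval η = (gp k (2 ^ i) l).eval x) :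
    ¬ IsAPN (fun x : GaloisField 2 m => x ^ (2 ^ i * l + 1)) := by
  intro hA
  let ι : GaloisField 2 m →+* k := (IsAlgClosed.lift : GaloisField 2 m →ₐ[ZMod 2] k)
  obtain ⟨x', rfl⟩ := lift_GF hm ι x hx
  obtain ⟨η', rfl⟩ := lift_GF hm ι η hη
  have h2 : (2 : GaloisField 2 m) = 0 := CharTwo.two_eq_zero
  have e : (η' + 1) ^ (2 ^ i * l + 1) + η' ^ (2 ^ i * l + 1) = (x' + 1) ^ (2 ^ i * l + 1) + x' ^ (2 ^ i * l + 1) := by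
    apply ι.injective
    simpa [gp] using hg
  have h := hA 1 ((x' + 1) ^ (2 ^ i * l + 1) + x' ^ (2 ^ i * l + 1)) one_ne_zero
  have hsub : (({x', x' + 1, η'} : Finset (GaloisField 2 m)) : Set (GaloisField 2 m)) ⊆
      {x | (fun x : GaloisField 2 m => x ^ (2 ^ i * l + 1)) (x + 1) + (fun x : GaloisField 2 m => x ^ (2 ^ i * l + 1)) x
        = (x' + 1) ^ (2 ^ i * l + 1) + x' ^ (2 ^ i * l + 1)} := by
    intro z hz
    simp only [Finset.coe_insert, Finset.coe_singleton, Set.mem_insert_iff, Set.mem_singleton_iff] at hz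
    rw [Set.mem_setOf_eq]
    rcases hz with rfl | rfl | rfl
    · rfl
    · dsimp only
      rw [show x' + 1 + 1 = x' by linear_combination h2, add_comm]
    · exact e
  have h3 := Set.ncard_le_ncard hsub (Set.toFinite _)
  rw [Set.ncard_coe_finset, Finset.card_eq_three.mpr ⟨x', x' + 1, η', ?_, ?_, ?_, rfl⟩] at h3
  · exact absurd (h3.trans h) (by norm_num)
  · simp
  · rintro rfl; exact h0 rfl
  · rintro rfl; apply h1; simp

end
end HM

end

/-- Hernando–McGuire: Let `t ≥ 3` be odd, neither a Gold number `2^k + 1` nor a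
Kasami–Welch number `2^(2k) - 2^k + 1` for any `k ≥ 1`.  Then `x ↦ x^t` is not exceptional
APN: it is APN on `F_{2^m}` for only finitely many `m ≥ 1`. -/
theorem monomial_not_gold_kasami_not_exceptional_APN (t : ℕ) (ht3 : 3 ≤ t) (htodd : Odd t)
    (hgold : ¬ ∃ k : ℕ, 1 ≤ k ∧ t = 2 ^ k + 1)
    (hkasami : ¬ ∃ k : ℕ, 1 ≤ k ∧ t = 2 ^ (2 * k) - 2 ^ k + 1) :
    {m : ℕ | 1 ≤ m ∧ IsAPN (fun x : GaloisField 2 m => x ^ t)}.Finite := by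
  obtain ⟨i, l, hl, htl⟩ := Nat.exists_eq_two_pow_mul_odd (n := t - 1) (by omega)
  obtain rfl : t = 2 ^ i * l + 1 := by omega
  have hi : 1 ≤ i := by
    by_contra h
    have hi0 : i = 0 := by omega
    subst hi0
    obtain ⟨r, hr⟩ := htodd
    obtain ⟨r', hr'⟩ := hl
    omega
  have hl1 : l ≠ 1 := by
    rintro rfl
    exact hgold ⟨i, hi, by rw [mul_one]⟩
  have hl3 : 3 ≤ l := by
    obtain ⟨r, hr⟩ := hl
    omega
  have hK : l ≠ 2 ^ i - 1 := by
    intro h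
    refine hkasami ⟨i, hi, ?_⟩
    rw [h, Nat.mul_sub, mul_one, ← pow_add, two_mul]
  obtain ⟨m0, hm0⟩ := HM.three_sols (k := AlgebraicClosure (ZMod 2)) hl hl3 hi hK
  refine (Set.finite_lt_nat m0).subset ?_
  rintro m ⟨hm, hA⟩
  rw [Set.mem_setOf_eq]
  by_contra hlt
  obtain ⟨x, η, hx, hη, h0, h1, hg⟩ := hm0 m (not_lt.mp hlt)
  exact HM.not_APN (k := AlgebraicClosure (ZMod 2)) (by omega) hx hη h0 h1 hg hA
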